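/- Every tiling of the Euclidean plane by convex polygons that is monocoronal up to rigid motions is crystallographic, i.e. 2-periodic: its symmetry group contains translations by two linearly independent vectors. -/

import Mathlib

noncomputable section

open Set

abbrev E2 := EuclideanSpace ℝ (Fin 2)

/-- A convex polygon: a compact convex subset of the plane with nonempty interior
and finitely many extreme points. -/
def IsConvexPolygon (P : Set E2) : Prop :=
  IsCompact P ∧ Convex ℝ P ∧ (interior P).Nonempty ∧ (Set.extremePoints ℝ P).Finite

/-- A tiling of the plane by convex polygons. -/
def IsTiling (T : Set (Set E2)) : Prop :=
  T.Countable ∧ (∀ P ∈ T, IsConvexPolygon P) ∧ (⋃₀ T = Set.univ) ∧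
    T.Pairwise fun P Q => Disjoint (interior P) (interior Q)

/-- A vertex of a tiling: an extreme point of at least one tile. -/
def IsVertex (T : Set (Set E2)) (x : E2) : Prop :=
  ∃ P ∈ T, x ∈ Set.extremePoints ℝ P

/-- An isometry of the plane is orientation preserving if its linear part has
determinant `1`. -/
def OrientationPreserving (f : E2 ≃ᵃⁱ[ℝ] E2) : Prop :=
  LinearMap.det (f.linearIsometryEquiv.toLinearEquiv : E2 →ₗ[ℝ] E2) = 1

/-- Monocoronal up to rigid motions: any two vertex coronae are directly congruent. -/
def MonocoronalRM (T : Set (Set E2)) : Prop :=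
  ∀ x y : E2, IsVertex T x → IsVertex T y →
    ∃ f : E2 ≃ᵃⁱ[ℝ] E2, OrientationPreserving f ∧ f x = y ∧
      (fun P => f '' P) '' {P | P ∈ T ∧ x ∈ P} = {P | P ∈ T ∧ y ∈ P}

/-- A symmetry of a tiling: an isometry mapping the set of tiles onto itself. -/
def IsSymmetry (T : Set (Set E2)) (f : E2 ≃ᵃⁱ[ℝ] E2) : Prop :=
  (fun P => f '' P) '' T = T

/-- The set of translation vectors of a tiling. -/
def periodVectors (T : Set (Set E2)) : Set E2 :=
  {v | IsSymmetry T (AffineIsometryEquiv.constVAdd ℝ E2 v)}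

namespace MC

/-- planar cross product -/
def cr (a b : ℂ) : ℝ := a.re * b.im - a.im * b.re

lemma cr_self (a : ℂ) : cr a a = 0 := by unfold cr; ring
lemma cr_swap (a b : ℂ) : cr a b = - cr b a := by unfold cr; ring
lemma cr_add_right (a b c : ℂ) : cr a (b + c) = cr a b + cr a c := by unfold cr; simp; ring
lemma cr_add_left (a b c : ℂ) : cr (a + b) c = cr a c + cr b c := by unfold cr; simp; ring
lemma cr_sub_right (a b c : ℂ) : cr a (b - c) = cr a b - cr a c := by unfold cr; simp; ring
lemma cr_sub_left (a b c : ℂ) : cr (a - b) c = cr a c - cr b c := by unfold cr; simp; ring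
lemma cr_neg_right (a b : ℂ) : cr a (-b) = - cr a b := by unfold cr; simp; ring
lemma cr_neg_left (a b : ℂ) : cr (-a) b = - cr a b := by unfold cr; simp; ring
lemma cr_smul_right (t : ℝ) (a b : ℂ) : cr a (t * b) = t * cr a b := by unfold cr; simp; ring
lemma cr_smul_left (t : ℝ) (a b : ℂ) : cr (t * a) b = t * cr a b := by unfold cr; simp; ring
lemma cr_zero_left (a : ℂ) : cr 0 a = 0 := by unfold cr; simp
lemma cr_zero_right (a : ℂ) : cr a 0 = 0 := by unfold cr; simp
lemma cr_mul (a b c : ℂ) : cr (a * b) (a * c) = Complex.normSq a * cr b c := by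
  unfold cr; simp [Complex.normSq_apply]; ring

lemma cr_rot {a : ℂ} (ha : ‖a‖ = 1) (b c : ℂ) : cr (a * b) (a * c) = cr b c := by
  rw [cr_mul, Complex.normSq_eq_norm_sq, ha]; ring

lemma cr_continuous_right (a : ℂ) : Continuous fun z => cr a z := by unfold cr; fun_prop
lemma cr_continuous_left (a : ℂ) : Continuous fun z => cr z a := by unfold cr; fun_prop

lemma div_im_eq (a b : ℂ) (ha : a ≠ 0) : (b / a).im = cr a b / Complex.normSq a := by
  rw [Complex.div_im]; unfold cr; ring

lemma div_im_pos {a b : ℂ} (ha : a ≠ 0) : 0 < (b / a).im ↔ 0 < cr a b := by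
  rw [div_im_eq a b ha]
  have := Complex.normSq_pos.2 ha
  exact div_pos_iff_of_pos_right this

lemma div_im_neg {a b : ℂ} (ha : a ≠ 0) : (b / a).im < 0 ↔ cr a b < 0 := by
  rw [div_im_eq a b ha]
  have := Complex.normSq_pos.2 ha
  rw [div_lt_iff₀ this, zero_mul]

lemma div_im_zero {a b : ℂ} (ha : a ≠ 0) : (b / a).im = 0 ↔ cr a b = 0 := by
  rw [div_im_eq a b ha]
  have := Complex.normSq_pos.2 ha
  simp [this.ne', ha]

/-- parallel vectors -/
lemma par_of_cr {a b : ℂ} (ha : a ≠ 0) (h : cr a b = 0) : ∃ t : ℝ, b = t * a := by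
  refine ⟨(b / a).re, ?_⟩
  have h1 : b / a = ((b / a).re : ℂ) := by
    apply Complex.ext <;> simp [(div_im_zero ha).2 h]
  rw [← h1]; field_simp

lemma arg_pos_of_im_pos {z : ℂ} (h : 0 < z.im) : 0 < z.arg ∧ z.arg < Real.pi := by
  constructor
  · rcases lt_or_eq_of_le (Complex.arg_nonneg_iff.2 h.le) with h1 | h1
    · exact h1
    · have := (Complex.arg_eq_zero_iff.1 h1.symm).2; linarith
  · rcases lt_or_eq_of_le (Complex.arg_le_pi z) with h1 | h1
    · exact h1
    · have := (Complex.arg_eq_pi_iff.1 h1).2; linarith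

lemma arg_cr_pos {a b : ℂ} (ha : a ≠ 0) (h : 0 < cr a b) :
    0 < (b / a).arg ∧ (b / a).arg < Real.pi :=
  arg_pos_of_im_pos ((div_im_pos ha).2 h)

lemma angle_cycle {a b c : ℂ} (ha : a ≠ 0) (hb : b ≠ 0) (hc : c ≠ 0) :
    (((c / a).arg : ℝ) : Real.Angle) = ((b / a).arg : ℝ) + ((c / b).arg : ℝ) := by
  rw [← Complex.arg_mul_coe_angle (div_ne_zero hb ha) (div_ne_zero hc hb)]
  congr 2; field_simp

lemma exists_generic {D : Type*} (S : Finset D) (v : D → ℂ) (hv : ∀ d ∈ S, v d ≠ 0) :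
    ∃ u : ℂ, u ≠ 0 ∧ ∀ d ∈ S, cr (v d) u ≠ 0 := by
  classical
  obtain ⟨s, hs⟩ := Infinite.exists_notMem_finset (S.image fun d => (v d).im / (v d).re)
  refine ⟨⟨1, s⟩, ?_, ?_⟩
  · intro h; simpa using congrArg Complex.re h
  · intro d hd h
    apply hs
    rw [Finset.mem_image]
    refine ⟨d, hd, ?_⟩
    unfold cr at h
    simp only at h
    by_cases hr : (v d).re = 0
    · exfalso
      apply hv d hd
      apply Complex.ext
      · simpa using hr
      · rw [hr] at h; simp; linarith
    · field_simp
      linarith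

theorem sum_arg {D : Type*} (S : Finset D) (f : D → D) (hf : ∀ d ∈ S, f d ∈ S)
    (inj : Set.InjOn f S) (v : D → ℂ) (hv : ∀ d ∈ S, v d ≠ 0)
    (hpos : ∀ d ∈ S, 0 < (v (f d) / v d).arg)
    (disj : ∀ d ∈ S, ∀ e ∈ S, ∀ u, 0 < cr (v d) u → 0 < cr u (v (f d)) →
      0 < cr (v e) u → 0 < cr u (v (f e)) → d = e) (hne : S.Nonempty) :
    ∑ d ∈ S, (v (f d) / v d).arg = 2 * Real.pi := by
  classical
  obtain ⟨u, hu0, hu⟩ := exists_generic S v hv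
  have hpi := Real.pi_pos
  let t : D → ℝ := fun d => if 0 < cr u (v d) then (v d / u).arg else (v d / u).arg + 2 * Real.pi
  have ht : ∀ d, ((t d : ℝ) : Real.Angle) = ((v d / u).arg : ℝ) := by
    intro d
    by_cases h : 0 < cr u (v d)
    · simp [t, h]
    · simp [t, h]
  have htpos : ∀ d ∈ S, 0 < cr u (v d) → 0 < t d ∧ t d < Real.pi := by
    intro d hd h
    simp only [t, h, if_true]
    exact arg_cr_pos hu0 h
  have htneg : ∀ d ∈ S, cr u (v d) < 0 → Real.pi < t d ∧ t d < 2 * Real.pi := by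
    intro d hd h
    have h' : ¬ 0 < cr u (v d) := by linarith
    simp only [t, h', if_false]
    have h1 := Complex.neg_pi_lt_arg (v d / u)
    have h2 := Complex.arg_neg_iff.2 ((div_im_neg hu0).2 h)
    constructor <;> linarith
  have hdich : ∀ d ∈ S, 0 < cr u (v d) ∨ cr u (v d) < 0 := by
    intro d hd
    have := hu d hd
    rw [cr_swap] at this
    rcases lt_trichotomy (cr u (v d)) 0 with h | h | h
    · exact Or.inr h
    · simp [h] at this
    · exact Or.inl h
  have htr : ∀ d ∈ S, 0 < t d ∧ t d < 2 * Real.pi := by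
    intro d hd
    rcases hdich d hd with h | h
    · have := htpos d hd h; constructor <;> linarith
    · have := htneg d hd h; constructor <;> linarith
  have key : ∀ d ∈ S, ∃ n : ℤ, (v (f d) / v d).arg = t (f d) - t d + 2 * Real.pi * n := by
    intro d hd
    have h1 := angle_cycle hu0 (hv d hd) (hv _ (hf d hd))
    rw [← ht, ← ht, ← Real.Angle.coe_add, Real.Angle.angle_eq_iff_two_pi_dvd_sub] at h1
    obtain ⟨k, hk⟩ := h1
    exact ⟨-k, by push_cast; linarith⟩
  choose! n hn using key
  have hn01 : ∀ d ∈ S, n d = 0 ∨ n d = 1 := by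
    intro d hd
    have h1 := hn d hd
    have h2 := htr d hd
    have h3 := htr _ (hf d hd)
    have h4 := hpos d hd
    have h5 := Complex.arg_le_pi (v (f d) / v d)
    have h6 : (-1 : ℝ) < n d := by
      by_contra hc
      push Not at hc
      nlinarith
    have h7 : (n d : ℝ) < 2 := by
      by_contra hc
      push Not at hc
      nlinarith
    have h6' : (-1 : ℤ) < n d := by exact_mod_cast h6
    have h7' : n d < 2 := by exact_mod_cast h7
    omega
  have hone : ∀ d ∈ S, n d = 1 → 0 < cr (v d) u ∧ 0 < cr u (v (f d)) := by
    intro d hd h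
    have h1 := hn d hd
    rw [h] at h1
    have h2 := htr d hd
    have h3 := htr _ (hf d hd)
    have h5 := Complex.arg_le_pi (v (f d) / v d)
    push_cast at h1
    constructor
    · rcases hdich d hd with h' | h'
      · have := htpos d hd h'; linarith
      · rw [cr_swap]; linarith
    · rcases hdich _ (hf d hd) with h' | h'
      · exact h'
      · have := htneg _ (hf d hd) h'; linarith
  have hsum : ∑ d ∈ S, (v (f d) / v d).arg = 2 * Real.pi * ∑ d ∈ S, (n d : ℝ) := by
    rw [Finset.sum_congr rfl hn, Finset.sum_add_distrib, Finset.sum_sub_distrib, ← Finset.mul_sum]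
    have : ∑ d ∈ S, t (f d) = ∑ d ∈ S, t d := by
      have himg : S.image f = S := by
        apply Finset.eq_of_subset_of_card_le
        · intro x hx
          obtain ⟨d, hd, rfl⟩ := Finset.mem_image.1 hx
          exact hf d hd
        · rw [Finset.card_image_of_injOn inj]
      conv_rhs => rw [← himg]
      rw [Finset.sum_image inj]
    rw [this]; ring
  have hpos' : 0 < ∑ d ∈ S, (v (f d) / v d).arg := Finset.sum_pos hpos hne
  have hex : ∃ d ∈ S, n d = 1 := by
    by_contra hc
    push Not at hc
    have : ∑ d ∈ S, (n d : ℝ) = 0 := by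
      apply Finset.sum_eq_zero
      intro d hd
      rcases hn01 d hd with h | h
      · simp [h]
      · exact absurd h (hc d hd)
    rw [hsum, this] at hpos'
    simp at hpos'
  obtain ⟨d0, hd0, h0⟩ := hex
  have : ∑ d ∈ S, (n d : ℝ) = 1 := by
    rw [Finset.sum_eq_single d0]
    · simp [h0]
    · intro d hd hne
      rcases hn01 d hd with h | h
      · simp [h]
      · exfalso
        have a1 := hone d hd h
        have a2 := hone d0 hd0 h0
        exact hne (disj d hd d0 hd0 u a1.1 a1.2 a2.1 a2.2)
    · intro h; exact absurd hd0 h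
  rw [hsum, this]; ring

/-- angle sum of a positively oriented triangle -/
lemma tri_sum {a b c : ℂ} (h : 0 < cr (b - a) (c - a)) :
    ((c - a) / (b - a)).arg + ((a - b) / (c - b)).arg + ((b - c) / (a - c)).arg = Real.pi := by
  have hpi := Real.pi_pos
  have h2 : 0 < cr (c - b) (a - b) := by
    have : cr (c - b) (a - b) = cr (b - a) (c - a) := by unfold cr; simp; ring
    rw [this]; exact h
  have h3 : 0 < cr (a - c) (b - c) := by
    have : cr (a - c) (b - c) = cr (b - a) (c - a) := by unfold cr; simp; ring
    rw [this]; exact h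
  have n1 : b - a ≠ 0 := by intro h0; rw [h0, cr_zero_left] at h; exact lt_irrefl _ h
  have n2 : c - b ≠ 0 := by intro h0; rw [h0, cr_zero_left] at h2; exact lt_irrefl _ h2
  have n3 : a - c ≠ 0 := by intro h0; rw [h0, cr_zero_left] at h3; exact lt_irrefl _ h3
  have a1 := arg_cr_pos n1 h
  have a2 := arg_cr_pos n2 h2
  have a3 := arg_cr_pos n3 h3
  have n1' : a - b ≠ 0 := by rw [← neg_sub]; exact neg_ne_zero.2 n1
  have n2' : b - c ≠ 0 := by rw [← neg_sub]; exact neg_ne_zero.2 n2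
  have n3' : c - a ≠ 0 := by rw [← neg_sub]; exact neg_ne_zero.2 n3
  have e : ((((c - a) / (b - a)).arg + ((a - b) / (c - b)).arg + ((b - c) / (a - c)).arg : ℝ) :
      Real.Angle) = (Real.pi : ℝ) := by
    rw [Real.Angle.coe_add, Real.Angle.coe_add,
      ← Complex.arg_mul_coe_angle (div_ne_zero n3' n1) (div_ne_zero n1' n2),
      ← Complex.arg_mul_coe_angle (mul_ne_zero (div_ne_zero n3' n1) (div_ne_zero n1' n2))
        (div_ne_zero n2' n3)]
    have : (c - a) / (b - a) * ((a - b) / (c - b)) * ((b - c) / (a - c)) = -1 := by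
      field_simp
      ring
    rw [this, Complex.arg_neg_one]
  rw [Real.Angle.angle_eq_iff_two_pi_dvd_sub] at e
  obtain ⟨k, hk⟩ := e
  have hk1 : (-1 : ℝ) < k := by
    by_contra hc
    push Not at hc
    nlinarith
  have hk2 : (k : ℝ) < 1 := by
    by_contra hc
    push Not at hc
    nlinarith
  have : k = 0 := by
    have h1 : (-1 : ℤ) < k := by exact_mod_cast hk1
    have h2 : k < 1 := by exact_mod_cast hk2
    omega
  rw [this] at hk
  simp at hk
  linarith

end MC

namespace MC

lemma cr_rsmul_right (t : ℝ) (a b : ℂ) : cr a (t • b) = t * cr a b := by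
  rw [Complex.real_smul, cr_smul_right]
lemma cr_rsmul_left (t : ℝ) (a b : ℂ) : cr (t • a) b = t * cr a b := by
  rw [Complex.real_smul, cr_smul_left]

/-- rigid motion `z ↦ a (z - x) + y` -/
def mv (a x y z : ℂ) : ℂ := a * (z - x) + y

/-- vertices -/
def V (T : Set (Set ℂ)) : Set ℂ := {x | ∃ P ∈ T, x ∈ Set.extremePoints ℝ P}

/-- vertex corona -/
def Cor (T : Set (Set ℂ)) (x : ℂ) : Set (Set ℂ) := {P | P ∈ T ∧ x ∈ P}

/-- monocoronal tilings, in complex coordinates -/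
class Til (T : Set (Set ℂ)) : Prop where
  cpt : ∀ P ∈ T, IsCompact P
  cvx : ∀ P ∈ T, Convex ℝ P
  int : ∀ P ∈ T, (interior P).Nonempty
  fin : ∀ P ∈ T, (Set.extremePoints ℝ P).Finite
  cov : ∀ z : ℂ, ∃ P ∈ T, z ∈ P
  dis : ∀ P ∈ T, ∀ Q ∈ T, ∀ z : ℂ, z ∈ interior P → z ∈ interior Q → P = Q
  mono : ∀ x ∈ V T, ∀ y ∈ V T, ∃ a : ℂ, ‖a‖ = 1 ∧
    (fun P => mv a x y '' P) '' Cor T x = Cor T y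

lemma tri_mem {P : Set ℂ} (hc : Convex ℝ P) {x a b : ℂ} (hx : x ∈ P) (ha : x + a ∈ P)
    (hb : x + b ∈ P) {s t : ℝ} (hs : 0 ≤ s) (ht : 0 ≤ t) (hst : s + t ≤ 1) :
    x + (s • a + t • b) ∈ P := by
  have h := hc.sum_mem (t := Finset.univ) (w := ![1 - s - t, s, t]) (z := ![x, x + a, x + b])
    (by intro i _; fin_cases i <;> simp <;> linarith) (by simp [Fin.sum_univ_three]; ring)
    (by intro i _; fin_cases i <;> simp [hx, ha, hb])
  convert h using 1
  simp [Fin.sum_univ_three]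
  ring

lemma decomp (a b w : ℂ) : (cr a b : ℂ) * w = cr w b * a + cr a w * b := by
  apply Complex.ext <;> simp [cr] <;> ring

lemma tri_int {P : Set ℂ} (hc : Convex ℝ P) {x a b : ℂ} (hx : x ∈ P) (ha : x + a ∈ P)
    (hb : x + b ∈ P) {w : ℂ} (h1 : 0 < cr a w) (h2 : 0 < cr w b)
    (h3 : cr a w + cr w b < cr a b) : x + w ∈ interior P := by
  rw [mem_interior]
  refine ⟨{z | 0 < cr a (z - x) ∧ 0 < cr (z - x) b ∧ cr a (z - x) + cr (z - x) b < cr a b},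
    ?_, ?_, ?_⟩
  · rintro z ⟨g1, g2, g3⟩
    have hab : 0 < cr a b := by linarith
    have := tri_mem hc hx ha hb (s := cr (z - x) b / cr a b) (t := cr a (z - x) / cr a b)
      (by positivity) (by positivity) (by rw [← add_div, div_le_one hab]; linarith)
    convert this using 1
    have hd := decomp a b (z - x)
    have hne : (cr a b : ℂ) ≠ 0 := by exact_mod_cast hab.ne'
    simp only [Complex.real_smul, Complex.ofReal_div]
    field_simp
    linear_combination hd
  · have c1 : Continuous fun z => cr a (z - x) := (cr_continuous_right a).comp (by fun_prop)
    have c2 : Continuous fun z => cr (z - x) b := (cr_continuous_left b).comp (by fun_prop)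
    exact (isOpen_lt continuous_const c1).inter ((isOpen_lt continuous_const c2).inter
      (isOpen_lt (c1.add c2) continuous_const))
  · simp [h1, h2, h3]

lemma cone_int {P : Set ℂ} (hc : Convex ℝ P) {x a b u : ℂ} (hx : x ∈ P) (ha : x + a ∈ P)
    (hb : x + b ∈ P) (hab : 0 < cr a b) (h1 : 0 < cr a u) (h2 : 0 < cr u b) :
    ∃ δ > 0, ∀ t : ℝ, 0 < t → t < δ → x + t • u ∈ interior P := by
  refine ⟨cr a b / (cr a u + cr u b), by positivity, fun t t0 t1 => ?_⟩
  rw [lt_div_iff₀ (by positivity)] at t1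
  apply tri_int hc hx ha hb
  · rw [cr_rsmul_right]; positivity
  · rw [cr_rsmul_left]; positivity
  · rw [cr_rsmul_right, cr_rsmul_left]; linarith

lemma strict_left {P : Set ℂ} {n x o : ℂ} (hn : n ≠ 0) (h : ∀ z ∈ P, 0 ≤ cr n (z - x))
    (ho : o ∈ interior P) : 0 < cr n (o - x) := by
  obtain ⟨ε, e0, he⟩ := Metric.isOpen_iff.1 isOpen_interior o ho
  have hn' : 0 < ‖n‖ := norm_pos_iff.2 hn
  have hmem : o - ((ε / (2 * ‖n‖) : ℝ) : ℂ) * (Complex.I * n) ∈ P := by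
    apply interior_subset
    apply he
    rw [Metric.mem_ball, dist_eq_norm]
    simp [abs_of_pos e0]
    field_simp
    norm_num
  have := h _ hmem
  have e : cr n (o - ((ε / (2 * ‖n‖) : ℝ) : ℂ) * (Complex.I * n) - x)
      = cr n (o - x) - (ε / (2 * ‖n‖)) * Complex.normSq n := by
    rw [sub_right_comm, cr_sub_right, cr_smul_right]
    congr 2
    simp [cr, Complex.normSq_apply]
  rw [e] at this
  have : 0 < (ε / (2 * ‖n‖)) * Complex.normSq n := by
    have := Complex.normSq_pos.2 hn
    positivity
  linarith

lemma supp_line {P : Set ℂ} (hc : Convex ℝ P) (hi : (interior P).Nonempty) {x : ℂ}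
    (hx : x ∉ interior P) : ∃ n : ℂ, n ≠ 0 ∧ ∀ z ∈ P, 0 ≤ cr n (z - x) := by
  obtain ⟨f, hf⟩ := geometric_hahn_banach_open_point hc.interior isOpen_interior hx
  have hrep : ∀ z : ℂ, f z = z.re * f 1 + z.im * f Complex.I := by
    intro z
    have : z = (z.re : ℝ) • (1 : ℂ) + (z.im : ℝ) • Complex.I := by
      simp
    conv_lhs => rw [this, map_add, map_smul, map_smul]
    simp
  set n : ℂ := ⟨-f Complex.I, f 1⟩ with hn
  have hcr : ∀ z, cr n z = - f z := by
    intro z; rw [hrep z]; simp [cr, hn]; ring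
  refine ⟨n, ?_, ?_⟩
  · intro h0
    obtain ⟨o, ho⟩ := hi
    have h1 := hf o ho
    have h2 := hcr o
    have h3 := hcr x
    rw [h0, cr_zero_left] at h2 h3
    linarith
  · intro z hz
    have hz' : z ∈ closure (interior P) := by
      rw [hc.closure_interior_eq_closure_of_nonempty_interior hi]; exact subset_closure hz
    have hcl : IsClosed {z | 0 ≤ cr n (z - x)} :=
      isClosed_le continuous_const ((cr_continuous_right n).comp (by fun_prop))
    have : interior P ⊆ {z | 0 ≤ cr n (z - x)} := by
      intro w hw
      have := hf w hw
      simp only [mem_ofPred_eq, hcr, map_sub]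
      linarith
    exact closure_minimal this hcl hz'

section
variable {T : Set (Set ℂ)} [h : Til T]

lemma ext_hull {P : Set ℂ} (hP : P ∈ T) : convexHull ℝ (Set.extremePoints ℝ P) = P := by
  rw [← ((Til.fin P hP).isClosed_convexHull (𝕜 := ℝ)).closure_eq]
  exact closure_convexHull_extremePoints (Til.cpt P hP) (Til.cvx P hP)

lemma mem_closure_int {P : Set ℂ} (hP : P ∈ T) {z : ℂ} (hz : z ∈ P) :
    z ∈ closure (interior P) := by
  rw [(Til.cvx P hP).closure_interior_eq_closure_of_nonempty_interior (Til.int P hP)]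
  exact subset_closure hz

lemma eq_of_int_mem {P Q : Set ℂ} (hP : P ∈ T) (hQ : Q ∈ T) {z : ℂ} (hz : z ∈ interior P)
    (hz' : z ∈ Q) : P = Q := by
  obtain ⟨w, hw1, hw2⟩ := mem_closure_iff.1 (mem_closure_int hQ hz') _ isOpen_interior hz
  exact Til.dis P hP Q hQ w hw1 hw2

lemma ext_not_int {P : Set ℂ} {x : ℂ} (hx : x ∈ Set.extremePoints ℝ P) : x ∉ interior P := by
  intro hx'
  exact Set.disjoint_left.1 (disjoint_interior_extremePoints P) hx' hx

lemma V_not_int {P : Set ℂ} (hP : P ∈ T) {x : ℂ} (hx : x ∈ V T) : x ∉ interior P := by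
  intro hi
  obtain ⟨Q, hQ, hxQ⟩ := hx
  have := eq_of_int_mem hP hQ hi (extremePoints_subset hxQ)
  subst this
  exact ext_not_int hxQ hi

lemma closed_tile {P : Set ℂ} (hP : P ∈ T) : IsClosed P := (Til.cpt P hP).isClosed

end
end MC

namespace MC

lemma mv_add (a x y z : ℂ) (w : ℂ) : mv a x y (z + w) = mv a x y z + a * w := by unfold mv; ring
lemma mv_sub (a x y z w : ℂ) : mv a x y z - mv a x y w = a * (z - w) := by unfold mv; ring
lemma mv_self (a x y : ℂ) : mv a x y x = y := by unfold mv; ring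

lemma mv_inv {a : ℂ} (ha : ‖a‖ = 1) (x y z : ℂ) : mv a⁻¹ y x (mv a x y z) = z := by
  have : a ≠ 0 := by intro h; simp [h] at ha
  unfold mv; field_simp; ring
lemma mv_inv' {a : ℂ} (ha : ‖a‖ = 1) (x y z : ℂ) : mv a x y (mv a⁻¹ y x z) = z := by
  have : a ≠ 0 := by intro h; simp [h] at ha
  unfold mv; field_simp; ring

lemma mv_comp (a b x y w z : ℂ) : mv b y w (mv a x y z) = mv (b * a) x w z := by
  unfold mv; ring

/-- rigid motion as a homeomorphism -/
def mvH (a : ℂ) (ha : ‖a‖ = 1) (x y : ℂ) : ℂ ≃ₜ ℂ where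
  toFun := mv a x y
  invFun := mv a⁻¹ y x
  left_inv := mv_inv ha x y
  right_inv := mv_inv' ha x y
  continuous_toFun := by unfold mv; fun_prop
  continuous_invFun := by unfold mv; fun_prop

lemma mv_inj {a : ℂ} (ha : ‖a‖ = 1) (x y : ℂ) : Function.Injective (mv a x y) :=
  (mvH a ha x y).injective

lemma mv_image_interior {a : ℂ} (ha : ‖a‖ = 1) (x y : ℂ) (P : Set ℂ) :
    mv a x y '' interior P = interior (mv a x y '' P) :=
  (mvH a ha x y).image_interior P

lemma mv_segm (a x y p q : ℂ) : mv a x y '' openSegment ℝ p q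
    = openSegment ℝ (mv a x y p) (mv a x y q) := by
  ext z
  simp only [openSegment, mem_image, mem_ofPred_eq]
  constructor
  · rintro ⟨w, ⟨s, t, hs, ht, hst, rfl⟩, rfl⟩
    refine ⟨s, t, hs, ht, hst, ?_⟩
    have : (s : ℂ) + t = 1 := by exact_mod_cast hst
    simp only [mv, Complex.real_smul]
    linear_combination (y - a * x) * this
  · rintro ⟨s, t, hs, ht, hst, rfl⟩
    refine ⟨_, ⟨s, t, hs, ht, hst, rfl⟩, ?_⟩
    have : (s : ℂ) + t = 1 := by exact_mod_cast hst
    simp only [mv, Complex.real_smul]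
    linear_combination -(y - a * x) * this

lemma mv_ext {a : ℂ} (ha : ‖a‖ = 1) (x y : ℂ) (P : Set ℂ) :
    mv a x y '' Set.extremePoints ℝ P = Set.extremePoints ℝ (mv a x y '' P) := by
  ext z
  constructor
  · rintro ⟨w, hw, rfl⟩
    rw [mem_extremePoints] at hw ⊢
    refine ⟨mem_image_of_mem _ hw.1, ?_⟩
    rintro _ ⟨p, hp, rfl⟩ _ ⟨q, hq, rfl⟩ hpq
    rw [← mv_segm] at hpq
    obtain ⟨w', hw', e⟩ := hpq
    rw [mv_inj ha x y e] at hw'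
    have := hw.2 p hp q hq hw'
    rw [this.1, this.2]; simp
  · intro hz
    rw [mem_extremePoints] at hz
    obtain ⟨⟨w, hw, rfl⟩, hz⟩ := hz
    refine ⟨w, ?_, rfl⟩
    rw [mem_extremePoints]
    refine ⟨hw, fun p hp q hq hpq => ?_⟩
    have := hz _ (mem_image_of_mem _ hp) _ (mem_image_of_mem _ hq)
      (by rw [← mv_segm]; exact mem_image_of_mem _ hpq)
    exact ⟨mv_inj ha x y this.1, mv_inj ha x y this.2⟩

/-- wide corner -/
def Wide (P : Set ℂ) (x : ℂ) : Prop :=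
  ∃ b c : ℂ, x + b ∈ P ∧ x + c ∈ P ∧ 0 < cr b c ∧ Real.pi / 3 ≤ (c / b).arg

lemma Wide.mv {P : Set ℂ} {x : ℂ} (hw : Wide P x) {a : ℂ} (ha : ‖a‖ = 1) (y : ℂ) :
    Wide (mv a x y '' P) y := by
  obtain ⟨b, c, hb, hc, h1, h2⟩ := hw
  have ha0 : a ≠ 0 := by intro h; simp [h] at ha
  refine ⟨a * b, a * c, ⟨_, hb, by unfold MC.mv; ring⟩, ⟨_, hc, by unfold MC.mv; ring⟩, ?_, ?_⟩
  · rw [cr_rot ha]; exact h1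
  · rwa [mul_div_mul_left _ _ ha0]

lemma polar (z : ℂ) : z = ‖z‖ * Complex.exp (z.arg * Complex.I) := by simp

lemma cr_polar (r s α β : ℝ) : cr (r * Complex.exp (α * Complex.I)) (s * Complex.exp (β * Complex.I))
    = r * s * Real.sin (β - α) := by
  rw [cr_smul_left, cr_smul_right]
  simp [cr, Complex.exp_ofReal_mul_I_re, Complex.exp_ofReal_mul_I_im, Real.sin_sub]
  ring

lemma cr_polar' (a b : ℂ) (β : ℝ) (hb : ((β : ℝ) : Real.Angle) = b.arg) :
    cr a b = ‖a‖ * ‖b‖ * Real.sin (β - a.arg) := by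
  conv_lhs => rw [polar a, polar b]
  rw [cr_polar]
  congr 1
  rw [Real.sin_sub, Real.sin_sub, ← Real.Angle.sin_coe β, ← Real.Angle.cos_coe β, hb]
  simp

lemma wide_dir {b c : ℂ} (h1 : 0 < cr b c) (h2 : Real.pi / 3 ≤ (c / b).arg) :
    ∃ n : ℤ, n ∈ Finset.Icc (-4 : ℤ) 5 ∧
      0 < cr b (Complex.exp ((n * (Real.pi / 4) : ℝ) * Complex.I)) ∧
      0 < cr (Complex.exp ((n * (Real.pi / 4) : ℝ) * Complex.I)) c := by
  have hpi := Real.pi_pos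
  have hb0 : b ≠ 0 := by intro h0; rw [h0, cr_zero_left] at h1; exact lt_irrefl _ h1
  have hc0 : c ≠ 0 := by intro h0; rw [h0, cr_zero_right] at h1; exact lt_irrefl _ h1
  have h3 := arg_cr_pos hb0 h1
  set n : ℤ := ⌊b.arg / (Real.pi / 4)⌋ + 1 with hn
  have n1 := Int.floor_le (b.arg / (Real.pi / 4))
  have n2 := Int.lt_floor_add_one (b.arg / (Real.pi / 4))
  have hbb := Complex.neg_pi_lt_arg b
  have hbb' := Complex.arg_le_pi b
  rw [le_div_iff₀ (by positivity)] at n1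
  rw [div_lt_iff₀ (by positivity)] at n2
  have hnc : (n : ℝ) = ⌊b.arg / (Real.pi / 4)⌋ + 1 := by rw [hn]; push_cast; ring
  have n1' : (n : ℝ) * (Real.pi / 4) ≤ b.arg + Real.pi / 4 := by rw [hnc]; linarith
  have n2' : b.arg < (n : ℝ) * (Real.pi / 4) := by rw [hnc]; linarith
  have hexp : Complex.exp ((n * (Real.pi / 4) : ℝ) * Complex.I)
    = ((1 : ℝ) : ℂ) * Complex.exp ((n * (Real.pi / 4) : ℝ) * Complex.I) := by simp
  refine ⟨n, ?_, ?_, ?_⟩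
  · rw [Finset.mem_Icc]
    constructor
    · have : (-5 : ℝ) < n := by
        by_contra hcon
        push Not at hcon
        nlinarith
      have : (-5 : ℤ) < n := by exact_mod_cast this
      omega
    · have : (n : ℝ) < 6 := by
        by_contra hcon
        push Not at hcon
        nlinarith
      have : n < 6 := by exact_mod_cast this
      omega
  · rw [hexp, polar b, cr_polar]
    have : 0 < Real.sin (n * (Real.pi / 4) - b.arg) := by
      apply Real.sin_pos_of_pos_of_lt_pi <;> linarith
    have := norm_pos_iff.2 hb0
    positivity
  · have hc : c = ‖c‖ * Complex.exp (((c / b).arg + b.arg : ℝ) * Complex.I) := by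
      have e : Complex.exp (((c / b).arg + b.arg : ℝ) * Complex.I) =
          Complex.exp ((c / b).arg * Complex.I) * Complex.exp (b.arg * Complex.I) := by
        rw [← Complex.exp_add]; push_cast; ring_nf
      have e1 := polar (c / b)
      have e2 := polar b
      have nb : (‖b‖ : ℂ) ≠ 0 := by simpa using hb0
      have : ‖c‖ = ‖c / b‖ * ‖b‖ := by rw [← norm_mul, div_mul_cancel₀ _ hb0]
      rw [e, this]
      calc c = (c / b) * b := by field_simp
        _ = (‖c / b‖ * Complex.exp ((c / b).arg * Complex.I)) *
            (‖b‖ * Complex.exp (b.arg * Complex.I)) := by rw [← e1, ← e2]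
        _ = _ := by push_cast; ring
    rw [hexp]
    rw [hc, cr_polar]
    have : 0 < Real.sin ((c / b).arg + b.arg - n * (Real.pi / 4)) := by
      apply Real.sin_pos_of_pos_of_lt_pi <;> linarith
    have := norm_pos_iff.2 hc0
    positivity

section
variable {T : Set (Set ℂ)} [h : Til T]

lemma exists_wide {P : Set ℂ} (hP : P ∈ T) : ∃ x ∈ Set.extremePoints ℝ P, Wide P x := by
  have hpi := Real.pi_pos
  -- three noncollinear extreme points
  have h3 : ∃ a ∈ Set.extremePoints ℝ P, ∃ b ∈ Set.extremePoints ℝ P,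
      ∃ c ∈ Set.extremePoints ℝ P, 0 < cr (b - a) (c - a) := by
    by_contra hcon
    push Not at hcon
    have hz : ∀ a ∈ Set.extremePoints ℝ P, ∀ b ∈ Set.extremePoints ℝ P,
      ∀ c ∈ Set.extremePoints ℝ P, cr (b - a) (c - a) = 0 := by
      intro a ha b hb c hc
      have h1 := hcon a ha b hb c hc
      have h2 := hcon a ha c hc b hb
      rw [cr_swap] at h2
      linarith
    obtain ⟨o, ho⟩ := Til.int P hP
    obtain ⟨a, ha⟩ := (Til.cpt P hP).extremePoints_nonempty ⟨o, interior_subset ho⟩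
    have key : ∃ n : ℂ, n ≠ 0 ∧ ∀ z ∈ P, cr n (z - a) = 0 := by
      by_cases hb : ∃ b ∈ Set.extremePoints ℝ P, b ≠ a
      · obtain ⟨b, hb, hba⟩ := hb
        refine ⟨b - a, sub_ne_zero.2 hba, ?_⟩
        have hconv : Convex ℝ {z | cr (b - a) (z - a) = 0} := by
          intro z hz w hw s t _ _ hst
          have e : s • z + t • w - a = s • (z - a) + t • (w - a) := by
            have : (s : ℂ) + t = 1 := by exact_mod_cast hst
            simp only [Complex.real_smul]
            linear_combination a * this
          simp only [mem_ofPred_eq] at hz hw ⊢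
          rw [e, cr_add_right, cr_rsmul_right, cr_rsmul_right, hz, hw]; simp
        have := convexHull_min (fun z hz' => hz a ha b hb z hz') hconv
        rw [ext_hull hP] at this
        exact this
      · push Not at hb
        have hs : Set.extremePoints ℝ P = {a} := by
          ext z; constructor
          · exact fun hz => hb z hz
          · rintro rfl; exact ha
        refine ⟨1, one_ne_zero, ?_⟩
        intro z hz
        rw [← ext_hull hP, hs] at hz
        simp at hz
        rw [hz]; simp [cr]
    obtain ⟨n, hn, hn'⟩ := key
    have := strict_left hn (fun z hz => (hn' z hz).ge) ho
    rw [hn' o (interior_subset ho)] at this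
    exact lt_irrefl _ this
  obtain ⟨a, ha, b, hb, c, hc, habc⟩ := h3
  have hs := tri_sum habc
  have h2 : 0 < cr (c - b) (a - b) := by
    have : cr (c - b) (a - b) = cr (b - a) (c - a) := by unfold cr; simp; ring
    rw [this]; exact habc
  have h3 : 0 < cr (a - c) (b - c) := by
    have : cr (a - c) (b - c) = cr (b - a) (c - a) := by unfold cr; simp; ring
    rw [this]; exact habc
  have ma := extremePoints_subset ha
  have mb := extremePoints_subset hb
  have mc := extremePoints_subset hc
  by_cases g1 : Real.pi / 3 ≤ ((c - a) / (b - a)).arg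
  · exact ⟨a, ha, b - a, c - a, by simpa using mb, by simpa using mc, habc, g1⟩
  by_cases g2 : Real.pi / 3 ≤ ((a - b) / (c - b)).arg
  · exact ⟨b, hb, c - b, a - b, by simpa using mc, by simpa using ma, h2, g2⟩
  by_cases g3 : Real.pi / 3 ≤ ((b - c) / (a - c)).arg
  · exact ⟨c, hc, a - c, b - c, by simpa using ma, by simpa using mb, h3, g3⟩
  exfalso; push Not at g1 g2 g3; linarith

lemma eq_of_cones {P Q : Set ℂ} (hP : P ∈ T) (hQ : Q ∈ T) {x u : ℂ}
    (h1 : ∃ δ > 0, ∀ t : ℝ, 0 < t → t < δ → x + t • u ∈ interior P)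
    (h2 : ∃ δ > 0, ∀ t : ℝ, 0 < t → t < δ → x + t • u ∈ interior Q) : P = Q := by
  obtain ⟨δ, d0, h1⟩ := h1
  obtain ⟨ε, e0, h2⟩ := h2
  have hm : 0 < min δ ε := lt_min d0 e0
  have hd := min_le_left δ ε
  have he := min_le_right δ ε
  exact Til.dis P hP Q hQ _ (h1 (min δ ε / 2) (by linarith) (by linarith))
    (h2 (min δ ε / 2) (by linarith) (by linarith))

lemma wide_finite (x : ℂ) : {P | P ∈ T ∧ x ∈ P ∧ Wide P x}.Finite := by
  classical
  have key : ∀ P : Set ℂ, ∃ n : ℤ, (P ∈ T ∧ x ∈ P ∧ Wide P x) → n ∈ Finset.Icc (-4 : ℤ) 5 ∧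
    ∃ δ > 0, ∀ t : ℝ, 0 < t → t < δ →
      x + t • (Complex.exp ((n * (Real.pi / 4) : ℝ) * Complex.I)) ∈ interior P := by
    intro P
    by_cases hP : P ∈ T ∧ x ∈ P ∧ Wide P x
    · obtain ⟨hP, hx, b, c, hb, hc, h1, h2⟩ := hP
      obtain ⟨n, hn, h3, h4⟩ := wide_dir h1 h2
      exact ⟨n, fun _ => ⟨hn, cone_int (Til.cvx P hP) hx hb hc h1 h3 h4⟩⟩
    · exact ⟨0, fun h => absurd h hP⟩
  choose n hn using key
  apply Set.Finite.of_finite_image (f := n)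
  · exact (Finset.finite_toSet (Finset.Icc (-4 : ℤ) 5)).subset (by
      rintro _ ⟨P, hP, rfl⟩; exact (hn P hP).1)
  · intro P hP Q hQ e
    have g1 := (hn P hP).2
    have g2 := (hn Q hQ).2
    rw [← e] at g2
    exact eq_of_cones hP.1 hQ.1 g1 g2

lemma exists_V (T : Set (Set ℂ)) [h : Til T] : ∃ x, x ∈ V T := by
  obtain ⟨P, hP, _⟩ := Til.cov (T := T) 0
  obtain ⟨x, hx, _⟩ := exists_wide hP
  exact ⟨x, P, hP, hx⟩

lemma mono_mem {x y a : ℂ} (e : (fun P => mv a x y '' P) '' Cor T x = Cor T y)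
    {P : Set ℂ} (hP : P ∈ T) (hx : x ∈ P) : mv a x y '' P ∈ T ∧ y ∈ mv a x y '' P := by
  have : mv a x y '' P ∈ Cor T y := by rw [← e]; exact ⟨P, ⟨hP, hx⟩, rfl⟩
  exact this

lemma uniform (T : Set (Set ℂ)) [h : Til T] : ∃ r > 0, ∃ D > 0, ∃ p : ℕ, ∀ P ∈ T,
    (∃ o, Metric.ball o r ⊆ P) ∧ (∀ z ∈ P, ∀ w ∈ P, dist z w ≤ D) ∧
    (Set.extremePoints ℝ P).ncard ≤ p := by
  classical
  obtain ⟨x0, hx0⟩ := exists_V T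
  have hfin := wide_finite (T := T) x0
  have hr : ∀ Q : Set ℂ, ∃ r > 0, ∃ D > 0, Q ∈ T → (∃ o, Metric.ball o r ⊆ Q) ∧
      (∀ z ∈ Q, ∀ w ∈ Q, dist z w ≤ D) := by
    intro Q
    by_cases hQ : Q ∈ T
    · obtain ⟨o, ho⟩ := Til.int Q hQ
      obtain ⟨r, r0, hr⟩ := Metric.isOpen_iff.1 isOpen_interior o ho
      obtain ⟨D, hD⟩ := Metric.isBounded_iff.1 (Til.cpt Q hQ).isBounded
      exact ⟨r, r0, max D 1, by positivity, fun _ => ⟨⟨o, hr.trans interior_subset⟩,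
        fun z hz w hw => (hD hz hw).trans (le_max_left _ _)⟩⟩
    · exact ⟨1, one_pos, 1, one_pos, fun h => absurd h hQ⟩
  choose r r0 D D0 hrD using hr
  obtain ⟨F, hF⟩ := hfin.exists_finset_coe
  have hne : F.Nonempty := by
    obtain ⟨P, hP, _⟩ := Til.cov (T := T) 0
    obtain ⟨x, hx, hw⟩ := exists_wide hP
    obtain ⟨a, ha, e⟩ := Til.mono x ⟨P, hP, hx⟩ x0 hx0
    refine ⟨mv a x x0 '' P, ?_⟩
    rw [← Finset.mem_coe, hF]
    have := mono_mem e hP (extremePoints_subset hx)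
    exact ⟨this.1, this.2, hw.mv ha x0⟩
  refine ⟨F.inf' hne r, ?_, F.sup' hne D, ?_, F.sup (fun Q => (Set.extremePoints ℝ Q).ncard), ?_⟩
  · rw [gt_iff_lt, Finset.lt_inf'_iff]; exact fun Q _ => r0 Q
  · rw [gt_iff_lt, Finset.lt_sup'_iff]; obtain ⟨Q, hQ⟩ := hne; exact ⟨Q, hQ, D0 Q⟩
  · intro P hP
    obtain ⟨x, hx, hw⟩ := exists_wide hP
    obtain ⟨a, ha, e⟩ := Til.mono x ⟨P, hP, hx⟩ x0 hx0
    have hm := mono_mem e hP (extremePoints_subset hx)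
    have hQF : mv a x x0 '' P ∈ F := by
      rw [← Finset.mem_coe, hF]
      exact ⟨hm.1, hm.2, hw.mv ha x0⟩
    set Q := mv a x x0 '' P with hQ
    have hiso : ∀ z w, dist (mv a x x0 z) (mv a x x0 w) = dist z w := by
      intro z w; rw [dist_eq_norm, dist_eq_norm, mv_sub, norm_mul, ha, one_mul]
    obtain ⟨⟨o, ho⟩, hd⟩ := hrD Q hm.1
    refine ⟨⟨mv a⁻¹ x0 x o, ?_⟩, ?_, ?_⟩
    · intro z hz
      have : mv a x x0 z ∈ Q := by
        apply ho
        rw [Metric.mem_ball] at hz ⊢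
        rw [← mv_inv' ha x x0 o, hiso]
        exact hz.trans_le (Finset.inf'_le _ hQF)
      obtain ⟨w, hw, e⟩ := this
      rwa [← mv_inj ha _ _ e]
    · intro z hz w hw
      rw [← hiso]
      exact (hd _ (mem_image_of_mem _ hz) _ (mem_image_of_mem _ hw)).trans
        (Finset.le_sup' _ hQF)
    · have : (Set.extremePoints ℝ P).ncard = (Set.extremePoints ℝ Q).ncard := by
        rw [hQ, ← mv_ext ha, Set.ncard_image_of_injective _ (mv_inj ha _ _)]
      rw [this]
      exact Finset.le_sup (f := fun Q => (Set.extremePoints ℝ Q).ncard) hQF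

end
end MC

namespace MC

lemma grid {δ : ℝ} (hδ : 0 < δ) : ∃ K : ℝ, 0 ≤ K ∧ ∀ (c : ℂ) (R : ℝ), 0 ≤ R → ∀ S : Set ℂ,
    S ⊆ Metric.closedBall c R → (∀ z ∈ S, ∀ w ∈ S, dist z w < δ → z = w) →
    S.Finite ∧ (S.ncard : ℝ) ≤ K * (R + 1) ^ 2 := by
  classical
  refine ⟨(4 / δ + 5) ^ 2, by positivity, fun c R hR S hS hsep => ?_⟩
  set f : ℂ → ℤ × ℤ := fun z => (⌊(z - c).re / (δ / 2)⌋, ⌊(z - c).im / (δ / 2)⌋) with hf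
  set N : ℕ := ⌈2 * R / δ⌉₊ + 1 with hN
  set G : Finset (ℤ × ℤ) := Finset.Icc (-(N : ℤ)) N ×ˢ Finset.Icc (-(N : ℤ)) N with hG
  have hN1 : 2 * R / δ ≤ N - 1 := by rw [hN]; push_cast; simpa using Nat.le_ceil (2 * R / δ)
  have hN2 : (N : ℝ) ≤ 2 * R / δ + 2 := by
    rw [hN]; push_cast
    have := Nat.ceil_lt_add_one (show 0 ≤ 2 * R / δ by positivity)
    linarith
  have hcell : ∀ t : ℝ, |t| ≤ R → ⌊t / (δ / 2)⌋ ∈ Finset.Icc (-(N : ℤ)) N := by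
    intro t ht
    rw [abs_le] at ht
    have h1 : t / (δ / 2) ≤ N := by
      have : t / (δ / 2) ≤ 2 * R / δ := by
        rw [div_le_div_iff₀ (by positivity) hδ]; nlinarith
      linarith
    have h2 : -(N : ℝ) ≤ t / (δ / 2) := by
      have : -(2 * R / δ) ≤ t / (δ / 2) := by
        rw [← neg_div, div_le_div_iff₀ hδ (by positivity)]; nlinarith
      linarith
    rw [Finset.mem_Icc]
    constructor
    · rw [Int.le_floor]; push_cast; exact h2
    · have : ((⌊t / (δ / 2)⌋ : ℤ) : ℝ) ≤ N := (Int.floor_le _).trans h1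
      exact_mod_cast this
  have hmaps : MapsTo f S (G : Set (ℤ × ℤ)) := by
    intro z hz
    have hz' := hS hz
    rw [Metric.mem_closedBall, dist_eq_norm] at hz'
    simp only [hG, hf, Finset.coe_product, mem_prod, Finset.mem_coe]
    exact ⟨hcell _ ((Complex.abs_re_le_norm _).trans hz'),
      hcell _ ((Complex.abs_im_le_norm _).trans hz')⟩
  have hinj : InjOn f S := by
    intro z hz w hw e
    apply hsep z hz w hw
    simp only [hf, Prod.mk.injEq] at e
    have e1 := Int.abs_sub_lt_one_of_floor_eq_floor e.1
    have e2 := Int.abs_sub_lt_one_of_floor_eq_floor e.2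
    rw [← sub_div, abs_div, abs_of_pos (show 0 < δ / 2 by positivity), div_lt_one (by positivity)]
      at e1 e2
    rw [dist_eq_norm]
    have : ‖z - w‖ ≤ |(z - w).re| + |(z - w).im| := Complex.norm_le_abs_re_add_abs_im _
    have r1 : (z - c).re - (w - c).re = (z - w).re := by simp
    have r2 : (z - c).im - (w - c).im = (z - w).im := by simp
    rw [r1] at e1; rw [r2] at e2
    linarith
  have hfin : S.Finite := Set.Finite.of_injOn hmaps hinj (Finset.finite_toSet G)
  refine ⟨hfin, ?_⟩
  have hcard : S.ncard ≤ (2 * N + 1) ^ 2 := by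
    have h1 := Set.ncard_le_ncard_of_injOn f hmaps hinj (Finset.finite_toSet G)
    rw [Set.ncard_coe_finset] at h1
    have h2 : G.card = (2 * N + 1) ^ 2 := by
      rw [hG, Finset.card_product, Int.card_Icc]
      have : ((N : ℤ) + 1 - -(N : ℤ)).toNat = 2 * N + 1 := by omega
      rw [this]; ring
    omega
  have : (S.ncard : ℝ) ≤ (2 * N + 1 : ℝ) ^ 2 := by exact_mod_cast hcard
  refine this.trans ?_
  rw [← mul_pow]
  apply pow_le_pow_left₀ (by positivity)
  have e : 2 * R / δ = R * (2 / δ) := by ring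
  have : 4 / δ = 2 * (2 / δ) := by ring
  have : 0 < 2 / δ := by positivity
  rw [e] at hN2
  nlinarith

section
variable {T : Set (Set ℂ)} [h : Til T]

lemma tiles_count (T : Set (Set ℂ)) [h : Til T] : ∃ K : ℝ, 0 ≤ K ∧ ∀ (c : ℂ) (R : ℝ), 0 ≤ R →
    {P | P ∈ T ∧ (P ∩ Metric.closedBall c R).Nonempty}.Finite ∧
    ({P | P ∈ T ∧ (P ∩ Metric.closedBall c R).Nonempty}.ncard : ℝ) ≤ K * (R + 1) ^ 2 := by
  classical
  obtain ⟨r, r0, D, D0, p, hu⟩ := uniform T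
  obtain ⟨K, hK0, hK⟩ := grid r0
  have hc : ∀ P : Set ℂ, ∃ o, P ∈ T → Metric.ball o r ⊆ P := by
    intro P
    by_cases hP : P ∈ T
    · obtain ⟨o, ho⟩ := (hu P hP).1; exact ⟨o, fun _ => ho⟩
    · exact ⟨0, fun h => absurd h hP⟩
  choose o ho using hc
  have hsep : ∀ P ∈ T, ∀ Q ∈ T, dist (o P) (o Q) < r → P = Q := by
    intro P hP Q hQ hd
    have h1 : o P ∈ interior P :=
      interior_mono (ho P hP) (by rw [Metric.isOpen_ball.interior_eq]; exact Metric.mem_ball_self r0)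
    exact eq_of_int_mem hP hQ h1 (ho Q hQ (by rw [Metric.mem_ball]; exact hd))
  refine ⟨K * (D + 1) ^ 2, by positivity, fun c R hR => ?_⟩
  set A := {P | P ∈ T ∧ (P ∩ Metric.closedBall c R).Nonempty} with hA
  have hinj : InjOn o A := by
    intro P hP Q hQ e
    exact hsep P hP.1 Q hQ.1 (by rw [e]; simpa using r0)
  have := hK c (R + D) (by linarith) (o '' A) (by
      rintro _ ⟨P, ⟨hP, z, hz, hzb⟩, rfl⟩
      rw [Metric.mem_closedBall] at hzb ⊢
      have h1 := (hu P hP).2.1 (o P) (ho P hP (Metric.mem_ball_self r0)) z hz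
      have := dist_triangle (o P) z c
      linarith) (by
      rintro _ ⟨P, hP, rfl⟩ _ ⟨Q, hQ, rfl⟩ hd
      rw [hsep P hP.1 Q hQ.1 hd])
  refine ⟨Set.Finite.of_finite_image this.1 hinj, ?_⟩
  rw [hinj.ncard_image] at this
  refine this.2.trans ?_
  rw [mul_assoc]
  apply mul_le_mul_of_nonneg_left _ hK0
  rw [← mul_pow]
  apply pow_le_pow_left₀ (by linarith)
  nlinarith

lemma V_count (T : Set (Set ℂ)) [h : Til T] : ∃ K : ℝ, 0 ≤ K ∧ ∀ (c : ℂ) (R : ℝ), 0 ≤ R →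
    (V T ∩ Metric.closedBall c R).Finite ∧
    ((V T ∩ Metric.closedBall c R).ncard : ℝ) ≤ K * (R + 1) ^ 2 := by
  classical
  obtain ⟨r, r0, D, D0, p, hu⟩ := uniform T
  obtain ⟨K, hK0, hK⟩ := tiles_count T
  refine ⟨p * K, by positivity, fun c R hR => ?_⟩
  obtain ⟨hf, hn⟩ := hK c R hR
  obtain ⟨F, hF⟩ := hf.exists_finset_coe
  rw [← hF, Set.ncard_coe_finset] at hn
  have hFT : ∀ P ∈ F, P ∈ T := fun P hP => by
    rw [← Finset.mem_coe, hF] at hP; exact hP.1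
  have hsub : V T ∩ Metric.closedBall c R ⊆ ⋃ P ∈ F, Set.extremePoints ℝ P := by
    rintro x ⟨⟨P, hP, hx⟩, hxb⟩
    simp only [mem_iUnion]
    refine ⟨P, ?_, hx⟩
    rw [← Finset.mem_coe, hF]
    exact ⟨hP, x, extremePoints_subset hx, hxb⟩
  have hfin : (⋃ P ∈ F, Set.extremePoints ℝ P).Finite :=
    F.finite_toSet.biUnion fun P hP => Til.fin P (hFT P hP)
  refine ⟨hfin.subset hsub, ?_⟩
  have h1 := Set.ncard_le_ncard hsub hfin
  have h2 : (⋃ P ∈ F, Set.extremePoints ℝ P).ncard ≤ F.card * p := by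
    have : (⋃ P ∈ F, Set.extremePoints ℝ P) ⊆
        ((F.biUnion fun P => if hP : P ∈ T then (Til.fin P hP).toFinset else ∅ : Finset ℂ) : Set ℂ) := by
      intro z hz
      simp only [mem_iUnion] at hz
      obtain ⟨P, hP, hz⟩ := hz
      rw [Finset.mem_coe, Finset.mem_biUnion]
      exact ⟨P, hP, by simp [hFT P hP, hz]⟩
    refine (Set.ncard_le_ncard this (Finset.finite_toSet _)).trans ?_
    rw [Set.ncard_coe_finset]
    apply Finset.card_biUnion_le_card_mul
    intro P hP
    simp only [hFT P hP, dif_pos]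
    rw [← Set.ncard_eq_toFinset_card _ (Til.fin P (hFT P hP))]
    exact (hu P (hFT P hP)).2.2
  have h3 : ((V T ∩ Metric.closedBall c R).ncard : ℝ) ≤ F.card * p := by exact_mod_cast h1.trans h2
  refine h3.trans ?_
  calc (F.card : ℝ) * p ≤ (K * (R + 1) ^ 2) * p := by gcongr
    _ = _ := by ring

lemma VP_finite {P : Set ℂ} (hP : P ∈ T) : (V T ∩ P).Finite := by
  obtain ⟨K, _, hK⟩ := V_count T
  obtain ⟨R, hR⟩ := (Til.cpt P hP).isBounded.subset_closedBall 0
  exact (hK 0 (max R 0) (le_max_right _ _)).1.subset (inter_subset_inter_right _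
    (hR.trans (Metric.closedBall_subset_closedBall (le_max_left _ _))))

lemma Cor_finite (x : ℂ) : (Cor T x).Finite := by
  obtain ⟨K, _, hK⟩ := tiles_count T
  refine (hK x 0 le_rfl).1.subset ?_
  rintro P ⟨hP, hx⟩
  exact ⟨hP, x, hx, by simp⟩

/-- in every direction from every point there is a tile -/
lemma exists_dir (x u : ℂ) : ∃ Q ∈ T, x ∈ Q ∧ ∃ t : ℝ, 0 < t ∧ x + t • u ∈ Q := by
  obtain ⟨K, _, hK⟩ := tiles_count T
  have hfin := (hK x ‖u‖ (norm_nonneg _)).1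
  choose Q hQ hQm using fun n : ℕ => Til.cov (T := T) (x + (1 / ((n : ℝ) + 1)) • u)
  have hmem : ∀ n, Q n ∈ {P | P ∈ T ∧ (P ∩ Metric.closedBall x ‖u‖).Nonempty} := by
    intro n
    refine ⟨hQ n, _, hQm n, ?_⟩
    rw [Metric.mem_closedBall, dist_eq_norm, add_sub_cancel_left, norm_smul, Real.norm_eq_abs,
      abs_of_nonneg (by positivity)]
    apply mul_le_of_le_one_left (norm_nonneg _)
    rw [div_le_one (by positivity)]
    have : (0 : ℝ) ≤ n := by positivity
    linarith
  have : Finite {P | P ∈ T ∧ (P ∩ Metric.closedBall x ‖u‖).Nonempty} := hfin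
  obtain ⟨⟨P, hP⟩, hinf⟩ := Finite.exists_infinite_fiber
    (fun n : ℕ => (⟨Q n, hmem n⟩ : {P | P ∈ T ∧ (P ∩ Metric.closedBall x ‖u‖).Nonempty}))
  have hinf' : {n : ℕ | Q n = P}.Infinite := by
    rw [Set.infinite_coe_iff] at hinf
    refine hinf.mono ?_
    intro n hn
    simpa using hn
  refine ⟨P, hP.1, ?_, ?_⟩
  · apply (closed_tile hP.1).mem_of_frequently_of_tendsto (b := Filter.atTop)
      (f := fun n : ℕ => x + (1 / ((n : ℝ) + 1)) • u)
    · rw [Nat.frequently_atTop_iff_infinite]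
      refine hinf'.mono ?_
      intro n hn
      have := hQm n
      rwa [show Q n = P from hn] at this
    · have := (tendsto_one_div_add_atTop_nhds_zero_nat (𝕜 := ℝ)).smul_const u
      simpa using this.const_add x
  · obtain ⟨n, hn⟩ := hinf'.nonempty
    refine ⟨1 / ((n : ℝ) + 1), by positivity, ?_⟩
    have := hQm n
    rwa [show Q n = P from hn] at this

end
end MC

namespace MC

/-- `(x, y)` is an edge of the tiling with tile `P` on its left -/
structure IsDart (T : Set (Set ℂ)) (P : Set ℂ) (x y : ℂ) : Prop where
  hP : P ∈ T
  hx : x ∈ V T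
  hy : y ∈ V T
  xP : x ∈ P
  yP : y ∈ P
  ne : y - x ≠ 0
  left : ∀ z ∈ P, 0 ≤ cr (y - x) (z - x)
  noV : ∀ t : ℝ, 0 < t → t < 1 → x + t • (y - x) ∉ V T

lemma min_dir (S : Finset ℂ) (hS : S.Nonempty) (h0 : ∀ u ∈ S, u ≠ 0) {n : ℂ} (hn : n ≠ 0)
    (hl : ∀ u ∈ S, 0 ≤ cr n u) :
    ∃ u ∈ S, ∀ v ∈ S, 0 ≤ cr u v ∧ (∀ t : ℝ, v = t • u → 0 < t → 1 ≤ t) := by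
  obtain ⟨u, hu, hmin⟩ := Finset.exists_min_image S
    (fun u => (toLex ((u / n).arg, ‖u‖) : ℝ ×ₗ ℝ)) hS
  refine ⟨u, hu, fun v hv => ?_⟩
  have hm := hmin v hv
  rw [Prod.Lex.le_iff] at hm
  simp only [ofLex_toLex] at hm
  have him : ∀ w ∈ S, 0 ≤ (w / n).arg := by
    intro w hw
    rw [Complex.arg_nonneg_iff]
    rw [div_im_eq _ _ hn]
    exact div_nonneg (hl w hw) (Complex.normSq_nonneg _)
  have h1 := him u hu
  have h2 := Complex.arg_le_pi (v / n)
  constructor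
  · have e : cr u v = Complex.normSq n * cr (u / n) (v / n) := by
      rw [← cr_mul, mul_div_cancel₀ _ hn, mul_div_cancel₀ _ hn]
    rw [e, cr_polar' (u / n) (v / n) _ rfl]
    have : 0 ≤ Real.sin ((v / n).arg - (u / n).arg) := by
      apply Real.sin_nonneg_of_nonneg_of_le_pi
      · rcases hm with hm | hm <;> linarith
      · linarith
    have := Complex.normSq_nonneg n
    positivity
  · intro t ht t0
    have ha : (v / n).arg = (u / n).arg := by
      rw [ht, Complex.real_smul, mul_div_assoc, Complex.arg_real_mul _ t0]
    rcases hm with hm | hm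
    · rw [ha] at hm; exact absurd hm (lt_irrefl _)
    · have h3 := hm.2
      rw [ht, norm_smul, Real.norm_eq_abs, abs_of_pos t0] at h3
      have := norm_pos_iff.2 (h0 u hu)
      by_contra hc
      push Not at hc
      nlinarith

lemma cr_conj (a b : ℂ) : cr (starRingEnd ℂ a) (starRingEnd ℂ b) = - cr a b := by
  simp [cr]; ring

lemma max_dir (S : Finset ℂ) (hS : S.Nonempty) (h0 : ∀ u ∈ S, u ≠ 0) {n : ℂ} (hn : n ≠ 0)
    (hl : ∀ u ∈ S, 0 ≤ cr n u) :
    ∃ u ∈ S, ∀ v ∈ S, 0 ≤ cr v u ∧ (∀ t : ℝ, v = t • u → 0 < t → 1 ≤ t) := by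
  classical
  obtain ⟨u, hu, hm⟩ := min_dir (S.image (starRingEnd ℂ)) (hS.image _) (by
    intro u hu
    obtain ⟨w, hw, rfl⟩ := Finset.mem_image.1 hu
    simpa using h0 w hw) (n := - starRingEnd ℂ n) (by simpa using hn) (by
    intro u hu
    obtain ⟨w, hw, rfl⟩ := Finset.mem_image.1 hu
    rw [cr_neg_left, cr_conj]; simpa using hl w hw)
  obtain ⟨w, hw, rfl⟩ := Finset.mem_image.1 hu
  refine ⟨w, hw, fun v hv => ?_⟩
  have := hm _ (Finset.mem_image_of_mem _ hv)
  rw [cr_conj, ← cr_swap] at this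
  refine ⟨this.1, fun t ht => this.2 t ?_⟩
  rw [ht]; simp

lemma exists_N {p q c : ℝ} (hp : 0 < p) (hq : 0 < q) : ∃ N : ℝ, 0 < N * p + c ∧ 0 < N * q - c := by
  refine ⟨|c| / p + |c| / q + 1, ?_, ?_⟩
  · have h1 : (|c| / p + |c| / q + 1) * p = |c| + |c| / q * p + p := by field_simp
    have h2 : 0 ≤ |c| / q * p := by positivity
    have := neg_abs_le c
    linarith
  · have h1 : (|c| / p + |c| / q + 1) * q = |c| + |c| / p * q + q := by field_simp; ring
    have h2 : 0 ≤ |c| / p * q := by positivity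
    have := le_abs_self c
    linarith

section
variable {T : Set (Set ℂ)} [h : Til T]

lemma hull_left {P : Set ℂ} (hP : P ∈ T) {n x : ℂ}
    (hl : ∀ z ∈ V T ∩ P, 0 ≤ cr n (z - x)) : ∀ z ∈ P, 0 ≤ cr n (z - x) := by
  have hconv : Convex ℝ {z | 0 ≤ cr n (z - x)} := by
    intro z hz w hw s t hs ht hst
    have e : s • z + t • w - x = s • (z - x) + t • (w - x) := by
      have : (s : ℂ) + t = 1 := by exact_mod_cast hst
      simp only [Complex.real_smul]
      linear_combination x * this
    simp only [mem_ofPred_eq] at hz hw ⊢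
    rw [e, cr_add_right, cr_rsmul_right, cr_rsmul_right]; positivity
  have := convexHull_min (s := Set.extremePoints ℝ P)
    (fun z hz' => hl z ⟨⟨P, hP, hz'⟩, extremePoints_subset hz'⟩) hconv
  rw [ext_hull hP] at this
  exact this

lemma out_dir {P : Set ℂ} (hP : P ∈ T) {x a b : ℂ} (ha : a ≠ 0) (hb : b ≠ 0) (mb : x + b ∈ P)
    (ma : x + a ∈ P)
    (la : ∀ z ∈ P, 0 ≤ cr a (z - x)) (lb : ∀ z ∈ P, 0 ≤ cr b (z - x)) :
    ∃ κ : ℝ, 0 < κ ∧ b = κ • a := by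
  have h1 := la _ mb
  have h2 := lb _ ma
  rw [add_sub_cancel_left] at h1 h2
  rw [cr_swap] at h2
  obtain ⟨t, ht⟩ := par_of_cr ha (by linarith)
  obtain ⟨o, ho⟩ := Til.int P hP
  have g1 := strict_left ha la ho
  have g2 := strict_left hb lb ho
  refine ⟨t, ?_, by rw [ht]; simp⟩
  rw [ht, cr_smul_left] at g2
  by_contra hc
  push Not at hc
  nlinarith

lemma IsDart.out_unique {P : Set ℂ} {x y z : ℂ} (hy : IsDart T P x y) (hz : IsDart T P x z) :
    y = z := by
  obtain ⟨κ, k0, hk⟩ := out_dir hy.hP hy.ne hz.ne (by simpa using hz.yP) (by simpa using hy.yP)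
    hy.left hz.left
  rcases lt_trichotomy κ 1 with h1 | h1 | h1
  · exfalso
    apply hy.noV κ k0 h1
    rw [← hk]; simpa using hz.hy
  · rw [h1, one_smul] at hk
    exact (sub_left_inj.1 hk).symm
  · exfalso
    apply hz.noV κ⁻¹ (by positivity) (inv_lt_one_of_one_lt₀ h1)
    rw [hk, smul_smul, inv_mul_cancel₀ k0.ne', one_smul]; simpa using hy.hy

lemma IsDart.left' {P : Set ℂ} {x y : ℂ} (hy : IsDart T P x y) :
    ∀ z ∈ P, 0 ≤ cr (y - x) (z - y) := by
  intro z hz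
  have := hy.left z hz
  have e : z - x = (z - y) + (y - x) := by ring
  rw [e, cr_add_right, cr_self] at this
  simpa using this

lemma IsDart.in_unique {P : Set ℂ} {x y z : ℂ} (hy : IsDart T P y x) (hz : IsDart T P z x) :
    y = z := by
  have ly := hy.left'
  have lz := hz.left'
  have h1 := ly _ hz.xP
  have h2 := lz _ hy.xP
  have e1 : cr (x - y) (z - x) = - cr (x - y) (x - z) := by rw [← cr_neg_right]; congr 1; ring
  have e2 : cr (x - z) (y - x) = cr (x - y) (x - z) := by
    rw [cr_swap, ← cr_neg_left]; congr 1; ring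
  rw [e1] at h1; rw [e2] at h2
  obtain ⟨κ, hk⟩ := par_of_cr hy.ne (show cr (x - y) (x - z) = 0 by linarith)
  rw [← Complex.real_smul] at hk
  obtain ⟨o, ho⟩ := Til.int P hy.hP
  have g1 := strict_left hy.ne ly ho
  have g2 := strict_left hz.ne lz ho
  have k0 : 0 < κ := by
    rw [hk, cr_rsmul_left] at g2
    by_contra hc
    push Not at hc
    nlinarith
  rcases lt_trichotomy κ 1 with h1 | h1 | h1
  · exfalso
    apply hy.noV (1 - κ) (by linarith) (by linarith)
    have : y + (1 - κ) • (x - y) = z := by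
      rw [sub_smul, one_smul, ← hk]; ring
    rw [this]; exact hz.hx
  · rw [h1, one_smul] at hk
    exact (sub_right_inj.1 hk).symm
  · exfalso
    apply hz.noV (1 - κ⁻¹) (by have := inv_lt_one_of_one_lt₀ h1; linarith)
      (by have : 0 < κ⁻¹ := by positivity
          linarith)
    have : z + (1 - κ⁻¹) • (x - z) = y := by
      have e : κ⁻¹ • (x - z) = x - y := by
        rw [hk, smul_smul, inv_mul_cancel₀ k0.ne', one_smul]
      rw [sub_smul, one_smul, e]; ring
    rw [this]; exact hy.hx

lemma exists_other {P : Set ℂ} (hP : P ∈ T) (x : ℂ) : ∃ y ∈ V T ∩ P, y ≠ x := by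
  by_contra hc
  push Not at hc
  obtain ⟨o, ho⟩ := Til.int P hP
  have := hull_left hP (n := 1) (x := x) (fun z hz => by rw [hc z hz]; simp [cr])
  have h1 := strict_left one_ne_zero this ho
  have := hull_left hP (n := -1) (x := x) (fun z hz => by rw [hc z hz]; simp [cr])
  have h2 := strict_left (by simp) this ho
  rw [cr_neg_left] at h2
  linarith

lemma exists_succ {P : Set ℂ} (hP : P ∈ T) {x : ℂ} (hx : x ∈ V T) (xP : x ∈ P) :
    (∃ y, IsDart T P x y) ∧ (∃ z, IsDart T P z x) := by
  classical
  obtain ⟨n, hn, hl⟩ := supp_line (Til.cvx P hP) (Til.int P hP) (V_not_int hP hx)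
  set S : Finset ℂ := ((VP_finite hP).toFinset.erase x).image (fun z => z - x) with hS
  have hmem : ∀ u, u ∈ S ↔ (x + u ∈ V T ∧ x + u ∈ P) ∧ u ≠ 0 := by
    intro u
    simp only [hS, Finset.mem_image, Finset.mem_erase, Set.Finite.mem_toFinset, mem_inter_iff]
    constructor
    · rintro ⟨a, ⟨h1, h2⟩, rfl⟩
      exact ⟨by simpa using h2, sub_ne_zero.2 h1⟩
    · rintro ⟨h1, h2⟩
      exact ⟨x + u, ⟨by simpa using h2, h1⟩, by ring⟩
  have hne : S.Nonempty := by
    obtain ⟨y, hy, hyx⟩ := exists_other hP x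
    exact ⟨y - x, (hmem _).2 ⟨by simpa using hy, sub_ne_zero.2 hyx⟩⟩
  have h0 : ∀ u ∈ S, u ≠ 0 := fun u hu => ((hmem u).1 hu).2
  have hS' : ∀ u ∈ S, 0 ≤ cr n u := fun u hu => by
    simpa using hl _ ((hmem u).1 hu).1.2
  constructor
  · obtain ⟨u, hu, hm⟩ := min_dir S hne h0 hn hS'
    have hu' := (hmem u).1 hu
    refine ⟨x + u, hP, hx, hu'.1.1, xP, hu'.1.2, by simpa using hu'.2, ?_, ?_⟩
    · rw [add_sub_cancel_left]
      apply hull_left hP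
      intro z hz
      by_cases hzx : z = x
      · rw [hzx, sub_self, cr_zero_right]
      · exact (hm (z - x) ((hmem _).2 ⟨by simpa using hz, sub_ne_zero.2 hzx⟩)).1
    · intro t t0 t1 hV
      rw [add_sub_cancel_left] at hV
      have hin : x + t • u ∈ P := by
        have := (Til.cvx P hP) xP hu'.1.2 (show 0 ≤ 1 - t by linarith) t0.le (by ring)
        convert this using 1
        simp; ring
      have := (hm (t • u) ((hmem _).2 ⟨⟨hV, hin⟩, smul_ne_zero t0.ne' hu'.2⟩)).2 t rfl t0
      linarith
  · obtain ⟨u, hu, hm⟩ := max_dir S hne h0 hn hS'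
    have hu' := (hmem u).1 hu
    refine ⟨x + u, hP, hu'.1.1, hx, hu'.1.2, xP, by simpa using hu'.2, ?_, ?_⟩
    · have e : ∀ z, cr (x - (x + u)) (z - (x + u)) = cr (-u) (z - x) := by
        intro z; unfold cr; simp; ring
      intro z hz
      rw [e]
      revert z
      apply hull_left hP
      intro z hz
      by_cases hzx : z = x
      · rw [hzx, sub_self, cr_zero_right]
      · have := (hm (z - x) ((hmem _).2 ⟨by simpa using hz, sub_ne_zero.2 hzx⟩)).1
        rw [cr_neg_left, ← cr_swap]; exact this
    · intro t t0 t1 hV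
      have e : x + u + t • (x - (x + u)) = x + (1 - t) • u := by simp; ring
      rw [e] at hV
      have hin : x + (1 - t) • u ∈ P := by
        have := (Til.cvx P hP) xP hu'.1.2 t0.le (show 0 ≤ 1 - t by linarith) (by ring)
        convert this using 1
        simp; ring
      have := (hm ((1 - t) • u) ((hmem _).2 ⟨⟨hV, hin⟩,
        smul_ne_zero (by linarith) hu'.2⟩)).2 (1 - t) rfl (by linarith)
      linarith

/-- a tile is determined by a direction along which it lies on the left -/
lemma left_unique {P Q : Set ℂ} (hP : P ∈ T) (hQ : Q ∈ T) {x v : ℂ} (xP : x ∈ P) (xQ : x ∈ Q)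
    {s t : ℝ} (s0 : 0 < s) (t0 : 0 < t) (sP : x + s • v ∈ P) (tQ : x + t • v ∈ Q) (hv : v ≠ 0)
    (lP : ∀ z ∈ P, 0 ≤ cr v (z - x)) (lQ : ∀ z ∈ Q, 0 ≤ cr v (z - x)) : P = Q := by
  obtain ⟨o, ho⟩ := Til.int P hP
  obtain ⟨o', ho'⟩ := Til.int Q hQ
  have g1 := strict_left hv lP ho
  have g2 := strict_left hv lQ ho'
  obtain ⟨N, n1, n2⟩ := exists_N (c := cr (o' - x) (o - x)) g1 g2
  apply eq_of_cones hP hQ (x := x) (u := N • v + ((o - x) + (o' - x)))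
  · refine cone_int (Til.cvx P hP) xP sP (b := o - x) (by simpa using interior_subset ho) ?_ ?_ ?_
    · rw [cr_rsmul_left]; positivity
    · simp only [cr_rsmul_left, cr_add_right, cr_rsmul_right, cr_self]
      have := mul_pos s0 (add_pos g1 g2)
      linarith
    · simp only [cr_add_left, cr_rsmul_left, cr_self]; linarith
  · refine cone_int (Til.cvx Q hQ) xQ tQ (b := o' - x) (by simpa using interior_subset ho') ?_ ?_ ?_
    · rw [cr_rsmul_left]; positivity
    · simp only [cr_rsmul_left, cr_add_right, cr_rsmul_right, cr_self]
      have := mul_pos t0 (add_pos g1 g2)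
      linarith
    · simp only [cr_add_left, cr_rsmul_left, cr_self]
      linarith [cr_swap (o - x) (o' - x)]

lemma right_unique {P Q : Set ℂ} (hP : P ∈ T) (hQ : Q ∈ T) {x v : ℂ} (xP : x ∈ P) (xQ : x ∈ Q)
    {s t : ℝ} (s0 : 0 < s) (t0 : 0 < t) (sP : x + s • v ∈ P) (tQ : x + t • v ∈ Q) (hv : v ≠ 0)
    (lP : ∀ z ∈ P, cr v (z - x) ≤ 0) (lQ : ∀ z ∈ Q, cr v (z - x) ≤ 0) : P = Q := by
  obtain ⟨o, ho⟩ := Til.int P hP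
  obtain ⟨o', ho'⟩ := Til.int Q hQ
  have g1 := strict_left (neg_ne_zero.2 hv) (fun z hz => by
    rw [cr_neg_left]; linarith [lP z hz]) ho
  have g2 := strict_left (neg_ne_zero.2 hv) (fun z hz => by
    rw [cr_neg_left]; linarith [lQ z hz]) ho'
  rw [cr_neg_left, ← cr_swap] at g1 g2
  obtain ⟨N, n1, n2⟩ := exists_N (c := cr (o - x) (o' - x)) g1 g2
  apply eq_of_cones hP hQ (x := x) (u := N • v + ((o - x) + (o' - x)))
  · refine cone_int (Til.cvx P hP) xP (a := o - x) (by simpa using interior_subset ho) sP ?_ ?_ ?_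
    · rw [cr_rsmul_right]; positivity
    · simp only [cr_add_right, cr_rsmul_right, cr_self]; linarith
    · simp only [cr_rsmul_right, cr_add_left, cr_rsmul_left, cr_self]
      have := mul_pos s0 (add_pos g1 g2)
      linarith
  · refine cone_int (Til.cvx Q hQ) xQ (a := o' - x) (by simpa using interior_subset ho') tQ ?_ ?_ ?_
    · rw [cr_rsmul_right]; positivity
    · simp only [cr_add_right, cr_rsmul_right, cr_self]
      linarith [cr_swap (o - x) (o' - x)]
    · simp only [cr_rsmul_right, cr_add_left, cr_rsmul_left, cr_self]
      have := mul_pos t0 (add_pos g1 g2)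
      linarith

lemma IsDart.tile_unique {P Q : Set ℂ} {x y : ℂ} (hp : IsDart T P x y) (hq : IsDart T Q x y) :
    P = Q :=
  left_unique hp.hP hq.hP hp.xP hq.xP one_pos one_pos (by simpa using hp.yP) (by simpa using hq.yP)
    hp.ne hp.left hq.left

end
end MC

namespace MC
section
variable {T : Set (Set ℂ)} [h : Til T]

lemma sector_int {P : Set ℂ} (hP : P ∈ T) {x a b u : ℂ} (xP : x ∈ P) (aP : x + a ∈ P)
    (bP : x + b ∈ P) (ha : a ≠ 0) (hb : b ≠ 0) (la : ∀ z ∈ P, 0 ≤ cr a (z - x))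
    (lb : ∀ z ∈ P, 0 ≤ cr (z - x) b) (h1 : 0 < cr a u) (h2 : 0 < cr u b) :
    ∃ δ > 0, ∀ t : ℝ, 0 < t → t < δ → x + t • u ∈ interior P := by
  obtain ⟨o, ho⟩ := Til.int P hP
  have g1 := strict_left ha la ho
  have g2 := strict_left (neg_ne_zero.2 hb) (fun z hz => by
    rw [cr_neg_left, ← cr_swap]; exact lb z hz) ho
  rw [cr_neg_left, ← cr_swap] at g2
  have oP : x + (o - x) ∈ P := by simpa using interior_subset ho
  rcases lt_trichotomy (cr u (o - x)) 0 with g | g | g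
  · rw [cr_swap] at g
    exact cone_int (Til.cvx P hP) xP oP bP g2 (by linarith) h2
  · have ho0 : o - x ≠ 0 := by intro h0; rw [h0, cr_zero_right] at g1; exact lt_irrefl _ g1
    rw [cr_swap] at g
    obtain ⟨t, ht⟩ := par_of_cr ho0 (show cr (o - x) u = 0 by linarith)
    have t0 : 0 < t := by
      rw [ht, cr_smul_right] at h1
      by_contra hc
      push Not at hc
      nlinarith
    refine ⟨1 / t, by positivity, fun s s0 s1 => ?_⟩
    rw [lt_div_iff₀ t0] at s1
    have := (Til.cvx P hP).add_smul_sub_mem_interior xP ho (t := s * t) ⟨by positivity, s1.le⟩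
    convert this using 2
    rw [ht]; simp; ring
  · exact cone_int (Til.cvx P hP) xP aP oP g1 h1 g

/-- extremal point of a tile on a supporting line is extreme -/
lemma line_ext {Q : Set ℂ} (hQ : Q ∈ T) {m v : ℂ} (hv : v ≠ 0) (mQ : m ∈ Q)
    {ε : ℝ} (hε : ε ≠ 0) (hl : ∀ z ∈ Q, ε * cr v (z - m) ≤ 0) :
    ∃ t : ℝ, 0 ≤ t ∧ m + t • v ∈ Set.extremePoints ℝ Q := by
  have hcomp : IsCompact {t : ℝ | m + t • v ∈ Q} := by
    have : Topology.IsClosedEmbedding (fun t : ℝ => m + t • v) :=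
      (Homeomorph.addLeft m).isClosedEmbedding.comp (isClosedEmbedding_smul_left hv)
    exact this.isCompact_preimage (Til.cpt Q hQ)
  obtain ⟨t, ht, hmax⟩ := hcomp.exists_isMaxOn ⟨0, by simpa using mQ⟩ continuousOn_id
  refine ⟨t, by simpa using hmax (show (0 : ℝ) ∈ {t : ℝ | m + t • v ∈ Q} by simpa using mQ), ?_⟩
  rw [mem_extremePoints_iff_left]
  refine ⟨ht, ?_⟩
  rintro p hp q hq ⟨a, b, ha, hb, hab, e⟩
  have e' : (t : ℝ) • v = a • (p - m) + b • (q - m) := by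
    have : (a : ℂ) + b = 1 := by exact_mod_cast hab
    simp only [Complex.real_smul] at e ⊢
    linear_combination -e + m * this
  have hc : a * cr v (p - m) + b * cr v (q - m) = 0 := by
    rw [← cr_rsmul_right, ← cr_rsmul_right, ← cr_add_right, ← e', cr_rsmul_right, cr_self, mul_zero]
  have hp' := hl p hp
  have hq' := hl q hq
  have hc' : a * (ε * cr v (p - m)) + b * (ε * cr v (q - m)) = 0 := by linear_combination ε * hc
  have zp : cr v (p - m) = 0 := by
    have : ε * cr v (p - m) = 0 := by nlinarith
    simpa [hε] using this
  have zq : cr v (q - m) = 0 := by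
    have : ε * cr v (q - m) = 0 := by nlinarith
    simpa [hε] using this
  obtain ⟨s, hs⟩ := par_of_cr hv zp
  obtain ⟨r, hr⟩ := par_of_cr hv zq
  have ps : p = m + s • v := by rw [Complex.real_smul, ← hs]; ring
  have qr : q = m + r • v := by rw [Complex.real_smul, ← hr]; ring
  have s1 : s ≤ t := hmax (show s ∈ {t : ℝ | m + t • v ∈ Q} by rw [ps] at hp; exact hp)
  have r1 : r ≤ t := hmax (show r ∈ {t : ℝ | m + t • v ∈ Q} by rw [qr] at hq; exact hq)
  have e2 : t = a * s + b * r := by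
    rw [hs, hr] at e'
    simp only [Complex.real_smul] at e'
    have : ((t - (a * s + b * r) : ℝ) : ℂ) * v = 0 := by push_cast; linear_combination e'
    rcases mul_eq_zero.1 this with h0 | h0
    · have : t - (a * s + b * r) = 0 := by exact_mod_cast h0
      linarith
    · exact absurd h0 hv
  have e3 : a * (t - s) + b * (t - r) = 0 := by linear_combination t * hab + e2
  have : s = t := by nlinarith
  rw [ps, this]

lemma IsDart.exists_rev {P : Set ℂ} {x y : ℂ} (hd : IsDart T P x y) : ∃ Q, IsDart T Q y x := by
  set v := y - x with hv
  have hv0 : v ≠ 0 := hd.ne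
  set m := x + (1 / 2 : ℝ) • v with hm
  have hmy : m + (1 / 2 : ℝ) • v = y := by rw [hm, hv]; simp; ring
  have hmx : m + (1 / 2 : ℝ) • (-v) = x := by rw [hm, hv]; simp; ring
  have mP : m ∈ P := by
    have := (Til.cvx P hd.hP) hd.xP hd.yP (show (0 : ℝ) ≤ 1 / 2 by norm_num)
      (show (0 : ℝ) ≤ 1 / 2 by norm_num) (by norm_num)
    convert this using 1
    rw [hm, hv]; simp; ring
  have lm : ∀ z, cr v (z - m) = cr v (z - x) := by
    intro z
    have : z - m = (z - x) - (1 / 2 : ℝ) • v := by rw [hm]; ring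
    rw [this, cr_sub_right, cr_rsmul_right, cr_self]; ring
  obtain ⟨Q, hQ, mQ, t, t0, tQ⟩ := exists_dir (T := T) m (-Complex.I * v)
  have hneg : cr v (m + t • (-Complex.I * v) - m) < 0 := by
    rw [add_sub_cancel_left, cr_rsmul_right]
    have : cr v (-Complex.I * v) = - Complex.normSq v := by
      simp [cr, Complex.normSq_apply]; ring
    rw [this]
    have := Complex.normSq_pos.2 hv0
    nlinarith
  have hne : P ≠ Q := by
    rintro rfl
    have := hd.left _ tQ
    rw [← hv, ← lm] at this
    linarith
  have hQr : ∀ z ∈ Q, cr v (z - m) ≤ 0 := by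
    intro z hz
    by_contra hc
    push Not at hc
    obtain ⟨δ, d0, hδ⟩ := sector_int hd.hP (x := m) (a := (1 / 2 : ℝ) • v)
      (b := (1 / 2 : ℝ) • (-v)) (u := z - m) mP (by rw [hmy]; exact hd.yP)
      (by rw [hmx]; exact hd.xP) (by simpa using hv0) (by simpa using hv0)
      (fun w hw => by rw [cr_rsmul_left, lm]; have := hd.left w hw; positivity)
      (fun w hw => by
        rw [cr_rsmul_right, cr_neg_right, ← cr_swap, lm]; have := hd.left w hw; positivity)
      (by rw [cr_rsmul_left]; positivity)
      (by rw [cr_rsmul_right, cr_neg_right, ← cr_swap]; positivity)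
    have hs0 : 0 < min (δ / 2) 1 := by positivity
    have h1 := hδ (min (δ / 2) 1) hs0 (by have := min_le_left (δ / 2) 1; linarith)
    have h2 : m + (min (δ / 2) 1) • (z - m) ∈ Q :=
      (Til.cvx Q hQ).add_smul_sub_mem mQ hz ⟨hs0.le, min_le_right _ _⟩
    exact hne (eq_of_int_mem hd.hP hQ h1 h2)
  have getmem : ∀ w : ℂ, w ≠ 0 → (∃ t : ℝ, 0 ≤ t ∧ m + t • w ∈ Set.extremePoints ℝ Q) →
      (∀ t : ℝ, 0 ≤ t → t < 1 / 2 → m + t • w ∉ V T) → m + (1 / 2 : ℝ) • w ∈ Q := by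
    rintro w hw ⟨t, t0, ht⟩ hno
    have h1 : 1 / 2 ≤ t := by
      by_contra hc
      push Not at hc
      exact hno t t0 hc ⟨Q, hQ, ht⟩
    have := (Til.cvx Q hQ).add_smul_sub_mem mQ (extremePoints_subset ht) (t := 1 / 2 / t)
      ⟨by positivity, by rw [div_le_one (by linarith)]; exact h1⟩
    convert this using 2
    rw [add_sub_cancel_left, smul_smul, div_mul_cancel₀ _ (by linarith)]
  have yQ : y ∈ Q := by
    rw [← hmy]
    apply getmem v hv0 (line_ext hQ hv0 mQ one_ne_zero (by simpa using hQr))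
    intro t t0 t1 hV
    apply hd.noV (1 / 2 + t) (by linarith) (by linarith)
    rw [← hv, add_smul, ← add_assoc, ← hm]; exact hV
  have xQ : x ∈ Q := by
    rw [← hmx]
    apply getmem (-v) (neg_ne_zero.2 hv0)
    · exact line_ext hQ (neg_ne_zero.2 hv0) mQ (ε := -1) (by norm_num)
        (fun z hz => by rw [cr_neg_left]; linarith [hQr z hz])
    · intro t t0 t1 hV
      apply hd.noV (1 / 2 - t) (by linarith) (by linarith)
      rw [← hv, sub_smul, sub_eq_add_neg, ← smul_neg, ← add_assoc, ← hm]; exact hV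
  refine ⟨Q, hQ, hd.hy, hd.hx, yQ, xQ, ?_, ?_, ?_⟩
  · rw [← neg_sub]; exact neg_ne_zero.2 hv0
  · intro z hz
    have := hQr z hz
    rw [lm] at this
    have e : cr (x - y) (z - y) = - cr v (z - x) := by rw [hv]; unfold cr; simp; ring
    rw [e]; linarith
  · intro t t0 t1
    have := hd.noV (1 - t) (by linarith) (by linarith)
    convert this using 2
    simp; ring

/-- the type of darts -/
def D (T : Set (Set ℂ)) : Type := {p : ℂ × ℂ // ∃ P, IsDart T P p.1 p.2}

def src (d : D T) : ℂ := d.1.1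
def tgt (d : D T) : ℂ := d.1.2
def lt (d : D T) : Set ℂ := d.2.choose
def vec (d : D T) : ℂ := tgt d - src d
def mkD {P : Set ℂ} {x y : ℂ} (hd : IsDart T P x y) : D T := ⟨(x, y), P, hd⟩

lemma spec (d : D T) : IsDart T (lt d) (src d) (tgt d) := d.2.choose_spec
@[simp] lemma src_mk {P : Set ℂ} {x y : ℂ} (hd : IsDart T P x y) : src (mkD hd) = x := rfl
@[simp] lemma tgt_mk {P : Set ℂ} {x y : ℂ} (hd : IsDart T P x y) : tgt (mkD hd) = y := rfl
@[simp] lemma lt_mk {P : Set ℂ} {x y : ℂ} (hd : IsDart T P x y) : lt (mkD hd) = P :=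
  (spec (mkD hd)).tile_unique hd
lemma dext {d e : D T} (h1 : src d = src e) (h2 : tgt d = tgt e) : d = e :=
  Subtype.ext (Prod.ext h1 h2)
lemma vec_ne (d : D T) : vec d ≠ 0 := (spec d).ne
lemma dext_vec {d e : D T} (h1 : src d = src e) (h2 : vec d = vec e) : d = e := by
  refine dext h1 ?_
  unfold vec at h2; rw [h1] at h2; exact sub_left_inj.1 h2
lemma dext_out {d e : D T} (h1 : src d = src e) (h2 : lt d = lt e) : d = e := by
  refine dext h1 ?_
  have := spec d
  rw [h1, h2] at this
  exact this.out_unique (spec e)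
lemma dext_in {d e : D T} (h1 : tgt d = tgt e) (h2 : lt d = lt e) : d = e := by
  refine dext ?_ h1
  have := spec d
  rw [h1, h2] at this
  exact this.in_unique (spec e)

lemma out_exists {P : Set ℂ} (hP : P ∈ T) {x : ℂ} (hx : x ∈ V T) (xP : x ∈ P) :
    ∃ d : D T, src d = x ∧ lt d = P := by
  obtain ⟨y, hy⟩ := (exists_succ hP hx xP).1
  exact ⟨mkD hy, rfl, lt_mk hy⟩
lemma in_exists {P : Set ℂ} (hP : P ∈ T) {x : ℂ} (hx : x ∈ V T) (xP : x ∈ P) :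
    ∃ d : D T, tgt d = x ∧ lt d = P := by
  obtain ⟨y, hy⟩ := (exists_succ hP hx xP).2
  exact ⟨mkD hy, rfl, lt_mk hy⟩

lemma nxt_ex (d : D T) : ∃ e : D T, src e = tgt d ∧ lt e = lt d :=
  out_exists (spec d).hP (spec d).hy (spec d).yP
lemma prv_ex (d : D T) : ∃ e : D T, tgt e = src d ∧ lt e = lt d :=
  in_exists (spec d).hP (spec d).hx (spec d).xP

/-- next dart around the left tile -/
def nx : Equiv.Perm (D T) where
  toFun d := (nxt_ex d).choose
  invFun d := (prv_ex d).choose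
  left_inv d := by
    have h1 := (nxt_ex d).choose_spec
    have h2 := (prv_ex (nxt_ex d).choose).choose_spec
    exact dext_in (h2.1.trans h1.1) (h2.2.trans h1.2)
  right_inv d := by
    have h1 := (prv_ex d).choose_spec
    have h2 := (nxt_ex (prv_ex d).choose).choose_spec
    exact dext_out (h2.1.trans h1.1) (h2.2.trans h1.2)

lemma src_nx (d : D T) : src (nx d) = tgt d := (nxt_ex d).choose_spec.1
lemma lt_nx (d : D T) : lt (nx d) = lt d := (nxt_ex d).choose_spec.2
lemma tgt_nxi (d : D T) : tgt (nx⁻¹ d) = src d := (prv_ex d).choose_spec.1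
lemma lt_nxi (d : D T) : lt (nx⁻¹ d) = lt d := (prv_ex d).choose_spec.2

/-- opposite dart -/
def rv : Equiv.Perm (D T) where
  toFun d := mkD (spec d).exists_rev.choose_spec
  invFun d := mkD (spec d).exists_rev.choose_spec
  left_inv d := dext rfl rfl
  right_inv d := dext rfl rfl

@[simp] lemma src_rv (d : D T) : src (rv d) = tgt d := rfl
@[simp] lemma tgt_rv (d : D T) : tgt (rv d) = src d := rfl
@[simp] lemma rv_rv (d : D T) : rv (rv d) = d := dext rfl rfl
lemma vec_rv (d : D T) : vec (rv d) = - vec d := by unfold vec; simp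

/-- counterclockwise rotation about the source -/
def sg : Equiv.Perm (D T) := rv * nx⁻¹

lemma sg_apply (d : D T) : sg d = rv (nx⁻¹ d) := rfl
lemma src_sg (d : D T) : src (sg d) = src d := by rw [sg_apply, src_rv, tgt_nxi]
lemma nx_eq (d : D T) : nx d = sg⁻¹ (rv d) := by
  rw [Equiv.Perm.eq_inv_iff_eq, sg_apply]; simp
lemma rv_nx (d : D T) : sg (nx d) = rv d := by rw [sg_apply]; simp
lemma lt_rv_sg (d : D T) : lt (rv (sg d)) = lt d := by rw [sg_apply, rv_rv, lt_nxi]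
lemma lt_rv (d : D T) : lt (rv d) = lt (sg⁻¹ d) := by
  have := lt_rv_sg (sg⁻¹ d); simpa using this

lemma right_of (d : D T) : ∀ z ∈ lt (rv d), cr (vec d) (z - src d) ≤ 0 := by
  intro z hz
  have := (spec (rv d)).left' z hz
  simp only [src_rv, tgt_rv] at this
  have e : src d - tgt d = - vec d := by unfold vec; ring
  rw [e, cr_neg_left] at this
  linarith

/-- angle of the left tile at the source -/
def ang (d : D T) : ℝ := (vec (sg d) / vec d).arg

lemma cr_sg_nonneg (d : D T) : 0 ≤ cr (vec d) (vec (sg d)) := by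
  have h1 := (spec (rv (sg d))).xP
  rw [lt_rv_sg] at h1
  have := (spec d).left _ h1
  simp only [src_rv] at this
  unfold vec; rw [src_sg]; exact this

lemma left_sg (d : D T) : ∀ z ∈ lt d, 0 ≤ cr (z - src d) (vec (sg d)) := by
  intro z hz
  rw [← lt_rv_sg] at hz
  have := right_of (sg d) z hz
  rw [src_sg] at this
  rw [cr_swap]; linarith

lemma sg_flat {d : D T} (h0 : cr (vec d) (vec (sg d)) = 0) :
    ∃ t : ℝ, 0 < t ∧ vec (sg d) = -(t • vec d) := by
  obtain ⟨t, ht⟩ := par_of_cr (vec_ne d) h0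
  obtain ⟨o, ho⟩ := Til.int _ (spec d).hP
  have g1 : 0 < cr (vec d) (o - src d) := strict_left (vec_ne d) (spec d).left ho
  have g2 := left_sg d o (interior_subset ho)
  rw [ht, cr_smul_right, cr_swap] at g2
  have ht0 : t ≠ 0 := by
    rintro rfl
    exact vec_ne (sg d) (by rw [ht]; simp)
  refine ⟨-t, ?_, by rw [ht]; simp⟩
  have : t ≤ 0 := by
    by_contra hc
    push Not at hc
    nlinarith
  have := lt_of_le_of_ne this ht0
  linarith

lemma ang_pi_iff (d : D T) : ang d = Real.pi ↔ cr (vec d) (vec (sg d)) = 0 := by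
  constructor
  · intro h1
    have := (Complex.arg_eq_pi_iff.1 h1).2
    exact (div_im_zero (vec_ne d)).1 this
  · intro h0
    obtain ⟨t, t0, ht⟩ := sg_flat h0
    unfold ang
    rw [ht]
    have : -(t • vec d) / vec d = ((-t : ℝ) : ℂ) := by
      have := vec_ne d
      simp; field_simp
    rw [this, Complex.arg_ofReal_of_neg (by linarith)]

lemma ang_pos (d : D T) : 0 < ang d := by
  rcases (cr_sg_nonneg d).lt_or_eq with h1 | h1
  · exact (arg_cr_pos (vec_ne d) h1).1
  · rw [(ang_pi_iff d).2 h1.symm]; exact Real.pi_pos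

lemma ang_le (d : D T) : ang d ≤ Real.pi := Complex.arg_le_pi _

lemma ang_pi_iff_ext (d : D T) : ang d = Real.pi ↔ src d ∉ Set.extremePoints ℝ (lt d) := by
  rw [ang_pi_iff]
  have hp : tgt (sg d) ∈ lt d := by
    have := (spec (rv (sg d))).xP
    rwa [lt_rv_sg] at this
  constructor
  · intro h0 he
    obtain ⟨t, t0, ht⟩ := sg_flat h0
    rw [mem_extremePoints] at he
    have h1 := (he.2 (tgt d) (spec d).yP (tgt (sg d)) hp ⟨t / (1 + t), 1 / (1 + t), by positivity,
      by positivity, by field_simp; ring, by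
        have e : tgt (sg d) = src d - t * (tgt d - src d) := by
          have : tgt (sg d) = src d + vec (sg d) := by unfold vec; rw [src_sg]; ring
          rw [this, ht]; simp [vec]; ring
        have : (1 + t : ℂ) ≠ 0 := by exact_mod_cast (by positivity : (1 + t : ℝ) ≠ 0)
        rw [e]; simp; field_simp; ring⟩).1
    exact vec_ne d (by unfold vec; rw [h1, sub_self])
  · intro he
    by_contra hne
    have hpos := lt_of_le_of_ne (cr_sg_nonneg d) (Ne.symm hne)
    apply he
    rw [mem_extremePoints_iff_left]
    refine ⟨(spec d).xP, ?_⟩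
    rintro p hp q hq ⟨a, b, ha, hb, hab, e⟩
    have e' : a • (p - src d) + b • (q - src d) = 0 := by
      have : (a : ℂ) + b = 1 := by exact_mod_cast hab
      simp only [Complex.real_smul] at e ⊢
      linear_combination e - src d * this
    have c1 : a * cr (vec d) (p - src d) + b * cr (vec d) (q - src d) = 0 := by
      rw [← cr_rsmul_right, ← cr_rsmul_right, ← cr_add_right, e', cr_zero_right]
    have c2 : a * cr (p - src d) (vec (sg d)) + b * cr (q - src d) (vec (sg d)) = 0 := by
      rw [← cr_rsmul_left, ← cr_rsmul_left, ← cr_add_left, e', cr_zero_left]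
    have l1 : 0 ≤ cr (vec d) (p - src d) := (spec d).left p hp
    have l2 : 0 ≤ cr (vec d) (q - src d) := (spec d).left q hq
    have l3 := left_sg d p hp
    have l4 := left_sg d q hq
    have z1 : cr (vec d) (p - src d) = 0 := by nlinarith
    have z2 : cr (p - src d) (vec (sg d)) = 0 := by nlinarith
    have := decomp (vec d) (vec (sg d)) (p - src d)
    rw [z1, z2] at this
    have : p - src d = 0 := by
      have hne' : (cr (vec d) (vec (sg d)) : ℂ) ≠ 0 := by exact_mod_cast hpos.ne'
      simpa [hne'] using this
    exact sub_eq_zero.1 this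

end
end MC

namespace MC
section
variable {T : Set (Set ℂ)} [h : Til T]

lemma dat_finite (x : ℂ) : {d : D T | src d = x}.Finite := by
  refine Set.Finite.of_finite_image (f := lt) ((Cor_finite (T := T) x).subset ?_) ?_
  · rintro _ ⟨d, hd, rfl⟩
    have := (spec d)
    exact ⟨this.hP, by rw [← show src d = x from hd]; exact this.xP⟩
  · intro d hd e he hde
    exact dext_out ((show src d = x from hd).trans (show src e = x from he).symm) hde

/-- darts at a vertex -/
def dat (x : ℂ) : Finset (D T) := (dat_finite x).toFinset
@[simp] lemma mem_dat {x : ℂ} {d : D T} : d ∈ dat x ↔ src d = x := by simp [dat]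

lemma dtl_finite (P : Set ℂ) : {d : D T | lt d = P}.Finite := by
  by_cases hP : P ∈ T
  · refine Set.Finite.of_finite_image (f := src) ((VP_finite hP).subset ?_) ?_
    · rintro _ ⟨d, hd, rfl⟩
      have := (spec d)
      exact ⟨this.hx, by rw [← show lt d = P from hd]; exact this.xP⟩
    · intro d hd e he hde
      exact dext_out hde ((show lt d = P from hd).trans (show lt e = P from he).symm)
  · convert Set.finite_empty
    ext d
    simp only [mem_ofPred_eq, mem_empty_iff_false, iff_false]
    rintro rfl
    exact hP (spec d).hP

/-- darts of a tile -/
def dtl (P : Set ℂ) : Finset (D T) := (dtl_finite P).toFinset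
@[simp] lemma mem_dtl {P : Set ℂ} {d : D T} : d ∈ dtl P ↔ lt d = P := by simp [dtl]

lemma add_vec (d : D T) : src d + vec d = tgt d := by unfold vec; ring
lemma tgt_sg_mem (d : D T) : tgt (sg d) ∈ lt d := by
  have := (spec (rv (sg d))).xP
  rwa [lt_rv_sg] at this

lemma sg_disj {d e : D T} (he : src d = src e) {u : ℂ} (h1 : 0 < cr (vec d) u)
    (h2 : 0 < cr u (vec (sg d))) (h3 : 0 < cr (vec e) u) (h4 : 0 < cr u (vec (sg e))) : d = e := by
  have key : ∀ d : D T, 0 < cr (vec d) u → 0 < cr u (vec (sg d)) →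
      ∃ δ > 0, ∀ t : ℝ, 0 < t → t < δ → src d + t • u ∈ interior (lt d) := by
    intro d h1 h2
    refine sector_int (spec d).hP (spec d).xP (by rw [add_vec]; exact (spec d).yP)
      (by rw [← src_sg, add_vec]; exact tgt_sg_mem d) (vec_ne d) (vec_ne _) (spec d).left
      (left_sg d) h1 h2
  have k1 := key d h1 h2
  have k2 := key e h3 h4
  rw [← he] at k2
  exact dext_out he (eq_of_cones (spec d).hP (spec e).hP k1 k2)

lemma sum_ang' {S : Finset (D T)} {x : ℂ} (hS : ∀ d ∈ S, src d = x) (hne : S.Nonempty)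
    (hsg : ∀ d ∈ S, sg d ∈ S) : ∑ d ∈ S, ang d = 2 * Real.pi :=
  sum_arg S sg hsg sg.injective.injOn vec (fun d _ => vec_ne d) (fun d _ => ang_pos d)
    (fun d hd e he u h1 h2 h3 h4 => sg_disj ((hS d hd).trans (hS e he).symm) h1 h2 h3 h4) hne

lemma dat_src_ne (d : D T) : (dat (src d) : Finset (D T)).Nonempty := ⟨d, by simp⟩

lemma sum_ang (d : D T) : ∑ e ∈ (dat (src d) : Finset (D T)), ang e = 2 * Real.pi :=
  sum_ang' (x := src d) (fun e he => by simpa using he) (dat_src_ne d)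
    (fun e he => by simpa [src_sg] using he)

/-- generic: positive weights force single orbit -/
lemma single_orbit {α : Type*} (f : Equiv.Perm α) (S : Finset α) (hf : ∀ d ∈ S, f d ∈ S)
    (w : α → ℝ) (hw : ∀ d ∈ S, 0 < w d) (c : ℝ)
    (hs : ∀ S' ⊆ S, S'.Nonempty → (∀ d ∈ S', f d ∈ S') → ∑ d ∈ S', w d = c) :
    f.IsCycleOn (S : Set α) := by
  classical
  have hfp : ∀ n : ℕ, ∀ d ∈ S, (f ^ n) d ∈ S := by
    intro n
    induction n with
    | zero => intro d hd; simpa using hd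
    | succ n ih => intro d hd; rw [pow_succ', Equiv.Perm.mul_apply]; exact hf _ (ih d hd)
  refine ⟨?_, ?_⟩
  · refine ⟨fun d hd => hf d hd, f.injective.injOn, ?_⟩
    have := Finset.surj_on_of_inj_on_of_card_le (s := S) (t := S) (fun a _ => f a)
      (fun a ha => hf a ha) (fun a b _ _ h => f.injective h) le_rfl
    intro b hb
    obtain ⟨a, ha, e⟩ := this b hb
    exact ⟨a, ha, e.symm⟩
  · intro d hd e he
    set S' := S.filter (fun e => ∃ n : ℕ, (f ^ n) d = e) with hS'
    have hd' : d ∈ S' := Finset.mem_filter.2 ⟨hd, 0, rfl⟩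
    have h1 := hs S' (Finset.filter_subset _ _) ⟨d, hd'⟩ (by
      intro a ha
      obtain ⟨ha, n, hn⟩ := Finset.mem_filter.1 ha
      exact Finset.mem_filter.2 ⟨hf a ha, n + 1, by
        rw [pow_succ', Equiv.Perm.mul_apply, hn]⟩)
    have h2 := hs S subset_rfl ⟨d, hd⟩ hf
    by_contra hne
    have he' : e ∉ S' := by
      intro h
      obtain ⟨_, n, hn⟩ := Finset.mem_filter.1 h
      exact hne ⟨n, by simpa using hn⟩
    have := Finset.sum_lt_sum_of_subset (f := w) (Finset.filter_subset (fun e => ∃ n : ℕ, (f ^ n) d = e) S)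
      he he' (hw e he) (fun j hj _ => (hw j hj).le)
    rw [← hS'] at this
    linarith

lemma cyc_sg (x : ℂ) : (sg : Equiv.Perm (D T)).IsCycleOn (dat x : Finset (D T)) := by
  refine single_orbit sg _ (fun e he => by simpa [src_sg] using he) ang (fun d _ => ang_pos d)
    (2 * Real.pi) ?_
  intro S' hS hne hf
  exact sum_ang' (x := x) (fun d hd => by simpa using hS hd) hne hf

lemma fan_pos {o : ℂ} {d : D T} (ho : o ∈ interior (lt d)) :
    0 < cr (src d - o) (tgt d - o) := by
  have := strict_left (spec d).ne (spec d).left ho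
  have e : cr (src d - o) (tgt d - o) = cr (tgt d - src d) (o - src d) := by
    unfold cr; simp; ring
  rwa [e]

lemma fan_hit {o : ℂ} {d : D T} (ho : o ∈ interior (lt d)) {u : ℂ}
    (h1 : 0 < cr (src d - o) u) (h2 : 0 < cr u (tgt d - o)) :
    ∃ l : ℝ, 0 < l ∧ ∃ τ : ℝ, 0 < τ ∧ τ < 1 ∧ o + l • u = src d + τ • (tgt d - src d) := by
  have hp := fan_pos ho
  set a := src d - o
  set b := tgt d - o
  have hs : 0 < cr u b + cr a u := by linarith
  refine ⟨cr a b / (cr u b + cr a u), by positivity, cr a u / (cr u b + cr a u), by positivity, ?_, ?_⟩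
  · rw [div_lt_one hs]; linarith
  · have := decomp a b u
    have hs' : (cr u b + cr a u : ℂ) ≠ 0 := by exact_mod_cast hs.ne'
    have e1 : src d = o + a := by simp [a]
    have e2 : tgt d = o + b := by simp [b]
    rw [e1, e2]
    simp only [Complex.real_smul]
    push_cast
    field_simp
    linear_combination this

lemma fan_le {o : ℂ} {d e : D T} (hde : lt d = lt e) (ho : o ∈ interior (lt d)) {u : ℂ} {l m τ σ : ℝ}
    (hl : 0 < l) (hm : 0 < m) (h1 : 0 < τ) (h2 : τ < 1)
    (e1 : o + l • u = src d + τ • (tgt d - src d))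
    (e2 : o + m • u = src e + σ • (tgt e - src e)) : l ≤ m := by
  have hq : o + l • u ∈ lt e := by
    rw [e1, ← hde]
    exact (Til.cvx _ (spec d).hP).add_smul_sub_mem (spec d).xP (spec d).yP ⟨h1.le, h2.le⟩
  have c1 := (spec e).left _ hq
  have c2 := strict_left (spec e).ne (spec e).left (hde ▸ ho)
  have c3 : cr (tgt e - src e) (o + m • u - src e) = 0 := by
    rw [e2, add_sub_cancel_left, cr_rsmul_right, cr_self, mul_zero]
  have x1 : ∀ s : ℝ, o + s • u - src e = (o - src e) + s • u := fun s => by ring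
  rw [x1, cr_add_right, cr_rsmul_right] at c1 c3
  by_contra hc
  push Not at hc
  nlinarith

lemma fan_one {d e : D T} (hde : lt d = lt e) {q : ℂ} {τ σ : ℝ} (h1 : 0 < τ) (h2 : τ < 1)
    (h3 : 0 < σ) (h4 : σ < 1)
    (e1 : q = src d + τ • (tgt d - src d)) (e2 : q = src e + σ • (tgt e - src e))
    {κ : ℝ} (k0 : 0 < κ) (hk : tgt e - q = κ • (tgt d - q)) : 1 ≤ κ := by
  by_contra hc
  push Not at hc
  have := (spec d).noV (τ + κ * (1 - τ)) (by nlinarith) (by nlinarith)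
  apply this
  convert (spec e).hy using 1
  have : tgt e = q + κ • (tgt d - q) := by rw [← hk]; ring
  rw [this, e1]
  simp
  ring

lemma fan_disj {o : ℂ} {d e : D T} (hde : lt d = lt e) (ho : o ∈ interior (lt d)) {u : ℂ}
    (h1 : 0 < cr (src d - o) u) (h2 : 0 < cr u (tgt d - o))
    (h3 : 0 < cr (src e - o) u) (h4 : 0 < cr u (tgt e - o)) : d = e := by
  obtain ⟨l, l0, τ, t0, t1, e1⟩ := fan_hit ho h1 h2
  obtain ⟨m, m0, σ, s0, s1, e2⟩ := fan_hit (hde ▸ ho) h3 h4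
  have hlm : l = m := le_antisymm (fan_le hde ho l0 m0 t0 t1 e1 e2)
    (fan_le hde.symm (hde ▸ ho) m0 l0 s0 s1 e2 e1)
  subst hlm
  set q := o + l • u
  have a1 : tgt d - q = (1 - τ) • vec d := by rw [e1]; simp [vec]; ring
  have a2 : tgt e - q = (1 - σ) • vec e := by rw [e2]; simp [vec]; ring
  have n1 : tgt d - q ≠ 0 := by rw [a1]; exact smul_ne_zero (by linarith) (vec_ne d)
  have n2 : tgt e - q ≠ 0 := by rw [a2]; exact smul_ne_zero (by linarith) (vec_ne e)
  have l1 : ∀ z ∈ lt d, 0 ≤ cr (tgt d - q) (z - q) := by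
    intro z hz
    have := (spec d).left z hz
    have x : z - q = (z - src d) - τ • vec d := by rw [e1]; simp [vec]; ring
    rw [a1, x, cr_rsmul_left, cr_sub_right, cr_rsmul_right, cr_self]
    have : 0 ≤ cr (vec d) (z - src d) := this
    have : 0 < 1 - τ := by linarith
    simp only [mul_zero, sub_zero]
    positivity
  have l2 : ∀ z ∈ lt d, 0 ≤ cr (tgt e - q) (z - q) := by
    intro z hz
    have := (spec e).left z (hde ▸ hz)
    have x : z - q = (z - src e) - σ • vec e := by rw [e2]; simp [vec]; ring
    rw [a2, x, cr_rsmul_left, cr_sub_right, cr_rsmul_right, cr_self]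
    have : 0 ≤ cr (vec e) (z - src e) := this
    have : 0 < 1 - σ := by linarith
    simp only [mul_zero, sub_zero]
    positivity
  have y1 : q + (tgt d - q) = tgt d := by ring
  have y2 : q + (tgt e - q) = tgt e := by ring
  obtain ⟨κ, k0, hk⟩ := out_dir (spec d).hP n1 n2 (by rw [y2, hde]; exact (spec e).yP)
    (by rw [y1]; exact (spec d).yP) l1 l2
  have k1 := fan_one hde t0 t1 s0 s1 e1 e2 k0 hk
  have k2 := fan_one hde.symm s0 s1 t0 t1 e2 e1 (inv_pos.2 k0) (by
    rw [hk, smul_smul, inv_mul_cancel₀ k0.ne', one_smul])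
  have : κ = 1 := by
    have := (one_le_inv₀ k0).1 k2
    linarith
  rw [this, one_smul] at hk
  exact dext_in (sub_left_inj.1 hk).symm hde


lemma sum_fan {S : Finset (D T)} {P : Set ℂ} {o : ℂ} (ho : o ∈ interior P)
    (hS : ∀ d ∈ S, lt d = P) (hne : S.Nonempty) (hnx : ∀ d ∈ S, nx d ∈ S) :
    ∑ d ∈ S, ((tgt d - o) / (src d - o)).arg = 2 * Real.pi := by
  have hsv : ∀ d ∈ S, src d - o ≠ 0 := by
    intro d hd h0
    have := fan_pos (d := d) (o := o) (by rw [hS d hd]; exact ho)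
    rw [h0, cr_zero_left] at this
    exact lt_irrefl _ this
  have := sum_arg S nx hnx nx.injective.injOn (fun d => src d - o) hsv
    (by
      intro d hd
      rw [src_nx]
      exact (arg_cr_pos (hsv d hd) (fan_pos (by rw [hS d hd]; exact ho))).1)
    (by
      intro d hd e he u
      rw [src_nx, src_nx]
      intro h1 h2 h3 h4
      exact fan_disj ((hS d hd).trans (hS e he).symm) (by rw [hS d hd]; exact ho) h1 h2 h3 h4) hne
  simpa only [src_nx] using this

lemma cyc_nx (P : Set ℂ) : (nx : Equiv.Perm (D T)).IsCycleOn (dtl P : Finset (D T)) := by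
  by_cases hP : P ∈ T
  · obtain ⟨o, ho⟩ := Til.int P hP
    refine single_orbit nx _ (fun e he => by simpa [lt_nx] using he)
      (fun d => ((tgt d - o) / (src d - o)).arg) (fun d hd => ?_) (2 * Real.pi) ?_
    · have hd : lt d = P := by simpa using hd
      have h1 := fan_pos (d := d) (o := o) (by rw [hd]; exact ho)
      refine (arg_cr_pos ?_ h1).1
      intro h0
      rw [h0, cr_zero_left] at h1
      exact lt_irrefl _ h1
    · intro S' hS hne hf
      exact sum_fan ho (fun d hd => by simpa using hS hd) hne hf
  · have : (dtl P : Finset (D T)) = ∅ := by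
      ext d; simp; rintro rfl; exact hP (spec d).hP
    rw [this]; simp

lemma arg_add_of {a b c : ℂ} (ha : a ≠ 0) (h1 : 0 < cr a b) (h2 : 0 < cr b c)
    (h3 : 0 < (c / a).arg) : (b / a).arg + (c / b).arg = (c / a).arg := by
  have hb : b ≠ 0 := by rintro rfl; rw [cr_zero_left] at h2; exact lt_irrefl _ h2
  have hc : c ≠ 0 := by rintro rfl; rw [cr_zero_right] at h2; exact lt_irrefl _ h2
  have h := angle_cycle ha hb hc
  rw [← Real.Angle.coe_add, Real.Angle.angle_eq_iff_two_pi_dvd_sub] at h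
  obtain ⟨k, hk⟩ := h
  have p1 := arg_cr_pos ha h1
  have p2 := arg_cr_pos hb h2
  have p3 := Complex.arg_le_pi (c / a)
  have hpi := Real.pi_pos
  have k1 : (k : ℝ) < 1 := by nlinarith
  have k2 : (-1 : ℝ) < k := by nlinarith
  have k1' : k < 1 := by exact_mod_cast k1
  have k2' : -1 < k := by exact_mod_cast k2
  have : k = 0 := by omega
  subst this
  simp at hk
  linarith

/-- exterior angles of a tile sum to 2π -/
lemma sum_ext {P : Set ℂ} (hP : P ∈ T) : ∑ d ∈ (dtl P : Finset (D T)), (Real.pi - ang d) = 2 * Real.pi := by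
  obtain ⟨o, ho⟩ := Til.int P hP
  have hS : ∀ d ∈ (dtl P : Finset (D T)), lt d = P := fun d hd => by simpa using hd
  have hnx : ∀ d ∈ (dtl P : Finset (D T)), nx d ∈ (dtl P : Finset (D T)) :=
    fun d hd => by simpa [lt_nx] using hd
  have hne : (dtl P : Finset (D T)).Nonempty := by
    obtain ⟨y, hy, -⟩ := exists_other hP 0
    obtain ⟨d, -, hd⟩ := out_exists hP hy.1 hy.2
    exact ⟨d, by simpa using hd⟩
  have h1 := sum_fan ho hS hne hnx
  have h2 : ∀ d ∈ (dtl P : Finset (D T)), ((tgt d - o) / (src d - o)).arg +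
      ((o - src d) / (vec d)).arg + ((src d - tgt d) / (o - tgt d)).arg = Real.pi := by
    intro d hd
    exact tri_sum (fan_pos (by rw [hS d hd]; exact ho))
  have h3 : ∑ d ∈ (dtl P : Finset (D T)), ((src d - tgt d) / (o - tgt d)).arg
      = ∑ d ∈ (dtl P : Finset (D T)), ((vec (sg d)) / (o - src d)).arg := by
    refine Finset.sum_bij (fun d _ => nx d) hnx (fun a _ b _ h => nx.injective h) ?_ ?_
    · intro d hd
      exact ⟨nx⁻¹ d, by rw [mem_dtl, lt_nxi]; simpa using hd, by simp⟩
    · intro d hd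
      rw [rv_nx, src_nx, vec_rv]
      simp [vec]
  have h4 : ∀ d ∈ (dtl P : Finset (D T)), ((o - src d) / (vec d)).arg +
      ((vec (sg d)) / (o - src d)).arg = ang d := by
    intro d hd
    have ho' : o ∈ interior (lt d) := by rw [hS d hd]; exact ho
    refine arg_add_of (vec_ne d) (strict_left (vec_ne d) (spec d).left ho') ?_ (ang_pos d)
    have := strict_left (neg_ne_zero.2 (vec_ne (sg d))) (P := lt d) (x := src d) (fun z hz => by
      rw [cr_neg_left, ← cr_swap]; exact left_sg d z hz) ho'
    rw [cr_neg_left, ← cr_swap] at this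
    exact this
  rw [Finset.sum_sub_distrib, ← Finset.sum_congr rfl h2, ← Finset.sum_congr rfl h4]
  simp only [Finset.sum_add_distrib]
  rw [h3]
  linarith
end
end MC

namespace MC
section
variable {T : Set (Set ℂ)} [h : Til T]

lemma ang_ne (d : D T) : sg d ≠ d := by
  intro h0
  have := ang_pos d
  unfold ang at this
  rw [h0, div_self (vec_ne d), Complex.arg_one] at this
  exact lt_irrefl _ this

lemma exists_proper (d : D T) : ∃ e : D T, src e = src d ∧ ang e < Real.pi := by
  obtain ⟨P, hP, hx⟩ := (spec d).hx
  obtain ⟨e, he, hl⟩ := out_exists hP (spec d).hx hx.1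
  refine ⟨e, he, lt_of_le_of_ne (ang_le e) ?_⟩
  rw [Ne, ang_pi_iff_ext, hl, he]
  exact not_not.2 hx

/-- at most one flat angle at a vertex -/
lemma flat_unique {d e : D T} (hs : src d = src e) (hd : ang d = Real.pi) (he : ang e = Real.pi) :
    d = e := by
  classical
  by_contra hne
  obtain ⟨f, hf, hf'⟩ := exists_proper d
  have hs3 : ({d, e, f} : Finset (D T)) ⊆ dat (src d) := by
    intro g hg
    simp only [Finset.mem_insert, Finset.mem_singleton] at hg
    rw [mem_dat]
    rcases hg with rfl | rfl | rfl
    · rfl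
    · exact hs.symm
    · exact hf
  have h1 : d ≠ f := by rintro rfl; linarith
  have h2 : e ≠ f := by rintro rfl; linarith
  have := Finset.sum_le_sum_of_subset_of_nonneg hs3 (f := ang) (fun i _ _ => (ang_pos i).le)
  rw [sum_ang, Finset.sum_insert (by simp [hne, h1]), Finset.sum_insert (by simp [h2]),
    Finset.sum_singleton, hd, he] at this
  have := ang_pos f
  linarith

lemma tgt_ext (d : D T) : tgt d ∈ Set.extremePoints ℝ (lt d) ∨
    tgt d ∈ Set.extremePoints ℝ (lt (rv d)) := by
  by_contra hc
  push Not at hc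
  have h1 : ang (nx d) = Real.pi := by
    rw [ang_pi_iff_ext, src_nx, lt_nx]; exact hc.1
  have h2 : ang (rv d) = Real.pi := by
    rw [ang_pi_iff_ext, src_rv]; exact hc.2
  have := flat_unique (by rw [src_nx, src_rv]) h1 h2
  rw [← rv_nx] at this
  exact ang_ne _ this.symm

/-- corona maps -/
def Mp (T : Set (Set ℂ)) (a x y : ℂ) : Prop :=
  ‖a‖ = 1 ∧ (fun P => mv a x y '' P) '' Cor T x = Cor T y

lemma mv_image_inv {a : ℂ} (ha : ‖a‖ = 1) (x y : ℂ) (P : Set ℂ) :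
    mv a⁻¹ y x '' (mv a x y '' P) = P := by
  rw [Set.image_image]
  simp [mv_inv ha]

lemma Mp.symm {a x y : ℂ} (m : Mp T a x y) : Mp T a⁻¹ y x := by
  refine ⟨by rw [norm_inv, m.1, inv_one], ?_⟩
  rw [← m.2, Set.image_image]
  simp [mv_image_inv m.1]

lemma Mp.refl (x : ℂ) : Mp T 1 x x := by
  refine ⟨by simp, ?_⟩
  have : mv 1 x x = id := by ext z; simp [mv]
  rw [this]; simp

lemma Mp.trans {a b x y z : ℂ} (m : Mp T a x y) (m' : Mp T b y z) : Mp T (b * a) x z := by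
  refine ⟨by rw [norm_mul, m.1, m'.1, one_mul], ?_⟩
  rw [← m'.2, ← m.2, Set.image_image]
  congr 1
  ext1 P
  rw [Set.image_image]
  congr 1
  ext1 w
  rw [mv_comp]

lemma mono_Mp {x y : ℂ} (hx : x ∈ V T) (hy : y ∈ V T) : ∃ a, Mp T a x y := by
  obtain ⟨a, ha, e⟩ := Til.mono x hx y hy
  exact ⟨a, ha, e⟩

lemma mv_vec (a x y : ℂ) (d : D T) (hd : src d = x) : mv a x y (tgt d) = y + a * vec d := by
  subst hd; unfold mv vec; ring

lemma Mp.half {a x y : ℂ} (m : Mp T a x y) (hy : y ∈ V T) {d : D T} (hd : src d = x) :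
    ∃ d' : D T, src d' = y ∧ lt d' = mv a x y '' lt d ∧ ∃ κ : ℝ, 1 ≤ κ ∧ a * vec d = κ • vec d' := by
  have xP := (spec d).xP
  rw [hd] at xP
  obtain ⟨h1, h2⟩ := mono_mem m.2 (spec d).hP xP
  obtain ⟨d', e1, e2⟩ := out_exists h1 hy h2
  refine ⟨d', e1, e2, ?_⟩
  have a0 : a ≠ 0 := by rintro rfl; have := m.1; simp at this
  have hmem : y + a * vec d ∈ mv a x y '' lt d := by
    rw [← mv_vec a x y d hd]; exact mem_image_of_mem _ (spec d).yP
  obtain ⟨κ, k0, hk⟩ := out_dir h1 (x := y) (a := vec d') (b := a * vec d) (vec_ne d')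
    (mul_ne_zero a0 (vec_ne d)) hmem
    (by rw [← e2, ← e1, add_vec]; exact (spec d').yP)
    (by rw [← e2, ← e1]; exact (spec d').left)
    (by
      rintro _ ⟨z, hz, rfl⟩
      have e : mv a x y z - y = a * (z - src d) := by rw [hd]; unfold mv; ring
      rw [e, cr_rot m.1]
      exact (spec d).left z hz)
  refine ⟨κ, ?_, hk⟩
  by_contra hc
  push Not at hc
  refine (spec d').noV κ k0 hc ?_
  have e3 : src d' + κ • (tgt d' - src d') = mv a x y (tgt d) := by
    rw [mv_vec a x y d hd, hk, e1]; unfold vec; rw [e1]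
  rw [e3]
  have hr := (spec (rv d)).yP
  rw [tgt_rv, hd] at hr
  rcases tgt_ext d with h3 | h3
  · exact ⟨_, h1, by rw [← mv_ext m.1]; exact mem_image_of_mem _ h3⟩
  · exact ⟨_, (mono_mem m.2 (spec (rv d)).hP hr).1, by
      rw [← mv_ext m.1]; exact mem_image_of_mem _ h3⟩

lemma Mp.dart {a x y : ℂ} (m : Mp T a x y) (hy : y ∈ V T) {d : D T} (hd : src d = x) :
    ∃ d' : D T, src d' = y ∧ vec d' = a * vec d ∧ lt d' = mv a x y '' lt d := by
  obtain ⟨d', e1, e2, κ, k1, hk⟩ := m.half hy hd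
  refine ⟨d', e1, ?_, e2⟩
  obtain ⟨d'', f1, f2, κ', k1', hk'⟩ := m.symm.half (by rw [← hd]; exact (spec d).hx) e1
  have : d'' = d := dext_out (f1.trans hd.symm) (by rw [f2, e2, mv_image_inv m.1])
  subst this
  have a0 : a ≠ 0 := by rintro rfl; have := m.1; simp at this
  have h1 : vec d'' = (κ * κ') • vec d'' := by
    have : vec d'' = a⁻¹ * (a * vec d'') := by field_simp
    rw [hk] at this
    have h2 : a⁻¹ * κ • vec d' = κ • (a⁻¹ * vec d') := by simp; ring
    rw [h2, hk', smul_smul] at this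
    exact this
  have h2 : κ * κ' = 1 := by
    have : (κ * κ' - 1 : ℝ) • vec d'' = 0 := by rw [sub_smul, one_smul, ← h1, sub_self]
    rcases smul_eq_zero.1 this with h | h
    · linarith
    · exact absurd h (vec_ne _)
  have : κ = 1 := by nlinarith
  rw [hk, this, one_smul]

/-- simple consequences of a corona map matching two darts -/
lemma Mp.lt {a : ℂ} {d d' : D T} (m : Mp T a (src d) (src d')) (hv : vec d' = a * vec d) :
    lt d' = mv a (src d) (src d') '' lt d := by
  obtain ⟨e, e1, e2, e3⟩ := m.dart (spec d').hx rfl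
  have : e = d' := dext_vec e1 (e2.trans hv.symm)
  rw [← e3, this]

lemma Mp.ltr {a : ℂ} {d d' : D T} (m : Mp T a (src d) (src d')) (hv : vec d' = a * vec d) :
    MC.lt (rv d') = mv a (src d) (src d') '' MC.lt (rv d) := by
  have hr := (spec (rv d)).yP
  rw [tgt_rv] at hr
  obtain ⟨h1, h2⟩ := mono_mem m.2 (spec (rv d)).hP hr
  have hr' := (spec (rv d')).yP
  rw [tgt_rv] at hr'
  refine right_unique (spec (rv d')).hP h1 hr' h2 (s := 1) (t := 1) (by norm_num) (by norm_num)
    (v := vec d') ?_ ?_ (vec_ne d') (right_of d') ?_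
  · rw [one_smul, add_vec]; exact (spec (rv d')).xP
  · rw [one_smul, hv, ← mv_vec a (src d) (src d') d rfl]
    exact mem_image_of_mem _ (spec (rv d)).xP
  · rintro _ ⟨z, hz, rfl⟩
    have e : mv a (src d) (src d') z - src d' = a * (z - src d) := by unfold mv; ring
    rw [e, hv, cr_rot m.1]
    exact right_of d z hz

lemma Mp.sg {a : ℂ} {d d' : D T} (m : Mp T a (src d) (src d')) (hv : vec d' = a * vec d) :
    vec (MC.sg d') = a * vec (MC.sg d) := by
  obtain ⟨e, e1, e2, e3⟩ := m.dart (spec d').hx (src_sg d)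
  have m' : Mp T a (src (MC.sg d)) (src e) := by rw [src_sg, e1]; exact m
  have h1 := m'.ltr e2
  rw [lt_rv_sg, src_sg, e1, ← m.lt hv, lt_rv] at h1
  have : MC.sg⁻¹ e = d' := by
    refine dext_out ?_ h1
    rw [← src_sg]; simpa using e1
  rw [← e2, ← this]; simp

/-- equivalence of darts -/
def Eqv (d d' : D T) : Prop := ∃ a, Mp T a (src d) (src d') ∧ vec d' = a * vec d

lemma Eqv.refl (d : D T) : Eqv d d := ⟨1, Mp.refl _, by simp⟩
lemma Eqv.symm {d d' : D T} (e : Eqv d d') : Eqv d' d := by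
  obtain ⟨a, m, hv⟩ := e
  have a0 : a ≠ 0 := by rintro rfl; have := m.1; simp at this
  exact ⟨a⁻¹, m.symm, by rw [hv]; field_simp⟩
lemma Eqv.trans {d d' d'' : D T} (e : Eqv d d') (e' : Eqv d' d'') : Eqv d d'' := by
  obtain ⟨a, m, hv⟩ := e
  obtain ⟨b, m', hv'⟩ := e'
  exact ⟨b * a, m.trans m', by rw [hv', hv]; ring⟩
lemma Eqv.sg {d d' : D T} (e : Eqv d d') : Eqv (MC.sg d) (MC.sg d') := by
  obtain ⟨a, m, hv⟩ := e
  exact ⟨a, by rw [src_sg, src_sg]; exact m, m.sg hv⟩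
lemma Eqv.sgn {d d' : D T} (e : Eqv d d') (n : ℕ) : Eqv ((MC.sg ^ n) d) ((MC.sg ^ n) d') := by
  induction n with
  | zero => exact e
  | succ n ih => rw [pow_succ', Equiv.Perm.mul_apply, Equiv.Perm.mul_apply]; exact ih.sg

lemma src_sgn (d : D T) (n : ℕ) : src ((sg ^ n) d) = src d := by
  induction n with
  | zero => rfl
  | succ n ih => rw [pow_succ', Equiv.Perm.mul_apply, src_sg, ih]

lemma exists_Eqv (d : D T) {y : ℂ} (hy : y ∈ V T) : ∃ d' : D T, src d' = y ∧ Eqv d d' := by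
  obtain ⟨a, m⟩ := mono_Mp (spec d).hx hy
  obtain ⟨d', e1, e2, -⟩ := m.dart hy rfl
  exact ⟨d', e1, a, by rw [e1]; exact m, e2⟩

/-- number of darts at a vertex -/
def deg (d : D T) : ℕ := (dat (src d) : Finset (D T)).card

lemma sgn_eq_iff (d : D T) (n : ℕ) : (sg ^ n) d = d ↔ deg d ∣ n :=
  (cyc_sg (src d)).pow_apply_eq (by simp)

lemma exists_sgn {d e : D T} (hs : src d = src e) : ∃ n < deg d, (sg ^ n) d = e :=
  (cyc_sg (T := T) (src d)).exists_pow_eq (by simp) (by simp [hs])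

lemma sgn_deg (d : D T) : (sg ^ deg d) d = d := (sgn_eq_iff d _).2 dvd_rfl

/-- reconstruct a corona map from the darts -/
lemma Mp_of {a : ℂ} (ha : ‖a‖ = 1) {d d' : D T}
    (hl : ∀ n : ℕ, lt ((sg ^ n) d') = mv a (src d) (src d') '' lt ((sg ^ n) d)) :
    Mp T a (src d) (src d') := by
  refine ⟨ha, ?_⟩
  ext Q
  constructor
  · rintro ⟨P, ⟨hP, xP⟩, rfl⟩
    obtain ⟨e, e1, e2⟩ := out_exists hP (spec d).hx xP
    obtain ⟨n, -, hn⟩ := exists_sgn e1.symm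
    have := hl n
    rw [hn, e2] at this
    simp only
    rw [← this]
    refine ⟨(spec _).hP, ?_⟩
    have := (spec ((sg ^ n) d')).xP
    rwa [src_sgn] at this
  · rintro ⟨hQ, xQ⟩
    obtain ⟨e, e1, e2⟩ := out_exists hQ (spec d').hx xQ
    obtain ⟨n, -, hn⟩ := exists_sgn e1.symm
    refine ⟨lt ((sg ^ n) d), ⟨(spec _).hP, ?_⟩, ?_⟩
    · have := (spec ((sg ^ n) d)).xP
      rwa [src_sgn] at this
    · simp only
      rw [← hl n, hn, e2]

lemma Eqv.ang {d d' : D T} (e : Eqv d d') : ang d' = ang d := by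
  obtain ⟨a, m, hv⟩ := e
  have a0 : a ≠ 0 := by rintro rfl; have := m.1; simp at this
  unfold MC.ang
  rw [m.sg hv, hv, mul_div_mul_left _ _ a0]

lemma Eqv.len {d d' : D T} (e : Eqv d d') : ‖vec d'‖ = ‖vec d‖ := by
  obtain ⟨a, m, hv⟩ := e
  rw [hv, norm_mul, m.1, one_mul]

lemma Eqv.of_src {d d' e : D T} (he : Eqv d d') (hs : src e = src d) :
    ∃ e', src e' = src d' ∧ Eqv e e' := exists_Eqv e (spec d').hx

lemma Eqv.deg {d d' : D T} (e : Eqv d d') : deg d' = deg d := by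
  have key : ∀ {d d' : D T}, Eqv d d' → MC.deg d' ∣ MC.deg d := by
    intro d d' e
    obtain ⟨a, m, hv⟩ := e
    have := Eqv.sgn ⟨a, m, hv⟩ (MC.deg d)
    rw [sgn_deg] at this
    rw [← sgn_eq_iff]
    -- same map a
    have hn : ∀ n : ℕ, vec ((MC.sg ^ n) d') = a * vec ((MC.sg ^ n) d) := by
      intro n
      induction n with
      | zero => exact hv
      | succ n ih =>
        rw [pow_succ', Equiv.Perm.mul_apply, Equiv.Perm.mul_apply]
        exact Mp.sg (by rw [src_sgn, src_sgn]; exact m) ih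
    have h1 := hn (MC.deg d)
    rw [sgn_deg, ← hv] at h1
    exact dext_vec (src_sgn _ _) h1
  exact Nat.dvd_antisymm (key e) (key e.symm)

lemma deg_src {d e : D T} (hs : src d = src e) : deg d = deg e := by unfold deg; rw [hs]

lemma deg_const (d e : D T) : deg d = deg e := by
  obtain ⟨d', h1, h2⟩ := exists_Eqv d (spec e).hx
  rw [← h2.deg, deg_src h1]

lemma deg_ge (d : D T) : 3 ≤ deg d := by
  classical
  obtain ⟨e, he, hlt⟩ := exists_proper d
  have hs := sum_ang e
  by_contra hc
  rw [deg_const d e] at hc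
  have hcard : (dat (src e) : Finset (D T)).card ≤ 2 := by unfold deg at hc; omega
  have hpi := Real.pi_pos
  have h1 : ∑ f ∈ (dat (src e) : Finset (D T)), ang f < ∑ f ∈ (dat (src e) : Finset (D T)), Real.pi :=
    Finset.sum_lt_sum (fun f _ => ang_le f) ⟨e, by simp, hlt⟩
  rw [hs, Finset.sum_const, nsmul_eq_mul] at h1
  have : ((dat (src e) : Finset (D T)).card : ℝ) ≤ 2 := by exact_mod_cast hcard
  nlinarith

end
end MC

namespace MC
section
variable {T : Set (Set ℂ)} [h : Til T]

lemma meet_V {P Q : Set ℂ} (hP : P ∈ T) (hQ : Q ∈ T) {z : ℂ} (zP : z ∈ P) (zQ : z ∈ Q) :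
    ∃ v ∈ V T, v ∈ P ∧ v ∈ Q := by
  by_cases hPQ : P = Q
  · subst hPQ
    obtain ⟨y, hy, -⟩ := exists_other hP 0
    exact ⟨y, hy.1, hy.2, hy.2⟩
  have hc : IsCompact (P ∩ Q) := (Til.cpt P hP).inter (Til.cpt Q hQ)
  obtain ⟨e, he⟩ := hc.extremePoints_nonempty ⟨z, zP, zQ⟩
  rw [mem_extremePoints_iff_left] at he
  obtain ⟨⟨eP, eQ⟩, hext⟩ := he
  by_contra hcon
  push Not at hcon
  have nP : e ∉ Set.extremePoints ℝ P := fun h' => hcon e ⟨P, hP, h'⟩ eP eQ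
  have nQ : e ∉ Set.extremePoints ℝ Q := fun h' => hcon e ⟨Q, hQ, h'⟩ eP eQ
  have key : ∀ R : Set ℂ, e ∈ R → e ∉ Set.extremePoints ℝ R → ∃ p ∈ R, ∃ q ∈ R, p - e ≠ 0 ∧
      ∃ t : ℝ, 0 < t ∧ q - e = -(t • (p - e)) := by
    intro R eR hR
    rw [mem_extremePoints_iff_left] at hR
    push Not at hR
    obtain ⟨p, hp, q, hq, ⟨a, b, a0, b0, ab, hab⟩, hne⟩ := hR eR
    refine ⟨p, hp, q, hq, sub_ne_zero.2 hne, a / b, by positivity, ?_⟩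
    have : (a : ℂ) + b = 1 := by exact_mod_cast ab
    have b0' : (b : ℂ) ≠ 0 := by exact_mod_cast b0.ne'
    simp only [Complex.real_smul] at hab ⊢
    push_cast
    field_simp
    linear_combination hab - e * this
  obtain ⟨p, hp, q, hq, hn, t, t0, hq'⟩ := key P eP nP
  obtain ⟨p', hp', q', hqQ, hn', t', t0', hq''⟩ := key Q eQ nQ
  have eni : e ∉ interior P := fun h' => hPQ (eq_of_int_mem hP hQ h' eQ)
  obtain ⟨n, n0, hl⟩ := supp_line (Til.cvx P hP) (Til.int P hP) eni
  have c1 := hl p hp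
  have c2 := hl q hq
  rw [hq', cr_neg_right, cr_rsmul_right] at c2
  have c3 : cr n (p - e) = 0 := by nlinarith
  obtain ⟨s, hs⟩ := par_of_cr n0 c3
  have s0 : s ≠ 0 := by rintro rfl; exact hn (by rw [hs]; simp)
  -- Q lies on the other side
  have hQl : ∀ w ∈ Q, cr n (w - e) ≤ 0 := by
    intro w hw
    by_contra hpos
    push Not at hpos
    have hsec : ∃ δ > 0, ∀ r : ℝ, 0 < r → r < δ → e + r • (w - e) ∈ interior P := by
      rcases lt_or_gt_of_ne s0 with hs0 | hs0
      · refine sector_int hP (a := q - e) (b := p - e) eP (by simpa using hq) (by simpa using hp)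
          ?_ hn ?_ ?_ ?_ ?_
        · rw [hq']; simp [hn, t0.ne']
        · intro y hy
          rw [hq', cr_neg_left, cr_rsmul_left, hs, cr_smul_left]
          have := hl y hy
          have : 0 ≤ (-s) * t * cr n (y - e) := mul_nonneg (mul_nonneg (by linarith) t0.le) this
          linarith
        · intro y hy
          rw [hs, cr_smul_right, cr_swap]
          have := hl y hy
          nlinarith
        · rw [hq', cr_neg_left, cr_rsmul_left, hs, cr_smul_left]
          have : 0 < (-s) * t * cr n (w - e) := mul_pos (mul_pos (by linarith) t0) hpos
          linarith
        · rw [hs, cr_smul_right, cr_swap]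
          nlinarith
      · refine sector_int hP (a := p - e) (b := q - e) eP (by simpa using hp) (by simpa using hq)
          hn ?_ ?_ ?_ ?_ ?_
        · rw [hq']; simp [hn, t0.ne']
        · intro y hy
          rw [hs, cr_smul_left]
          exact mul_nonneg hs0.le (hl y hy)
        · intro y hy
          rw [hq', cr_neg_right, cr_rsmul_right, hs, cr_smul_right, cr_swap]
          have : 0 ≤ t * s * cr n (y - e) := mul_nonneg (by positivity) (hl y hy)
          linarith
        · rw [hs, cr_smul_left]; positivity
        · rw [hq', cr_neg_right, cr_rsmul_right, hs, cr_smul_right, cr_swap]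
          have : 0 < t * s * cr n (w - e) := by positivity
          linarith
    obtain ⟨δ, d0, hδ⟩ := hsec
    have hm : 0 < min (δ / 2) 1 := by positivity
    have h1 := hδ (min (δ / 2) 1) hm (lt_of_le_of_lt (min_le_left _ _) (by linarith))
    have h2 : e + (min (δ / 2) 1) • (w - e) ∈ Q :=
      (Til.cvx Q hQ).add_smul_sub_mem eQ hw ⟨hm.le, min_le_right _ _⟩
    exact hPQ (eq_of_int_mem hP hQ h1 h2)
  have c1' := hQl p' hp'
  have c2' := hQl q' hqQ
  rw [hq'', cr_neg_right, cr_rsmul_right] at c2'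
  have c3' : cr n (p' - e) = 0 := by nlinarith
  obtain ⟨s', hs'⟩ := par_of_cr n0 c3'
  have s0' : s' ≠ 0 := by rintro rfl; exact hn' (by rw [hs']; simp)
  -- P and Q contain small segments around e
  have seg : ∀ R : Set ℂ, Convex ℝ R → e ∈ R → ∀ p q : ℂ, p ∈ R → q ∈ R → ∀ s t : ℝ, s ≠ 0 → 0 < t →
      p - e = s * n → q - e = -(t • (p - e)) → ∃ δ > 0, ∀ r : ℝ, |r| < δ → e + r • n ∈ R := by
    intro R hR eR p q hp hq s t hs ht e1 e2
    refine ⟨min |s| (t * |s|), by positivity, fun r hr => ?_⟩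
    have hr1 : |r| < |s| := lt_of_lt_of_le hr (min_le_left _ _)
    have hr2 : |r| < t * |s| := lt_of_lt_of_le hr (min_le_right _ _)
    have hsC : (s : ℂ) ≠ 0 := by exact_mod_cast hs
    have htC : (t : ℂ) ≠ 0 := by exact_mod_cast ht.ne'
    by_cases hsign : 0 ≤ r / s
    · have : r / s ≤ 1 := by
        rw [← abs_of_nonneg hsign, abs_div]
        exact (div_le_one (abs_pos.2 hs)).2 hr1.le
      have := hR.add_smul_sub_mem eR hp ⟨hsign, this⟩
      convert this using 2
      rw [e1]; simp; field_simp
    · push Not at hsign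
      have h1 : 0 ≤ -(r / s) / t := div_nonneg (by linarith) ht.le
      have h2 : -(r / s) / t ≤ 1 := by
        rw [div_le_one ht, ← abs_of_neg hsign, abs_div, div_le_iff₀ (abs_pos.2 hs)]
        exact hr2.le
      have := hR.add_smul_sub_mem eR hq ⟨h1, h2⟩
      convert this using 2
      rw [e2, e1]; simp; field_simp
  obtain ⟨δ, d0, hδ⟩ := seg P (Til.cvx P hP) eP p q hp hq s t s0 t0 hs hq'
  obtain ⟨δ', d0', hδ'⟩ := seg Q (Til.cvx Q hQ) eQ p' q' hp' hqQ s' t' s0' t0' hs' hq''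
  set r := min δ δ' / 2 with hr
  have r0 : 0 < r := by positivity
  have r1 : |r| < δ := by
    rw [abs_of_pos r0]; have := min_le_left δ δ'; have : 0 < min δ δ' := by positivity
    linarith
  have r2 : |r| < δ' := by
    rw [abs_of_pos r0]; have := min_le_right δ δ'; have : 0 < min δ δ' := by positivity
    linarith
  have := hext (e + r • n) ⟨hδ r r1, hδ' r r2⟩ (e + (-r) • n)
    ⟨hδ _ (by rwa [abs_neg]), hδ' _ (by rwa [abs_neg])⟩
    ⟨1 / 2, 1 / 2, by norm_num, by norm_num, by norm_num, by simp; ring⟩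
  simp [r0.ne', n0] at this

lemma union_closed (A : Set (Set ℂ)) (hA : A ⊆ T) : IsClosed (⋃₀ A) := by
  rw [sUnion_eq_iUnion]
  refine LocallyFinite.isClosed_iUnion ?_ (fun P => closed_tile (hA P.2))
  intro z
  obtain ⟨K, -, hK⟩ := tiles_count T
  refine ⟨Metric.closedBall z 1, Metric.closedBall_mem_nhds z (by norm_num), ?_⟩
  have := (hK z 1 (by norm_num)).1
  refine Set.Finite.of_finite_image (f := fun P : A => (P : Set ℂ)) (this.subset ?_)
    Subtype.val_injective.injOn
  rintro _ ⟨P, hP, rfl⟩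
  exact ⟨hA P.2, hP⟩

/-- connectivity of the vertex graph -/
lemma conn (S : Set ℂ) (hne : ∃ x ∈ V T, x ∈ S)
    (hS : ∀ d : D T, src d ∈ S → tgt d ∈ S) : ∀ x ∈ V T, x ∈ S := by
  have tile : ∀ P ∈ T, (∃ x ∈ V T, x ∈ P ∧ x ∈ S) → ∀ y ∈ V T, y ∈ P → y ∈ S := by
    rintro P hP ⟨x, hx, xP, xS⟩ y hy yP
    obtain ⟨d, d1, d2⟩ := out_exists hP hx xP
    obtain ⟨e, e1, e2⟩ := out_exists hP hy yP
    obtain ⟨n, -, hn⟩ := (cyc_nx (T := T) P).exists_pow_eq (a := d) (b := e) (by simpa using d2)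
      (by simpa using e2)
    have : ∀ n : ℕ, src ((nx ^ n) d) ∈ S := by
      intro n
      induction n with
      | zero => simpa [d1] using xS
      | succ n ih => rw [pow_succ', Equiv.Perm.mul_apply, src_nx]; exact hS _ ih
    have := this n
    rwa [hn, e1] at this
  obtain ⟨x, hx, xS⟩ := hne
  intro y hy
  by_contra yS
  let A : Set (Set ℂ) := {P | P ∈ T ∧ ∃ x ∈ V T, x ∈ P ∧ x ∈ S}
  let B : Set (Set ℂ) := {P | P ∈ T ∧ ¬ ∃ x ∈ V T, x ∈ P ∧ x ∈ S}
  have hA := union_closed A (fun P hP => hP.1)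
  have hB := union_closed B (fun P hP => hP.1)
  have hun : (Set.univ : Set ℂ) ⊆ ⋃₀ A ∪ ⋃₀ B := by
    intro z _
    obtain ⟨P, hP, zP⟩ := Til.cov (T := T) z
    by_cases hh : ∃ x ∈ V T, x ∈ P ∧ x ∈ S
    · exact Or.inl ⟨P, ⟨hP, hh⟩, zP⟩
    · exact Or.inr ⟨P, ⟨hP, hh⟩, zP⟩
  have hxA : (Set.univ ∩ ⋃₀ A).Nonempty := by
    obtain ⟨P, hP, h2⟩ := hx
    exact ⟨x, trivial, P, ⟨hP, x, ⟨P, hP, h2⟩, h2.1, xS⟩, h2.1⟩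
  have hyB : (Set.univ ∩ ⋃₀ B).Nonempty := by
    obtain ⟨P, hP, h2⟩ := hy
    exact ⟨y, trivial, P, ⟨hP, fun hh => yS (tile P hP hh y ⟨P, hP, h2⟩ h2.1)⟩, h2.1⟩
  obtain ⟨z, -, ⟨P, hP, zP⟩, Q, hQ, zQ⟩ :=
    isPreconnected_closed_iff.1 isPreconnected_univ _ _ hA hB hun hxA hyB
  obtain ⟨v, hv, vP, vQ⟩ := meet_V hP.1 hQ.1 zP zQ
  exact hQ.2 ⟨v, hv, vQ, tile P hP.1 hP.2 v hv vP⟩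

/-- symmetries -/
def Sy (T : Set (Set ℂ)) (a b : ℂ) : Prop := ‖a‖ = 1 ∧ (fun P => (fun z => a * z + b) '' P) '' T = T

lemma Sy.comp {a b c d : ℂ} (m : Sy T a b) (m' : Sy T c d) : Sy T (c * a) (c * b + d) := by
  refine ⟨by rw [norm_mul, m.1, m'.1, one_mul], ?_⟩
  conv_rhs => rw [← m'.2, ← m.2, Set.image_image]
  congr 1
  ext1 P
  rw [Set.image_image]
  congr 1
  ext1 w
  ring

lemma Sy.inv {a b : ℂ} (m : Sy T a b) : Sy T a⁻¹ (-(a⁻¹ * b)) := by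
  have a0 : a ≠ 0 := by rintro rfl; have := m.1; simp at this
  refine ⟨by rw [norm_inv, m.1, inv_one], ?_⟩
  conv_lhs => rw [← m.2]
  rw [Set.image_image]
  have e : ∀ P : Set ℂ, (fun z => a⁻¹ * z + -(a⁻¹ * b)) '' ((fun z => a * z + b) '' P) = P := by
    intro P
    rw [Set.image_image]
    have : (fun x : ℂ => a⁻¹ * (a * x + b) + -(a⁻¹ * b)) = id := by
      ext1 w
      simp; field_simp; ring
    rw [this, Set.image_id]
  simp only [e, Set.image_id']

/-- the key property -/
def Star (T : Set (Set ℂ)) [Til T] : Prop := ∀ d d' : D T, Eqv d d' → Eqv (rv d) (rv d')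

lemma Star.sub (hs : Star T) {a x y : ℂ} (hx : x ∈ V T) (hy : y ∈ V T) (m : Mp T a x y) :
    ∀ P ∈ T, mv a x y '' P ∈ T := by
  have a0 : a ≠ 0 := by rintro rfl; have := m.1; simp at this
  have mvmv : ∀ v, mv a v (mv a x y v) = mv a x y := by
    intro v; ext z; unfold mv; ring
  have key := conn (T := T) {v | mv a x y v ∈ V T ∧ Mp T a v (mv a x y v)}
    ⟨x, hx, by simp only [mem_ofPred_eq]; rw [mv_self]; exact ⟨hy, m⟩⟩ (by
      rintro d ⟨h1, h2⟩
      obtain ⟨d', e1, e2, -⟩ := h2.dart h1 rfl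
      have hE : Eqv d d' := ⟨a, by rw [e1]; exact h2, e2⟩
      obtain ⟨b, m', hb⟩ := hs d d' hE
      have hab : b = a := by
        rw [vec_rv, vec_rv, e2] at hb
        have : (b - a) * vec d = 0 := by linear_combination hb
        rcases mul_eq_zero.1 this with h3 | h3
        · exact sub_eq_zero.1 h3
        · exact absurd h3 (vec_ne d)
      subst hab
      have ht : mv b x y (tgt d) = tgt d' := by
        rw [← add_vec d, mv_add, ← e1, ← e2, add_vec]
      simp only [mem_ofPred_eq]
      rw [ht]
      exact ⟨(spec d').hy, m'⟩)
  intro P hP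
  obtain ⟨v, ⟨hv, vP⟩, -⟩ := exists_other hP 0
  have h2 := (key v hv).2
  have := (mono_mem h2.2 hP vP).1
  rwa [mvmv] at this

lemma Star.sy (hs : Star T) {x y : ℂ} (hx : x ∈ V T) (hy : y ∈ V T) : ∃ a b, Sy T a b ∧ a * x + b = y := by
  obtain ⟨a, m⟩ := mono_Mp hx hy
  refine ⟨a, y - a * x, ⟨m.1, ?_⟩, by ring⟩
  have e : (fun z => a * z + (y - a * x)) = mv a x y := by ext z; unfold mv; ring
  rw [e]
  ext Q
  constructor
  · rintro ⟨P, hP, rfl⟩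
    exact hs.sub hx hy m P hP
  · intro hQ
    refine ⟨_, hs.sub hy hx m.symm Q hQ, ?_⟩
    simp only
    rw [Set.image_image]
    simp [mv_inv' m.1]

def Per (T : Set (Set ℂ)) : Set ℂ := {v | Sy T 1 v}

lemma span_dense {W : Set ℂ} {R : ℝ} (hW : ∀ z, ∃ w ∈ W, dist z w ≤ R) : Submodule.span ℝ W = ⊤ := by
  have R0 : 0 ≤ R := by obtain ⟨w, -, hw⟩ := hW 0; exact dist_nonneg.trans hw
  have : ∃ w₁ ∈ W, w₁ ≠ 0 := by
    obtain ⟨w, hw, hd⟩ := hW ((R + 1 : ℝ) : ℂ)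
    refine ⟨w, hw, ?_⟩
    rintro rfl
    rw [dist_zero_right, Complex.norm_real, Real.norm_eq_abs, abs_of_pos (by linarith)] at hd
    linarith
  obtain ⟨w₁, h1, n1⟩ := this
  have : ∃ w₂ ∈ W, cr w₁ w₂ ≠ 0 := by
    by_contra hc
    push Not at hc
    have hn : 0 < ‖w₁‖ := norm_pos_iff.2 n1
    obtain ⟨w, hw, hd⟩ := hW (((R + 1) / ‖w₁‖ : ℝ) * (Complex.I * w₁))
    have h0 := hc w hw
    obtain ⟨t, ht⟩ := par_of_cr n1 h0
    rw [dist_eq_norm, ht] at hd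
    have e : (((R + 1) / ‖w₁‖ : ℝ) : ℂ) * (Complex.I * w₁) - t * w₁
        = (⟨-t, (R + 1) / ‖w₁‖⟩ : ℂ) * w₁ := by
      have : (⟨-t, (R + 1) / ‖w₁‖⟩ : ℂ) = ((-t : ℝ) : ℂ) + (((R + 1) / ‖w₁‖ : ℝ) : ℂ) * Complex.I :=
        Complex.mk_eq_add_mul_I _ _
      rw [this]; push_cast; ring
    rw [e, norm_mul] at hd
    have h2 := Complex.abs_im_le_norm (⟨-t, (R + 1) / ‖w₁‖⟩ : ℂ)
    simp only at h2
    rw [abs_of_nonneg (by positivity)] at h2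
    have h3 : (R + 1) / ‖w₁‖ * ‖w₁‖ ≤ R := (mul_le_mul_of_nonneg_right h2 hn.le).trans hd
    rw [div_mul_cancel₀ _ hn.ne'] at h3
    linarith
  obtain ⟨w₂, h2, n2⟩ := this
  rw [eq_top_iff]
  intro z _
  have hd := decomp w₁ w₂ z
  have n2' : (cr w₁ w₂ : ℂ) ≠ 0 := by exact_mod_cast n2
  have : z = (cr z w₂ / cr w₁ w₂) • w₁ + (cr w₁ z / cr w₁ w₂) • w₂ := by
    simp only [Complex.real_smul]; push_cast
    field_simp
    linear_combination hd
  rw [this]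
  exact Submodule.add_mem _ (Submodule.smul_mem _ _ (Submodule.subset_span h1))
    (Submodule.smul_mem _ _ (Submodule.subset_span h2))

lemma V_dense (T : Set (Set ℂ)) [Til T] : ∃ R : ℝ, ∀ z, ∃ v ∈ V T, dist z v ≤ R := by
  obtain ⟨r, -, R, -, p, hu⟩ := uniform T
  refine ⟨R, fun z => ?_⟩
  obtain ⟨P, hP, zP⟩ := Til.cov (T := T) z
  obtain ⟨v, ⟨hv, vP⟩, -⟩ := exists_other hP 0
  exact ⟨v, hv, (hu P hP).2.1 z zP v vP⟩

theorem Star.span (hs : Star T) : Submodule.span ℝ (Per T) = ⊤ := by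
  obtain ⟨x, hx⟩ := exists_V T
  obtain ⟨R, hR⟩ := V_dense T
  by_cases hrot : ∃ a b, Sy T a b ∧ a ≠ 1
  · obtain ⟨a, b, m, ha⟩ := hrot
    have a0 : a ≠ 0 := by rintro rfl; have := m.1; simp at this
    have a1 : 1 - a ≠ 0 := sub_ne_zero.2 (Ne.symm ha)
    set c := b / (1 - a) with hc
    have hcb : b = c - a * c := by rw [hc]; field_simp
    refine span_dense (R := ‖1 - a‖ * (R + ‖x - c‖)) (fun z => ?_)
    obtain ⟨v, hv, hd⟩ := hR (z / (1 - a) + c)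
    obtain ⟨α, β, m', hα⟩ := hs.sy hx hv
    have α0 : α ≠ 0 := by rintro rfl; have := m'.1; simp at this
    refine ⟨(1 - a) * (α * c + β - c), ?_, ?_⟩
    · have := ((m.inv.comp m'.inv).comp m).comp m'
      have e1 : α * (a * (α⁻¹ * a⁻¹)) = 1 := by field_simp
      rw [e1] at this
      have e2 : α * (a * (α⁻¹ * -(a⁻¹ * b) + -(α⁻¹ * β)) + b) + β = (1 - a) * (α * c + β - c) := by
        rw [hcb]; field_simp; ring
      rw [e2] at this
      exact this
    · have e : z - (1 - a) * (α * c + β - c) =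
          (1 - a) * ((z / (1 - a) + c - v) + α * (x - c)) := by
        rw [← hα]; field_simp; ring
      rw [dist_eq_norm, e, norm_mul]
      refine mul_le_mul_of_nonneg_left ((norm_add_le _ _).trans ?_) (norm_nonneg _)
      rw [norm_mul, m'.1, one_mul]
      rw [dist_eq_norm] at hd
      linarith
  · push Not at hrot
    refine span_dense (R := R) (fun z => ?_)
    obtain ⟨v, hv, hd⟩ := hR (z + x)
    obtain ⟨α, β, m', hα⟩ := hs.sy hx hv
    have := hrot _ _ m'
    subst this
    refine ⟨β, m', ?_⟩
    rw [← hα] at hd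
    rw [dist_eq_norm] at hd ⊢
    convert hd using 2
    ring

end
end MC

namespace MC
section
variable {T : Set (Set ℂ)} [h : Til T]

lemma sum_dat (d : D T) (f : D T → ℝ) :
    ∑ e ∈ (dat (src d) : Finset (D T)), f e = ∑ i ∈ Finset.range (deg d), f ((sg ^ i) d) := by
  symm
  refine Finset.sum_bij (fun i _ => (sg ^ i) d) ?_ ?_ ?_ ?_
  · intro i _; simp [src_sgn]
  · intro i hi j hj e
    have := ((cyc_sg (T := T) (src d)).pow_apply_eq_pow_apply (a := d) (by simp)).1 e
    have h1 := Finset.mem_range.1 hi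
    have h2 := Finset.mem_range.1 hj
    exact Nat.ModEq.eq_of_lt_of_lt this h1 h2
  · intro e he
    obtain ⟨n, hn, e⟩ := exists_sgn (d := d) (e := e) (by simpa using (mem_dat.1 he).symm)
    exact ⟨n, Finset.mem_range.2 hn, e⟩
  · intros; rfl

/-- number of corners of the left tile -/
def pd (d : D T) : ℕ := (Set.extremePoints ℝ (lt d)).ncard

lemma Eqv.pd {d d' : D T} (e : Eqv d d') : pd d' = pd d := by
  obtain ⟨a, m, hv⟩ := e
  unfold MC.pd
  rw [m.lt hv, ← mv_ext m.1, Set.ncard_image_of_injective _ (mv_inj m.1 _ _)]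

open Classical in
lemma pd_eq (d : D T) : pd d = ((dtl (lt d) : Finset (D T)).filter (fun e => ang e ≠ Real.pi)).card := by
  unfold pd
  rw [← Finset.card_image_of_injOn (f := src), ← Set.ncard_coe_finset]
  · congr 1
    ext x
    simp only [Finset.coe_image, mem_image, Finset.mem_coe, Finset.mem_filter, mem_dtl]
    constructor
    · intro hx
      obtain ⟨e, e1, e2⟩ := out_exists (spec d).hP ⟨_, (spec d).hP, hx⟩ hx.1
      refine ⟨e, ⟨e2, ?_⟩, e1⟩
      rw [Ne, ang_pi_iff_ext, e1, e2]
      exact not_not.2 hx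
    · rintro ⟨e, ⟨e1, e2⟩, rfl⟩
      rw [Ne, ang_pi_iff_ext, not_not, e1] at e2
      exact e2
  · intro a ha b hb hab
    simp only [Finset.coe_filter, mem_dtl, mem_ofPred_eq] at ha hb
    exact dext_out hab (ha.1.trans hb.1.symm)

lemma pd_ge (d : D T) : 3 ≤ pd d := by
  classical
  have hs := sum_ext (spec d).hP
  rw [← Finset.sum_filter_add_sum_filter_not (s := (dtl (lt d) : Finset (D T)))
    (p := fun e => ang e ≠ Real.pi)] at hs
  have h0 : ∑ e ∈ (dtl (lt d) : Finset (D T)).filter (fun e => ¬ ang e ≠ Real.pi), (Real.pi - ang e) = 0 := by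
    refine Finset.sum_eq_zero ?_
    intro e he
    have := (Finset.mem_filter.1 he).2
    rw [not_not] at this
    rw [this, sub_self]
  rw [h0, add_zero] at hs
  have hpi := Real.pi_pos
  have hne : ((dtl (lt d) : Finset (D T)).filter (fun e => ang e ≠ Real.pi)).Nonempty := by
    by_contra hc
    rw [Finset.not_nonempty_iff_eq_empty] at hc
    rw [hc] at hs
    simp at hs
  have h1 : ∑ e ∈ (dtl (lt d) : Finset (D T)).filter (fun e => ang e ≠ Real.pi), (Real.pi - ang e)
    < ∑ e ∈ (dtl (lt d) : Finset (D T)).filter (fun e => ang e ≠ Real.pi), Real.pi :=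
    Finset.sum_lt_sum_of_nonempty hne (fun e _ => by have := ang_pos e; linarith)
  rw [hs, Finset.sum_const, nsmul_eq_mul, ← pd_eq] at h1
  by_contra hc
  have : (pd d : ℝ) ≤ 2 := by exact_mod_cast (by omega)
  nlinarith

open Classical in
/-- curvature-type function -/
def F (d : D T) : ℝ := if ang d = Real.pi then 0 else Real.pi - ang d - 2 * Real.pi / pd d

lemma pd_lt {d e : D T} (hl : lt d = lt e) : pd d = pd e := by unfold pd; rw [hl]

lemma F_tile (d : D T) : ∑ e ∈ (dtl (lt d) : Finset (D T)), F e = 0 := by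
  classical
  have hs := sum_ext (spec d).hP
  have e1 : ∀ e ∈ (dtl (lt d) : Finset (D T)), F e = (Real.pi - ang e) -
      (if ang e ≠ Real.pi then 2 * Real.pi / pd d else 0) := by
    intro e he
    rw [mem_dtl] at he
    unfold F
    rw [pd_lt he]
    by_cases h1 : ang e = Real.pi
    · simp [h1]
    · simp [h1]
  rw [Finset.sum_congr rfl e1, Finset.sum_sub_distrib, hs, ← Finset.sum_filter, Finset.sum_const,
    nsmul_eq_mul, ← pd_eq]
  have : (pd d : ℝ) ≠ 0 := by have := pd_ge d; positivity
  field_simp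
  ring

lemma Eqv.F {d d' : D T} (e : Eqv d d') : F d' = F d := by
  unfold MC.F; rw [e.ang, e.pd]

lemma F_const (d e : D T) : ∑ f ∈ (dat (src d) : Finset (D T)), F f
    = ∑ f ∈ (dat (src e) : Finset (D T)), F f := by
  obtain ⟨d', h1, h2⟩ := exists_Eqv d (spec e).hx
  rw [← h1, sum_dat, sum_dat, h2.deg]
  exact Finset.sum_congr rfl (fun i _ => (h2.sgn i).F.symm)

lemma F_bd (d : D T) : |F d| ≤ 3 * Real.pi := by
  have h1 := ang_pos d
  have h2 := ang_le d
  have hpi := Real.pi_pos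
  have h3 : (3 : ℝ) ≤ pd d := by exact_mod_cast pd_ge d
  have h4 : 2 * Real.pi / pd d ≤ Real.pi := by
    rw [div_le_iff₀ (by linarith)]; nlinarith
  have h5 : 0 ≤ 2 * Real.pi / pd d := by positivity
  unfold F
  split_ifs
  · simp; positivity
  · rw [abs_le]; constructor <;> linarith

lemma no_exp {n : ℕ → ℝ} {K C c : ℝ} (h0 : 1 ≤ n 0) (hK : ∀ j, n j ≤ K * ((j : ℝ) + 1) ^ 2)
    (hmono : ∀ j, n j ≤ n (j + 1)) (hc : ∀ j, |c| * n (j + 1) ≤ C * (n (j + 1) - n j)) : c = 0 := by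
  by_contra hne
  have c0 : 0 < |c| := abs_pos.2 hne
  have hn1 : ∀ j, 1 ≤ n j := by
    intro j; induction j with
    | zero => exact h0
    | succ j ih => exact ih.trans (hmono j)
  have C0 : 0 < C := by
    by_contra hC
    have := hc 0
    have h1 := hmono 0
    have h2 := hn1 1
    have : 0 < |c| * n (0 + 1) := by have := hn1 (0 + 1); positivity
    nlinarith
  set r := 1 - |c| / C with hr
  have r1 : r < 1 := by have : 0 < |c| / C := by positivity
                        linarith
  have hstep : ∀ j, n j ≤ r * n (j + 1) := by
    intro j
    have := hc j
    have e : r * n (j + 1) = n (j + 1) - (|c| * n (j + 1)) / C := by rw [hr]; ring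
    rw [e]
    have : (|c| * n (j + 1)) / C ≤ n (j + 1) - n j := by
      rw [div_le_iff₀ C0]; linarith
    linarith
  have r0 : 0 ≤ r := by
    by_contra hneg
    push Not at hneg
    have h1 := hstep 0
    have h2 := hn1 0
    have h3 := hn1 (0 + 1)
    nlinarith
  have hpow : ∀ j, 1 ≤ r ^ j * n j := by
    intro j; induction j with
    | zero => simpa using h0
    | succ j ih =>
      have := mul_le_mul_of_nonneg_left (hstep j) (pow_nonneg r0 j)
      rw [pow_succ]; linarith
  have hr0 : 0 < r := by
    rcases r0.lt_or_eq with h1 | h1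
    · exact h1
    · have := hpow 1; rw [← h1] at this; norm_num at this
  have ht := tendsto_pow_const_mul_const_pow_of_abs_lt_one 2 (r := r) (by rw [abs_of_nonneg r0]; exact r1)
  have ht' := ((Filter.tendsto_add_atTop_iff_nat 1).2 ht).const_mul K
  rw [mul_zero] at ht'
  have : ∀ j : ℕ, r ≤ K * (((j + 1 : ℕ) : ℝ) ^ 2 * r ^ (j + 1)) := by
    intro j
    have h1 := hpow j
    have h2 := mul_le_mul_of_nonneg_left (hK j) (pow_nonneg r0 j)
    have h3 : 1 ≤ r ^ j * (K * ((j : ℝ) + 1) ^ 2) := h1.trans h2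
    have h4 := mul_le_mul_of_nonneg_right h3 r0
    push_cast
    have e : K * (((j : ℝ) + 1) ^ 2 * r ^ (j + 1)) = r ^ j * (K * ((j : ℝ) + 1) ^ 2) * r := by ring
    rw [e]
    linarith
  have := ge_of_tendsto' ht' this
  linarith

theorem F_zero (d : D T) : ∑ f ∈ (dat (src d) : Finset (D T)), F f = 0 := by
  classical
  set c := ∑ f ∈ (dat (src d) : Finset (D T)), F f with hc
  set x0 := src d
  obtain ⟨r, -, R, R0, p, hu⟩ := uniform T
  obtain ⟨K, K0, hK⟩ := V_count T
  have hRj : ∀ j : ℕ, 0 ≤ (j : ℝ) * R := fun j => by positivity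
  let B : ℕ → Finset ℂ := fun j => (hK x0 (j * R) (hRj j)).1.toFinset
  have memB : ∀ j v, v ∈ B j ↔ v ∈ V T ∧ dist v x0 ≤ j * R := by
    intro j v; simp [B]
  have hBsub : ∀ j, B j ⊆ B (j + 1) := by
    intro j v hv
    rw [memB] at hv ⊢
    refine ⟨hv.1, hv.2.trans ?_⟩
    push_cast; linarith
  refine no_exp (n := fun j => ((B j).card : ℝ)) (K := K * (R + 1) ^ 2)
    (C := 3 * Real.pi * deg d) ?_ ?_ ?_ ?_
  · have : x0 ∈ B 0 := by rw [memB]; exact ⟨(spec d).hx, by simp⟩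
    exact_mod_cast Finset.card_pos.2 ⟨x0, this⟩
  · intro j
    have h1 := (hK x0 (j * R) (hRj j)).2
    rw [Set.ncard_eq_toFinset_card _ (hK x0 (j * R) (hRj j)).1] at h1
    refine h1.trans ?_
    rw [mul_assoc, ← mul_pow]
    refine mul_le_mul_of_nonneg_left ?_ K0
    refine pow_le_pow_left₀ (by positivity) ?_ 2
    have : (0 : ℝ) ≤ j := by positivity
    nlinarith
  · intro j
    exact_mod_cast Finset.card_le_card (hBsub j)
  · intro j
    -- darts in the large ball
    let A : Finset (D T) := (B (j + 1)).biUnion dat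
    have memA : ∀ e, e ∈ A ↔ src e ∈ B (j + 1) := by intro e; simp [A]
    have hsum : ∑ e ∈ A, F e = c * (B (j + 1)).card := by
      rw [← Finset.sum_fiberwise_of_maps_to (t := B (j + 1)) (g := src) (fun e he => (memA e).1 he)]
      rw [mul_comm, ← nsmul_eq_mul, ← Finset.sum_const]
      refine Finset.sum_congr rfl ?_
      intro v hv
      have hvV := ((memB _ _).1 hv).1
      obtain ⟨e, he, -⟩ := exists_Eqv d hvV
      have e1 : A.filter (fun i => src i = v) = dat v := by
        ext e; simp only [Finset.mem_filter, memA, mem_dat]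
        constructor
        · exact fun h => h.2
        · rintro rfl; exact ⟨hv, rfl⟩
      rw [e1, hc, ← he]
      exact F_const _ _
    -- good darts
    let good : D T → Prop := fun e => ∀ f ∈ (dtl (lt e) : Finset (D T)), src f ∈ B (j + 1)
    have hgood : ∑ e ∈ A.filter good, F e = 0 := by
      rw [← Finset.sum_fiberwise_of_maps_to (t := (A.filter good).image lt) (g := lt)
        (fun e he => Finset.mem_image_of_mem _ he)]
      refine Finset.sum_eq_zero ?_
      intro P hP
      obtain ⟨e, he, rfl⟩ := Finset.mem_image.1 hP
      have e1 : (A.filter good).filter (fun i => lt i = lt e) = dtl (lt e) := by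
        ext f
        simp only [Finset.mem_filter, mem_dtl]
        constructor
        · exact fun h => h.2
        · intro hf
          have hg := (Finset.mem_filter.1 he).2
          refine ⟨⟨(memA f).2 (hg f (by simpa using hf)), ?_⟩, hf⟩
          intro g hg'
          rw [hf] at hg'
          exact hg g hg'
      rw [e1]
      exact F_tile e
    have hbad : ∀ e ∈ A.filter (fun e => ¬ good e), e ∈ (B (j + 1) \ B j).biUnion dat := by
      intro e he
      obtain ⟨h1, h2⟩ := Finset.mem_filter.1 he
      simp only [good] at h2
      push Not at h2
      obtain ⟨f, hf, hf'⟩ := h2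
      simp only [Finset.mem_biUnion, mem_dat, Finset.mem_sdiff]
      refine ⟨src e, ⟨(memA e).1 h1, ?_⟩, rfl⟩
      intro hB
      apply hf'
      rw [memB] at hB ⊢
      refine ⟨(spec f).hx, ?_⟩
      have hd := (hu _ (spec e).hP).2.1 (src f) (by
        rw [← mem_dtl.1 hf]; exact (spec f).xP) (src e) (spec e).xP
      have := dist_triangle (src f) (src e) x0
      push_cast
      linarith [hB.2]
    have hcount : (((B (j + 1) \ B j).biUnion (dat : ℂ → Finset (D T))).card : ℝ) ≤
        deg d * (((B (j + 1)).card : ℝ) - (B j).card) := by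
      have h1 : ((B (j + 1) \ B j).biUnion (dat : ℂ → Finset (D T))).card ≤
          (B (j + 1) \ B j).card * deg d := by
        refine Finset.card_biUnion_le_card_mul _ _ _ ?_
        intro v hv
        have hvV := ((memB _ _).1 (Finset.mem_sdiff.1 hv).1).1
        obtain ⟨e, he, -⟩ := exists_Eqv d hvV
        rw [← he, deg_const d e]
        exact le_rfl
      have h2 : ((B (j + 1) \ B j).card : ℝ) = (B (j + 1)).card - (B j).card := by
        rw [Finset.card_sdiff_of_subset (hBsub j), Nat.cast_sub (Finset.card_le_card (hBsub j))]
      rw [← h2, mul_comm]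
      exact_mod_cast h1
    have hpi := Real.pi_pos
    calc |c| * (B (j + 1)).card = |∑ e ∈ A, F e| := by
          rw [hsum, abs_mul, abs_of_nonneg (by positivity : (0 : ℝ) ≤ ((B (j + 1)).card : ℝ))]
      _ = |∑ e ∈ A.filter (fun e => ¬ good e), F e| := by
          rw [← Finset.sum_filter_add_sum_filter_not A good, hgood, zero_add]
      _ ≤ ∑ e ∈ A.filter (fun e => ¬ good e), |F e| := Finset.abs_sum_le_sum_abs _ _
      _ ≤ ∑ e ∈ A.filter (fun e => ¬ good e), 3 * Real.pi := Finset.sum_le_sum (fun e _ => F_bd e)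
      _ = (A.filter (fun e => ¬ good e)).card * (3 * Real.pi) := by
          rw [Finset.sum_const, nsmul_eq_mul]
      _ ≤ (deg d * (((B (j + 1)).card : ℝ) - (B j).card)) * (3 * Real.pi) := by
          refine mul_le_mul_of_nonneg_right (le_trans ?_ hcount) (by positivity)
          exact_mod_cast Finset.card_le_card hbad
      _ = 3 * Real.pi * deg d * (((B (j + 1)).card : ℝ) - (B j).card) := by ring

open Classical in
theorem euler (d : D T) : ∑ i ∈ Finset.range (deg d),
    (if ang ((sg ^ i) d) = Real.pi then (0 : ℝ) else 1 / pd ((sg ^ i) d)) = ((deg d : ℝ) - 2) / 2 := by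
  have h1 := F_zero d
  have h2 := sum_ang d
  rw [sum_dat] at h1 h2
  have hpi := Real.pi_pos
  have e : ∀ i ∈ Finset.range (deg d), F ((sg ^ i) d) = (Real.pi - ang ((sg ^ i) d)) -
      2 * Real.pi * (if ang ((sg ^ i) d) = Real.pi then (0 : ℝ) else 1 / pd ((sg ^ i) d)) := by
    intro i _
    unfold F
    split_ifs with h3
    · rw [h3]; ring
    · ring
  rw [Finset.sum_congr rfl e, Finset.sum_sub_distrib, Finset.sum_sub_distrib, h2, ← Finset.mul_sum,
    Finset.sum_const, Finset.card_range, nsmul_eq_mul] at h1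
  have : Real.pi * (∑ i ∈ Finset.range (deg d),
    (if ang ((sg ^ i) d) = Real.pi then (0 : ℝ) else 1 / pd ((sg ^ i) d)) - ((deg d : ℝ) - 2) / 2) = 0 := by
    linear_combination (-1/2) * h1
  rcases mul_eq_zero.1 this with h3 | h3
  · exact absurd h3 hpi.ne'
  · linarith

end
end MC

namespace MC
section
variable {T : Set (Set ℂ)} [h : Til T]

lemma unit_ne {a : ℂ} (ha : ‖a‖ = 1) : a ≠ 0 := by rintro rfl; simp at ha

lemma Eqv.sgi {d d' : D T} (e : Eqv d d') : Eqv (MC.sg⁻¹ d) (MC.sg⁻¹ d') := by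
  have key : ∀ d : D T, MC.sg⁻¹ d = (MC.sg ^ (MC.deg d - 1)) d := by
    intro d
    rw [Equiv.Perm.inv_eq_iff_eq, ← Equiv.Perm.mul_apply, ← pow_succ',
      Nat.sub_add_cancel (by have := deg_ge d; omega), sgn_deg]
  rw [key d, key d', e.deg]
  exact e.sgn _

/-- the left tiles of two darts are congruent, matching sources -/
def Tc (a : ℂ) (d d' : D T) : Prop := ‖a‖ = 1 ∧ lt d' = mv a (src d) (src d') '' lt d

lemma Tc.out {a : ℂ} {d d' : D T} (e : Tc a d d') : ∃ κ : ℝ, 0 < κ ∧ vec d' = κ • (a * vec d) := by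
  obtain ⟨ha, hl⟩ := e
  refine out_dir (spec d').hP (x := src d') (mul_ne_zero (unit_ne ha) (vec_ne d)) (vec_ne d') ?_ ?_ ?_ ?_
  · rw [add_vec]; exact (spec d').yP
  · rw [hl, ← mv_vec a (src d) (src d') d rfl]; exact mem_image_of_mem _ (spec d).yP
  · rw [hl]; rintro _ ⟨z, hz, rfl⟩
    have e : mv a (src d) (src d') z - src d' = a * (z - src d) := by unfold mv; ring
    rw [e, cr_rot ha]
    exact (spec d).left z hz
  · exact (spec d').left

lemma in_dir {P : Set ℂ} (hP : P ∈ T) {x a b : ℂ} (ha : a ≠ 0) (hb : b ≠ 0) (mb : x + b ∈ P)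
    (ma : x + a ∈ P)
    (la : ∀ z ∈ P, 0 ≤ cr (z - x) a) (lb : ∀ z ∈ P, 0 ≤ cr (z - x) b) :
    ∃ κ : ℝ, 0 < κ ∧ b = κ • a := by
  have h1 := la _ mb
  have h2 := lb _ ma
  rw [add_sub_cancel_left] at h1 h2
  rw [cr_swap] at h1
  obtain ⟨t, ht⟩ := par_of_cr ha (by linarith)
  obtain ⟨o, ho⟩ := Til.int P hP
  have g1 := strict_left (neg_ne_zero.2 ha) (x := x) (fun z hz => by
    rw [cr_neg_left, ← cr_swap]; exact la z hz) ho
  have g2 := strict_left (neg_ne_zero.2 hb) (x := x) (fun z hz => by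
    rw [cr_neg_left, ← cr_swap]; exact lb z hz) ho
  refine ⟨t, ?_, by rw [ht]; simp⟩
  rw [cr_neg_left] at g1 g2
  rw [ht, cr_smul_left] at g2
  by_contra hc
  push Not at hc
  nlinarith

lemma Tc.inn {a : ℂ} {d d' : D T} (e : Tc a d d') :
    ∃ κ : ℝ, 0 < κ ∧ vec (sg d') = κ • (a * vec (sg d)) := by
  obtain ⟨ha, hl⟩ := e
  refine in_dir (spec d').hP (x := src d') (mul_ne_zero (unit_ne ha) (vec_ne _)) (vec_ne _) ?_ ?_ ?_ ?_
  · rw [← src_sg, add_vec]; exact tgt_sg_mem d'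
  · rw [hl, ← mv_vec a (src d) (src d') (sg d) (src_sg d)]; exact mem_image_of_mem _ (tgt_sg_mem d)
  · rw [hl]; rintro _ ⟨z, hz, rfl⟩
    have e : mv a (src d) (src d') z - src d' = a * (z - src d) := by unfold mv; ring
    rw [e, cr_rot ha]
    exact left_sg d z hz
  · exact left_sg d'

lemma Tc.ang {a : ℂ} {d d' : D T} (e : Tc a d d') : ang d' = ang d := by
  obtain ⟨κ, k0, h1⟩ := e.out
  obtain ⟨μ, m0, h2⟩ := e.inn
  have a0 := unit_ne e.1
  unfold MC.ang
  rw [h1, h2]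
  have : (μ • (a * vec (MC.sg d))) / (κ • (a * vec d)) = ((μ / κ : ℝ) : ℂ) * (vec (MC.sg d) / vec d) := by
    have := vec_ne d
    have : (κ : ℂ) ≠ 0 := by exact_mod_cast k0.ne'
    simp only [Complex.real_smul]; push_cast
    field_simp
  rw [this, Complex.arg_real_mul _ (by positivity)]

lemma Tc.pd {a : ℂ} {d d' : D T} (e : Tc a d d') : pd d' = pd d := by
  unfold MC.pd
  rw [e.2, ← mv_ext e.1, Set.ncard_image_of_injective _ (mv_inj e.1 _ _)]

lemma Tc.symm {a : ℂ} {d d' : D T} (e : Tc a d d') : Tc a⁻¹ d' d :=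
  ⟨by rw [norm_inv, e.1, inv_one], by rw [e.2, mv_image_inv e.1]⟩

lemma Tc.trans {a b : ℂ} {d d' d'' : D T} (e : Tc a d d') (f : Tc b d' d'') : Tc (b * a) d d'' :=
  ⟨by rw [norm_mul, e.1, f.1, one_mul], by
    rw [f.2, e.2, Set.image_image]; simp only [mv_comp]⟩

/-- half congruence: both tiles adjacent to the edge match -/
def Hc (a : ℂ) (d d' : D T) : Prop :=
  vec d' = a * vec d ∧ Tc a d d' ∧ Tc a (sg⁻¹ d) (sg⁻¹ d')

lemma src_sgi (d : D T) : src (sg⁻¹ d) = src d := by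
  have := src_sg (sg⁻¹ d); simpa using this.symm

lemma Eqv.hc {d d' : D T} (e : Eqv d d') : ∃ a, Hc a d d' := by
  obtain ⟨a, m, hv⟩ := e
  refine ⟨a, hv, ⟨m.1, m.lt hv⟩, m.1, ?_⟩
  rw [src_sgi, src_sgi, ← lt_rv, ← lt_rv]
  exact m.ltr hv

lemma mv_tgt {a : ℂ} {d d' : D T} (hv : vec d' = a * vec d) :
    mv a (tgt d) (tgt d') = mv a (src d) (src d') := by
  ext z
  rw [← add_vec d, ← add_vec d', hv]; unfold mv; ring

lemma Hc.rv {a : ℂ} {d d' : D T} (e : Hc a d d') : Hc a (rv d) (rv d') := by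
  obtain ⟨hv, ⟨ha, h1⟩, -, h2⟩ := e
  rw [src_sgi, src_sgi, ← lt_rv, ← lt_rv] at h2
  refine ⟨by rw [vec_rv, vec_rv, hv]; ring, ⟨ha, ?_⟩, ha, ?_⟩
  · rw [src_rv, src_rv, mv_tgt hv, h2]
  · rw [src_sgi, src_sgi, ← lt_rv, ← lt_rv, rv_rv, rv_rv, src_rv, src_rv, mv_tgt hv, h1]

lemma Hc.symm {a : ℂ} {d d' : D T} (e : Hc a d d') : Hc a⁻¹ d' d := by
  have a0 := unit_ne e.2.1.1
  exact ⟨by rw [e.1]; field_simp, e.2.1.symm, e.2.2.symm⟩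

lemma Hc.trans {a b : ℂ} {d d' d'' : D T} (e : Hc a d d') (f : Hc b d' d'') : Hc (b * a) d d'' :=
  ⟨by rw [f.1, e.1]; ring, e.2.1.trans f.2.1, e.2.2.trans f.2.2⟩

/-- it suffices to rule out nontrivial half congruences at a vertex -/
lemma not_star (hs : ¬ Star T) : ∃ (d d' r s : D T) (c : ℂ), Eqv d d' ∧ rv d = r ∧ Eqv (rv d') s ∧
    src r = src s ∧ Hc c r s ∧ ¬ Eqv r s := by
  unfold Star at hs
  push Not at hs
  obtain ⟨d, d', e, hn⟩ := hs
  obtain ⟨s, h1, h2⟩ := exists_Eqv (rv d') (spec (rv d)).hx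
  obtain ⟨a, ha⟩ := e.hc
  obtain ⟨b, hb⟩ := h2.hc
  refine ⟨d, d', rv d, s, _, e, rfl, h2, h1.symm, ha.rv.trans hb, ?_⟩
  intro h3
  exact hn (h3.trans h2.symm)

/-- no flat corners -/
def NF (T : Set (Set ℂ)) [Til T] : Prop := ∀ d : D T, ang d ≠ Real.pi

lemma NF.ext (nf : NF T) {P : Set ℂ} (hP : P ∈ T) {x : ℂ} (hx : x ∈ V T) (xP : x ∈ P) :
    x ∈ Set.extremePoints ℝ P := by
  obtain ⟨d, h1, h2⟩ := out_exists hP hx xP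
  have := nf d
  rw [Ne, ang_pi_iff_ext, not_not, h1, h2] at this
  exact this

lemma NF.V (nf : NF T) {a x y : ℂ} (ha : ‖a‖ = 1) {P : Set ℂ} (hP : P ∈ T)
    (hP' : mv a x y '' P ∈ T) {z : ℂ} (hz : z ∈ P) : mv a x y z ∈ V T ↔ z ∈ V T := by
  constructor
  · intro h1
    have := nf.ext hP' h1 (mem_image_of_mem _ hz)
    rw [← mv_ext ha] at this
    obtain ⟨w, hw, e⟩ := this
    rw [← mv_inj ha _ _ e]
    exact ⟨P, hP, hw⟩
  · intro h1
    have := nf.ext hP h1 hz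
    exact ⟨_, hP', by rw [← mv_ext ha]; exact mem_image_of_mem _ this⟩

lemma NF.dart (nf : NF T) {a x y : ℂ} (ha : ‖a‖ = 1) {P : Set ℂ}
    (hP' : mv a x y '' P ∈ T) {p q : ℂ} (hd : IsDart T P p q) :
    IsDart T (mv a x y '' P) (mv a x y p) (mv a x y q) where
  hP := hP'
  hx := (nf.V ha hd.hP hP' hd.xP).2 hd.hx
  hy := (nf.V ha hd.hP hP' hd.yP).2 hd.hy
  xP := mem_image_of_mem _ hd.xP
  yP := mem_image_of_mem _ hd.yP
  ne := by rw [mv_sub]; exact mul_ne_zero (unit_ne ha) hd.ne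
  left := by
    rintro _ ⟨z, hz, rfl⟩
    rw [mv_sub, mv_sub, cr_rot ha]
    exact hd.left z hz
  noV := by
    intro t t0 t1 hV
    have e : mv a x y p + t • (mv a x y q - mv a x y p) = mv a x y (p + t • (q - p)) := by
      rw [mv_add, mv_sub]; simp; ring
    rw [e] at hV
    have hm : p + t • (q - p) ∈ P :=
      (Til.cvx P hd.hP).add_smul_sub_mem hd.xP hd.yP ⟨t0.le, t1.le⟩
    exact hd.noV t t0 t1 ((nf.V ha hd.hP hP' hm).1 hV)

lemma Tc.vec (nf : NF T) {a : ℂ} {d d' : D T} (e : Tc a d d') : vec d' = a * vec d := by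
  have h1 := nf.dart e.1 (by rw [← e.2]; exact (spec d').hP) (spec d)
  rw [← e.2, mv_self] at h1
  have := h1.out_unique (spec d')
  rw [mv_vec _ _ _ _ rfl, ← add_vec d'] at this
  exact (add_left_cancel this).symm

lemma Tc.nx (nf : NF T) {a : ℂ} {d d' : D T} (e : Tc a d d') : Tc a (nx d) (nx d') := by
  refine ⟨e.1, ?_⟩
  rw [src_nx, src_nx, lt_nx, lt_nx, mv_tgt (e.vec nf), e.2]

lemma Tc.nxn (nf : NF T) {a : ℂ} {d d' : D T} (e : Tc a d d') (n : ℕ) :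
    Tc a ((MC.nx ^ n) d) ((MC.nx ^ n) d') := by
  induction n with
  | zero => simpa using e
  | succ n ih => rw [pow_succ', Equiv.Perm.mul_apply, Equiv.Perm.mul_apply]; exact ih.nx nf

lemma Tc.sg (nf : NF T) {a : ℂ} {d d' : D T} (e : Tc a d d') : MC.vec (sg d') = a * MC.vec (sg d) := by
  have hd := spec (MC.nx⁻¹ d)
  rw [tgt_nxi, lt_nxi] at hd
  have h1 := nf.dart e.1 (by rw [← e.2]; exact (spec d').hP) hd
  rw [← e.2, mv_self] at h1
  have h2 := spec (MC.nx⁻¹ d')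
  rw [tgt_nxi, lt_nxi] at h2
  have := h1.in_unique h2
  rw [sg_apply, sg_apply, vec_rv, vec_rv]
  unfold MC.vec
  rw [tgt_nxi, tgt_nxi, ← this]; unfold mv; ring

lemma card_dtl (nf : NF T) (d : D T) : (dtl (lt d) : Finset (D T)).card = pd d := by
  classical
  rw [pd_eq, Finset.filter_true_of_mem (fun e _ => nf e)]

lemma nx_pd (nf : NF T) (d : D T) : (nx ^ pd d) d = d := by
  rw [← card_dtl nf]
  exact ((cyc_nx (T := T) (lt d)).pow_apply_eq (by simp)).2 dvd_rfl

lemma lt_nxn (d : D T) (n : ℕ) : lt ((nx ^ n) d) = lt d := by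
  induction n with
  | zero => rfl
  | succ n ih => rw [pow_succ', Equiv.Perm.mul_apply, lt_nx, ih]

lemma exists_nxn {d e : D T} (hl : lt e = lt d) : ∃ n : ℕ, (nx ^ n) d = e := by
  obtain ⟨n, -, hn⟩ := (cyc_nx (T := T) (lt d)).exists_pow_eq (a := d) (b := e) (by simp) (by simpa using hl)
  exact ⟨n, hn⟩

lemma hull_nx (d : D T) : lt d = convexHull ℝ (range fun n : ℕ => src ((nx ^ n) d)) := by
  apply Subset.antisymm
  · have h1 := ext_hull (T := T) (spec d).hP
    conv_lhs => rw [← h1]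
    apply convexHull_mono
    intro x hx
    obtain ⟨e, e1, e2⟩ := out_exists (spec d).hP ⟨_, (spec d).hP, hx⟩ hx.1
    obtain ⟨n, hn⟩ := exists_nxn e2
    exact ⟨n, by simp only [hn, e1]⟩
  · apply convexHull_min _ (Til.cvx _ (spec d).hP)
    rintro _ ⟨n, rfl⟩
    have := (spec ((nx ^ n) d)).xP
    rwa [lt_nxn] at this

lemma mv_hull (a x y : ℂ) (S : Set ℂ) : mv a x y '' convexHull ℝ S = convexHull ℝ (mv a x y '' S) := by
  let f : ℂ →ᵃ[ℝ] ℂ :=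
    { toFun := mv a x y
      linear := (LinearMap.mulLeft ℝ a)
      map_vadd' := by intro p v; simp [mv]; ring }
  exact f.image_convexHull S

lemma tile_of_vecs {a : ℂ} (ha : ‖a‖ = 1) {d d' : D T}
    (hv : ∀ n : ℕ, vec ((nx ^ n) d') = a * vec ((nx ^ n) d)) : Tc a d d' := by
  refine ⟨ha, ?_⟩
  have hs : ∀ n : ℕ, src ((nx ^ n) d') = mv a (src d) (src d') (src ((nx ^ n) d)) := by
    intro n
    induction n with
    | zero => simp [mv_self]
    | succ n ih =>
      rw [pow_succ', Equiv.Perm.mul_apply, Equiv.Perm.mul_apply, src_nx, src_nx, ← add_vec, ← add_vec,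
        ih, hv n, mv_add]
  rw [hull_nx d', hull_nx d, mv_hull, ← range_comp]
  congr 1
  ext z
  simp only [mem_range, hs, Function.comp]

lemma vec_sg (d : D T) : vec (sg d) =
    ((‖vec (sg d)‖ / ‖vec d‖ : ℝ) : ℂ) * Complex.exp (ang d * Complex.I) * vec d := by
  have h1 := Complex.norm_mul_exp_arg_mul_I (vec (sg d) / vec d)
  rw [norm_div] at h1
  unfold ang
  rw [h1]
  have := vec_ne d
  field_simp

lemma Eqv_of {c : ℂ} {r s : D T} (h0 : vec s = c * vec r)
    (hl : ∀ n < deg r, Tc c ((sg ^ n) r) ((sg ^ n) s)) : Eqv r s := by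
  have hn : ∀ n, Tc c ((sg ^ n) r) ((sg ^ n) s) := by
    intro n
    have e : ∀ d : D T, (sg ^ n) d = (sg ^ (n % deg d)) d := by
      intro d
      conv_lhs => rw [← Nat.mod_add_div n (deg d)]
      rw [pow_add, Equiv.Perm.mul_apply, (sgn_eq_iff d _).2 (dvd_mul_right _ _)]
    rw [e r, e s, deg_const s r]
    exact hl _ (Nat.mod_lt _ (by have := deg_ge r; omega))
  refine ⟨c, Mp_of (hn 0).1 ?_, h0⟩
  intro n
  have := (hn n).2
  rwa [src_sgn, src_sgn] at this

end
end MC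

namespace MC
section
variable {T : Set (Set ℂ)} [h : Til T]

lemma sum_angs (d : D T) : ∑ i ∈ Finset.range (deg d), ang ((sg ^ i) d) = 2 * Real.pi := by
  rw [← sum_dat, sum_ang]

lemma inv_pd (d : D T) : 1 / (pd d : ℝ) ≤ 1 / 3 := by
  have : (3 : ℝ) ≤ pd d := by exact_mod_cast pd_ge d
  exact one_div_le_one_div_of_le (by norm_num) this

lemma NF.euler (nf : NF T) (d : D T) :
    ∑ i ∈ Finset.range (deg d), (1 / (pd ((sg ^ i) d) : ℝ)) = ((deg d : ℝ) - 2) / 2 := by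
  rw [← MC.euler d]
  exact Finset.sum_congr rfl (fun i _ => by rw [if_neg (nf _)])

lemma NF.deg_le (nf : NF T) (d : D T) : deg d ≤ 6 := by
  have h1 := nf.euler d
  have h2 := Finset.sum_le_card_nsmul (Finset.range (deg d)) (fun i => 1 / (pd ((sg ^ i) d) : ℝ)) (1/3)
    (fun i _ => inv_pd _)
  rw [h1, Finset.card_range, nsmul_eq_mul] at h2
  have : (deg d : ℝ) ≤ 6 := by linarith
  exact_mod_cast this

lemma flat_deg_le {d : D T} (hd : ang d = Real.pi) : deg d ≤ 4 := by
  classical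
  have h1 := MC.euler d
  obtain ⟨n, hn⟩ : ∃ n, deg d = n + 1 := ⟨deg d - 1, by have := deg_ge d; omega⟩
  rw [hn, Finset.sum_range_succ'] at h1
  simp only [pow_zero, Equiv.Perm.coe_one, id, hd, if_true, add_zero] at h1
  have h2 := Finset.sum_le_card_nsmul (Finset.range n) (fun i => if ang ((sg ^ (i+1)) d) = Real.pi then (0:ℝ) else 1 / (pd ((sg ^ (i+1)) d) : ℝ)) (1/3)
    (fun i _ => by
      split_ifs
      · norm_num
      · exact inv_pd _)
  rw [h1, Finset.card_range, nsmul_eq_mul] at h2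
  push_cast at h2
  have : (n : ℝ) ≤ 3 := by linarith
  have : n ≤ 3 := by exact_mod_cast this
  omega

lemma vec_sgn (d : D T) (t : ℕ) : vec ((sg ^ t) d) =
    ((‖vec ((sg ^ t) d)‖ / ‖vec d‖ : ℝ) : ℂ) *
      Complex.exp ((∑ j ∈ Finset.range t, ang ((sg ^ j) d) : ℝ) * Complex.I) * vec d := by
  induction t with
  | zero =>
    have : ‖vec d‖ ≠ 0 := norm_ne_zero_iff.2 (vec_ne d)
    simp [this]
  | succ t ih =>
    have ha := vec_sg ((sg ^ t) d)
    rw [pow_succ', Equiv.Perm.mul_apply, Finset.sum_range_succ]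
    have h1 : ‖vec d‖ ≠ 0 := norm_ne_zero_iff.2 (vec_ne d)
    have h2 : ‖vec ((sg ^ t) d)‖ ≠ 0 := norm_ne_zero_iff.2 (vec_ne _)
    have key : ∀ (w v u A B : ℂ) (W V U : ℝ), U ≠ 0 → V ≠ 0 → w = ((W / V : ℝ) : ℂ) * A * v →
        v = ((V / U : ℝ) : ℂ) * B * u → w = ((W / U : ℝ) : ℂ) * (B * A) * u := by
      intro w v u A B W V U hU hV e1 e2
      rw [e1, e2]
      have h1' : (U : ℂ) ≠ 0 := by exact_mod_cast hU
      have h2' : (V : ℂ) ≠ 0 := by exact_mod_cast hV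
      push_cast
      field_simp
    rw [Complex.ofReal_add, add_mul, Complex.exp_add]
    exact key _ _ _ _ _ _ _ _ h1 h2 ha ih

lemma Hc.exp {c : ℂ} {r : D T} {t : ℕ} (e : Hc c r ((sg ^ t) r)) :
    c = Complex.exp ((∑ j ∈ Finset.range t, ang ((sg ^ j) r) : ℝ) * Complex.I) := by
  have h1 := vec_sgn r t
  have h2 : ‖vec ((sg ^ t) r)‖ = ‖vec r‖ := by rw [e.1, norm_mul, e.2.1.1, one_mul]
  have h0 : ‖vec r‖ ≠ 0 := norm_ne_zero_iff.2 (vec_ne r)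
  rw [h2, div_self h0, e.1, Complex.ofReal_one, one_mul] at h1
  exact mul_right_cancel₀ (vec_ne r) h1

lemma k3 {c : ℂ} {r : D T} (hk : deg r = 3) (e : Hc c r (sg r)) : Eqv r (sg r) := by
  have e' : Hc c r ((sg ^ 1) r) := by simpa using e
  have hc := e'.exp
  have s3 : sg (sg (sg r)) = r := by have := sgn_deg r; rw [hk] at this; simpa [pow_succ] using this
  have t1 := e.2.1
  have t2 := e.2.2
  have si : sg⁻¹ r = sg (sg r) := by rw [Equiv.Perm.inv_eq_iff_eq, s3]
  rw [si] at t2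
  rw [show sg⁻¹ (sg r) = r by simp] at t2
  have ha := sum_angs r
  rw [hk] at ha
  simp only [Finset.sum_range_succ, Finset.sum_range_zero, pow_succ, pow_zero, one_mul, zero_add,
    Equiv.Perm.coe_mul, Function.comp, Equiv.Perm.coe_one, id] at ha hc
  rw [t1.ang, ← t2.ang] at ha
  have a1 : ang r = 2 * Real.pi / 3 := by have := t2.ang; linarith [t1.ang]
  have c3 : c * c * c = 1 := by
    rw [hc, a1, ← Complex.exp_add, ← Complex.exp_add, Complex.exp_eq_one_iff]
    exact ⟨1, by push_cast; ring⟩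
  have t3 := (t2.trans t1).symm
  have : (c * c)⁻¹ = c := inv_eq_of_mul_eq_one_right c3
  rw [this] at t3
  refine Eqv_of e.1 ?_
  intro n hn
  rw [hk] at hn
  interval_cases n
  · exact t1
  · simpa using t3
  · simpa [pow_succ, s3] using t2

lemma k4_2 {c : ℂ} {r : D T} (hk : deg r = 4) (e : Hc c r (sg (sg r))) : Eqv r (sg (sg r)) := by
  have e' : Hc c r ((sg ^ 2) r) := by simpa [pow_succ] using e
  have hc := e'.exp
  have s4 : sg (sg (sg (sg r))) = r := by
    have := sgn_deg r; rw [hk] at this; simpa [pow_succ] using this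
  have t1 := e.2.1
  have t2 := e.2.2
  have si : sg⁻¹ r = sg (sg (sg r)) := by rw [Equiv.Perm.inv_eq_iff_eq, s4]
  rw [si] at t2
  rw [show sg⁻¹ (sg (sg r)) = sg r by simp] at t2
  have ha := sum_angs r
  rw [hk] at ha
  simp only [Finset.sum_range_succ, Finset.sum_range_zero, pow_succ, pow_zero, one_mul, zero_add,
    Equiv.Perm.coe_mul, Function.comp, Equiv.Perm.coe_one, id] at ha hc
  have a1 : ang r + ang (sg r) = Real.pi := by have := t2.ang; have := t1.ang; linarith
  rw [a1, Complex.exp_pi_mul_I] at hc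
  subst hc
  have t3 := t1.symm
  have t4 := t2.symm
  rw [inv_neg, inv_one] at t3 t4
  refine Eqv_of e.1 ?_
  intro n hn
  rw [hk] at hn
  interval_cases n
  · exact t1
  · simpa [pow_succ, s4] using t4
  · simpa [pow_succ, s4] using t3
  · simpa [pow_succ, s4] using t2

lemma four_unit {u v w z : ℂ} {l : ℝ} (l0 : 0 < l) (hu : ‖u‖ = l) (hv : ‖v‖ = l) (hw : ‖w‖ = l) (hz : ‖z‖ = l)
    (hs : u + v + w + z = 0) : u + v = 0 ∨ v + w = 0 ∨ u + w = 0 := by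
  have hz' : z = -(u + v + w) := by linear_combination hs
  have key : ∀ x : ℂ, ‖x‖ = l → x * starRingEnd ℂ x = (l : ℂ) ^ 2 := by
    intro x hx; rw [Complex.mul_conj, Complex.normSq_eq_norm_sq, hx]; push_cast; rfl
  have ku := key u hu
  have kv := key v hv
  have kw := key w hw
  have kz := key z hz
  rw [hz'] at kz
  simp only [map_neg, map_add] at kz
  have : (u + v) * ((v + w) * (u + w)) * (l : ℂ) ^ 2 = 0 := by
    set u' := starRingEnd ℂ u
    set v' := starRingEnd ℂ v
    set w' := starRingEnd ℂ w
    have k1 : (u + v + w) * (u' + v' + w') = (l : ℂ) ^ 2 := by linear_combination kz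
    -- multiply by u v w
    have k2 : (u + v + w) * (l ^ 2 * (v * w) + l ^ 2 * (u * w) + l ^ 2 * (u * v)) = (l : ℂ) ^ 2 * (u * v * w) := by
      linear_combination (u * v * w) * k1 - (u + v + w) * (v * w * ku + u * w * kv + u * v * kw)
    linear_combination k2
  have l2 : (l : ℂ) ^ 2 ≠ 0 := by
    have : (l : ℂ) ≠ 0 := by exact_mod_cast l0.ne'
    exact pow_ne_zero _ this
  rcases mul_eq_zero.1 this with h1 | h1
  · rcases mul_eq_zero.1 h1 with h2 | h2
    · exact Or.inl h2
    · rcases mul_eq_zero.1 h2 with h3 | h3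
      · exact Or.inr (Or.inl h3)
      · exact Or.inr (Or.inr h3)
  · exact absurd h1 l2

lemma vec_nx_add (d : D T) : vec d + vec (nx d) ≠ 0 := by
  intro h0
  have : vec (sg (nx d)) = vec (nx d) := by rw [rv_nx, vec_rv]; linear_combination -h0
  exact ang_ne (nx d) (dext_vec (src_sg _) this)

lemma all_of (r : D T) (p : D T → Prop) (hp : ∀ d d', Eqv d d' → p d → p d')
    (h1 : ∀ n < deg r, p ((sg ^ n) r)) (d : D T) : p d := by
  obtain ⟨r', e1, e2⟩ := exists_Eqv d (spec r).hx
  obtain ⟨n, hn, e3⟩ := exists_sgn e1.symm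
  exact hp _ _ e2.symm (e3 ▸ h1 n hn)

lemma vec_cyc4 {d : D T} (h4 : (nx ^ 4) d = d) :
    vec d + vec (nx d) + vec (nx (nx d)) + vec (nx (nx (nx d))) = 0 := by
  unfold vec
  have : tgt (nx (nx (nx d))) = src d := by
    rw [← src_nx]; congr 1
  rw [this, src_nx, src_nx, src_nx]; ring

lemma k4_1 (nf : NF T) {c : ℂ} {r : D T} (hk : deg r = 4) (e : Hc c r (sg r)) : Eqv r (sg r) := by
  have s4 : sg (sg (sg (sg r))) = r := by
    have := sgn_deg r; rw [hk] at this; simpa [pow_succ] using this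
  have t1 := e.2.1
  have t2 := e.2.2
  have si : sg⁻¹ r = sg (sg (sg r)) := by rw [Equiv.Perm.inv_eq_iff_eq, s4]
  rw [si] at t2
  rw [show sg⁻¹ (sg r) = r by simp] at t2
  have he := nf.euler r
  have ha := sum_angs r
  rw [hk] at ha he
  simp only [Finset.sum_range_succ, Finset.sum_range_zero, pow_succ, pow_zero, one_mul, zero_add,
    Equiv.Perm.coe_mul, Function.comp, Equiv.Perm.coe_one, id] at ha he
  rw [t1.pd, ← t2.pd] at he
  have p3 := pd_ge r
  have p3' := pd_ge (sg (sg r))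
  have hpp : pd r = 4 ∧ pd (sg (sg r)) = 4 := by
    set p := pd r
    set q := pd (sg (sg r))
    have hp0 : (p : ℝ) ≠ 0 := by positivity
    have hq0 : (q : ℝ) ≠ 0 := by positivity
    field_simp at he
    have he' : 3 * q + p = p * q := by
      have : (3 * q + p : ℝ) = p * q := by push_cast at he; linarith
      exact_mod_cast this
    have : p ≤ 4 := by
      by_contra hc
      obtain ⟨a, ha⟩ : ∃ a, p = a + 5 := ⟨p - 5, by omega⟩
      obtain ⟨b, hb⟩ : ∃ b, q = b + 3 := ⟨q - 3, by omega⟩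
      rw [ha, hb] at he'
      nlinarith
    interval_cases p <;> omega
  have hP : ∀ d : D T, pd d = 4 := by
    refine all_of r _ (fun d d' h1 h2 => by rw [h1.pd, h2]) ?_
    intro n hn
    rw [hk] at hn
    interval_cases n
    · exact hpp.1
    · simpa using t1.pd.trans hpp.1
    · simpa [pow_succ] using hpp.2
    · simpa [pow_succ] using t2.pd.symm.trans hpp.1
  have nrm : ∀ x : ℂ, ‖c * x‖ = ‖x‖ := by intro x; rw [norm_mul, t1.1, one_mul]
  have hL : ∀ d : D T, ‖vec d‖ = ‖vec r‖ := by
    refine all_of r _ (fun d d' h1 h2 => by rw [h1.len, h2]) ?_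
    intro n hn
    rw [hk] at hn
    have h1 : ‖vec (sg r)‖ = ‖vec r‖ := by rw [e.1, nrm]
    interval_cases n
    · rfl
    · simpa using h1
    · have := t1.sg nf
      simp only [pow_succ, pow_zero, one_mul, Equiv.Perm.coe_mul, Function.comp]
      rw [this, nrm, h1]
    · have := t2.vec nf
      simp only [pow_succ, pow_zero, one_mul, Equiv.Perm.coe_mul, Function.comp]
      rw [this, nrm]
  have l0 : 0 < ‖vec r‖ := norm_pos_iff.2 (vec_ne r)
  have n4 : ∀ d : D T, (nx ^ 4) d = d := fun d => by rw [← hP d]; exact nx_pd nf d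
  have opp : ∀ d : D T, vec (nx (nx d)) = - vec d := by
    intro d
    have h1 := vec_cyc4 (n4 d)
    rcases four_unit l0 (hL _) (hL _) (hL _) (hL _) h1 with h2 | h2 | h2
    · exact absurd h2 (vec_nx_add d)
    · exact absurd h2 (vec_nx_add _)
    · linear_combination h2
  have sgnx : ∀ d : D T, vec (sg d) = vec (nx d) := by
    intro d
    rw [sg_apply, vec_rv]
    have := opp (nx⁻¹ d)
    rw [show nx (nx⁻¹ d) = d by simp] at this
    rw [this]
  have ex : ∀ d : D T, vec (sg d) = Complex.exp (ang d * Complex.I) * vec d := by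
    intro d
    have := vec_sg d
    rw [hL (sg d), hL d, div_self l0.ne'] at this
    simpa using this
  have hsum : ∀ d : D T, ang d + ang (nx d) = Real.pi := by
    intro d
    have h1 := ex d
    have h2 := ex (nx d)
    rw [sgnx] at h1 h2
    rw [opp, h1, ← mul_assoc, ← Complex.exp_add] at h2
    have h3 : Complex.exp (↑(ang (nx d)) * Complex.I + ↑(ang d) * Complex.I) = -1 := by
      have := vec_ne d
      apply mul_right_cancel₀ this
      rw [← h2]; ring
    have h4 : Complex.exp (((ang (nx d) + ang d - Real.pi : ℝ) : ℂ) * Complex.I) = 1 := by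
      have : ((ang (nx d) + ang d - Real.pi : ℝ) : ℂ) * Complex.I
        = (↑(ang (nx d)) * Complex.I + ↑(ang d) * Complex.I) - Real.pi * Complex.I := by push_cast; ring
      rw [this, Complex.exp_sub, h3, Complex.exp_pi_mul_I]; norm_num
    have h5 := congrArg Complex.re h4
    rw [Complex.exp_ofReal_mul_I_re, Complex.one_re] at h5
    have b1 := ang_pos d
    have b2 := ang_pos (nx d)
    have b3 := lt_of_le_of_ne (ang_le d) (nf d)
    have b4 := lt_of_le_of_ne (ang_le (nx d)) (nf _)
    have := (Real.cos_eq_one_iff_of_lt_of_lt (by linarith) (by linarith)).1 h5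
    linarith
  have hang : ang r = Real.pi / 2 ∧ ang (sg (sg r)) = Real.pi / 2 := by
    have h1 := hsum r
    have h2 : ang (nx r) = ang r ∨ ang (nx r) = ang (sg (sg r)) := by
      refine all_of r (fun d => ang d = ang r ∨ ang d = ang (sg (sg r)))
        (fun d d' h1 h2 => by rw [h1.ang]; exact h2) ?_ (nx r)
      intro n hn
      rw [hk] at hn
      interval_cases n
      · exact Or.inl rfl
      · exact Or.inl (by simpa using t1.ang)
      · exact Or.inr (by simp [pow_succ])
      · exact Or.inl (by simpa [pow_succ] using t2.ang.symm)
    have := t1.ang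
    have := t2.ang
    rcases h2 with h2 | h2 <;> constructor <;> linarith
  have hall : ∀ d : D T, ang d = Real.pi / 2 := by
    refine all_of r _ (fun d d' h1 h2 => by rw [h1.ang, h2]) ?_
    intro n hn
    rw [hk] at hn
    interval_cases n
    · exact hang.1
    · simpa using t1.ang.trans hang.1
    · simpa [pow_succ] using hang.2
    · simpa [pow_succ] using t2.ang.symm.trans hang.1
  have hI : ∀ d : D T, vec (sg d) = Complex.I * vec d := by
    intro d
    rw [ex d, hall d]
    have : ((Real.pi / 2 : ℝ) : ℂ) * Complex.I = Real.pi / 2 * Complex.I := by push_cast; rfl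
    rw [this, Complex.exp_pi_div_two_mul_I]
  have hnx : ∀ (d : D T) (n : ℕ), vec ((nx ^ n) d) = Complex.I ^ n * vec d := by
    intro d n
    induction n with
    | zero => simp
    | succ n ih => rw [pow_succ', Equiv.Perm.mul_apply, ← sgnx, hI, ih]; ring
  refine Eqv_of (hI r) ?_
  intro n _
  refine tile_of_vecs (by simp) ?_
  intro m
  rw [hnx, hnx]
  have : (sg ^ n) (sg r) = sg ((sg ^ n) r) := by
    rw [← Equiv.Perm.mul_apply, ← pow_succ, pow_succ', Equiv.Perm.mul_apply]
  rw [this, hI]; ring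

end
end MC

namespace MC
section
variable {T : Set (Set ℂ)} [h : Til T]

/-- a labelling of darts by equivalence classes -/
structure Lab {T : Set (Set ℂ)} [Til T] (k : ℕ) [NeZero k] (L : D T → Fin k) : Prop where
  eqv : ∀ d d', L d = L d' ↔ Eqv d d'
  sg : ∀ d, L (sg d) = L d + 1

lemma sgn_mod {k : ℕ} {d : D T} (hk : deg d = k) (n : ℕ) : (sg ^ (n % k)) d = (sg ^ n) d := by
  conv_rhs => rw [← Nat.mod_add_div n k]
  have h1 : (sg ^ (k * (n / k))) d = d := (sgn_eq_iff d _).2 (by rw [hk]; exact dvd_mul_right _ _)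
  rw [pow_add, Equiv.Perm.mul_apply, h1]

lemma Eqv_shift {k : ℕ} [NeZero k] {d0 : D T} (hk0 : deg d0 = k) (n : Fin k) {i j : Fin k}
    (h1 : Eqv ((sg ^ (i : ℕ)) d0) ((sg ^ (j : ℕ)) d0)) :
    Eqv ((sg ^ ((i + n : Fin k) : ℕ)) d0) ((sg ^ ((j + n : Fin k) : ℕ)) d0) := by
  have h5 := h1.sgn (n : ℕ)
  rw [← Equiv.Perm.mul_apply, ← Equiv.Perm.mul_apply, ← pow_add, ← pow_add] at h5
  rw [Fin.val_add, Fin.val_add, sgn_mod hk0, sgn_mod hk0, add_comm (i : ℕ), add_comm (j : ℕ)]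
  exact h5

lemma sgn_add_one {k : ℕ} [NeZero k] {d : D T} (hk : deg d = k) (i : Fin k) :
    (sg ^ ((i + 1 : Fin k) : ℕ)) d = sg ((sg ^ (i : ℕ)) d) := by
  rw [Fin.val_add, sgn_mod hk, ← Equiv.Perm.mul_apply, ← pow_succ']
  have h3 := deg_ge d
  rw [Fin.val_one', Nat.mod_eq_of_lt (by omega)]

lemma exists_lb {k : ℕ} [NeZero k] {d0 : D T} (hk : deg d0 = k) (d : D T) :
    ∃ i : Fin k, Eqv ((sg ^ (i : ℕ)) d0) d := by
  obtain ⟨r, e1, e2⟩ := exists_Eqv d (spec d0).hx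
  obtain ⟨n, hn, e3⟩ := exists_sgn e1.symm
  exact ⟨⟨n, hk ▸ hn⟩, by simp only [e3]; exact e2.symm⟩

lemma exists_Lab {k : ℕ} [NeZero k] {d0 : D T} (hk : deg d0 = k)
    (hu : ∀ i j : Fin k, Eqv ((sg ^ (i : ℕ)) d0) ((sg ^ (j : ℕ)) d0) → i = j) :
    ∃ L : D T → Fin k, Lab k L ∧ ∀ i : Fin k, L ((sg ^ (i : ℕ)) d0) = i := by
  choose L hL using exists_lb (k := k) hk
  refine ⟨L, ⟨?_, ?_⟩, ?_⟩
  · intro d d'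
    constructor
    · intro e; have := hL d; rw [e] at this; exact this.symm.trans (hL d')
    · intro e; exact hu _ _ ((hL d).trans (e.trans (hL d').symm))
  · intro d
    apply hu
    refine (hL _).trans ?_
    rw [sgn_add_one hk]
    exact (hL d).sg.symm
  · intro i
    exact hu _ _ (hL _)

lemma Lab.sgi {k : ℕ} [NeZero k] {L : D T → Fin k} (l : Lab k L) (d : D T) : L (MC.sg⁻¹ d) = L d - 1 := by
  have := l.sg (MC.sg⁻¹ d)
  rw [show MC.sg (MC.sg⁻¹ d) = d by simp] at this
  rw [this, add_sub_cancel_right]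

lemma Lab.nx {k : ℕ} [NeZero k] {L : D T → Fin k} (l : Lab k L) (d : D T) : L (nx d) = L (rv d) - 1 := by
  rw [nx_eq, l.sgi]

lemma Lab.rnxi {k : ℕ} [NeZero k] {L : D T → Fin k} (l : Lab k L) (d : D T) :
    L (rv (MC.nx⁻¹ d)) = L d + 1 := by
  rw [← sg_apply, l.sg]

lemma Lab.star {k : ℕ} [NeZero k] {L : D T → Fin k} (l : Lab k L)
    (hm : ∀ d d', L d = L d' → L (rv d) = L (rv d')) : Star T := by
  intro d d' e
  exact (l.eqv _ _).1 (hm _ _ ((l.eqv _ _).2 e))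

/-- endpoint of the side starting at a proper dart -/
lemma side_end (d : D T) : ∃ t : ℝ, 1 ≤ t ∧ src d + t • vec d ∈ Set.extremePoints ℝ (lt d) := by
  obtain ⟨t, t0, ht⟩ := line_ext (spec d).hP (vec_ne d) (spec d).yP (ε := -1) (by norm_num)
    (fun z hz => by have := (spec d).left' z hz; change -1 * cr (tgt d - src d) (z - tgt d) ≤ 0; linarith)
  refine ⟨1 + t, by linarith, ?_⟩
  rw [add_smul, one_smul, ← add_assoc, add_vec]; exact ht

lemma side_unique {P : Set ℂ} {x v : ℂ} {s t : ℝ} (xP : x ∈ P) (hv : v ≠ 0) (s0 : 0 < s) (t0 : 0 < t)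
    (h1 : x + s • v ∈ Set.extremePoints ℝ P) (h2 : x + t • v ∈ Set.extremePoints ℝ P) : s = t := by
  have key : ∀ s t : ℝ, 0 < s → x + s • v ∈ Set.extremePoints ℝ P → x + t • v ∈ P → ¬ s < t := by
    intro s t s0 h1 h2 hst
    have := h1.2 xP h2 (show x + s • v ∈ openSegment ℝ x (x + t • v) by
      rw [openSegment_eq_image']
      refine ⟨s / t, ⟨by apply div_pos s0; linarith, by rw [div_lt_one (by linarith)]; exact hst⟩, ?_⟩
      simp only [add_sub_cancel_left, smul_smul]
      rw [div_mul_cancel₀ _ (by linarith)])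
    have h3 : s • v = 0 := by simpa using this
    rcases smul_eq_zero.1 h3 with h | h
    · linarith
    · exact hv h
  rcases lt_trichotomy s t with hh | hh | hh
  · exact absurd hh (key s t s0 h1 h2.1)
  · exact hh
  · exact absurd hh (key t s t0 h2 h1.1)

/-- all sides have the same length if all proper corners are congruent -/
lemma side_len {d0 : D T} (hd0 : ∀ e : D T, ang e ≠ Real.pi → ∃ a, Tc a d0 e) :
    ∃ σ : ℝ, ∀ e : D T, ang e ≠ Real.pi → ∀ t : ℝ, 0 < t →
      src e + t • vec e ∈ Set.extremePoints ℝ (lt e) → t * ‖vec e‖ = σ := by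
  obtain ⟨t0, ht0, hm⟩ := side_end d0
  refine ⟨t0 * ‖vec d0‖, ?_⟩
  intro e he t t1 ht
  obtain ⟨a, ha⟩ := hd0 e he
  obtain ⟨κ, k0, hk⟩ := ha.out
  have h1 : src e + (t0 / κ) • vec e ∈ Set.extremePoints ℝ (lt e) := by
    rw [ha.2, ← mv_ext ha.1]
    refine ⟨_, hm, ?_⟩
    rw [hk, smul_smul, div_mul_cancel₀ _ k0.ne']
    unfold mv; simp; ring
  have h2 := side_unique (spec e).xP (vec_ne e) t1 (by apply div_pos _ k0; linarith) ht h1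
  rw [h2, hk, norm_smul, norm_mul, ha.1, Real.norm_of_nonneg k0.le]
  field_simp

lemma flat_short {σ : ℝ} (hσ : ∀ e : D T, ang e ≠ Real.pi → ∀ t : ℝ, 0 < t →
      src e + t • vec e ∈ Set.extremePoints ℝ (lt e) → t * ‖vec e‖ = σ) {f : D T} (hf : ang f = Real.pi) :
    ‖vec f‖ < σ ∧ ‖vec (sg f)‖ < σ := by
  obtain ⟨τ, τ0, hτ⟩ := sg_flat ((ang_pi_iff f).1 hf)
  have v0 : 0 < ‖vec f‖ := norm_pos_iff.2 (vec_ne f)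
  -- forward end
  obtain ⟨t2, h2, hw2⟩ := side_end f
  -- backward end
  have hpm := tgt_sg_mem f
  obtain ⟨t1, h1, hw1⟩ := line_ext (spec f).hP (v := vec (sg f)) (m := tgt (sg f)) (vec_ne _) hpm (ε := 1) (by norm_num)
    (fun z hz => by
      have h1 := left_sg f z hz
      have e : z - src f = (z - tgt (sg f)) + vec (sg f) := by unfold vec; rw [src_sg]; ring
      rw [e, cr_add_left, cr_self, cr_swap] at h1; linarith)
  obtain ⟨g, g1, g2⟩ := out_exists (spec f).hP ⟨_, (spec f).hP, hw1⟩ hw1.1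
  have gn : ang g ≠ Real.pi := by
    rw [Ne, ang_pi_iff_ext, not_not, g1, g2]; exact hw1
  have hw : tgt (sg f) + t1 • vec (sg f) = src f - ((1 + t1) * τ) • vec f := by
    rw [← add_vec, src_sg, hτ]; simp; ring
  rw [hw] at hw1 g1
  obtain ⟨κ, k0, hk⟩ := out_dir (spec f).hP (x := src g) (a := vec g) (b := vec f) (vec_ne g) (vec_ne f)
    (by
      rw [g1]
      have e : src f - ((1 + t1) * τ) • vec f + vec f
        = src f - ((1 + t1) * τ) • vec f + ((1 + (1 + t1) * τ)⁻¹ : ℝ) • (tgt f - (src f - ((1 + t1) * τ) • vec f)) := by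
        have : tgt f - (src f - ((1 + t1) * τ) • vec f) = (1 + (1 + t1) * τ) • vec f := by
          rw [← add_vec]; simp; ring
        rw [this, smul_smul, inv_mul_cancel₀ (by positivity), one_smul]
      rw [e]
      refine (Til.cvx _ (spec f).hP).add_smul_sub_mem hw1.1 (spec f).yP ⟨by positivity, ?_⟩
      apply inv_le_one_of_one_le₀
      have : 0 < (1 + t1) * τ := by positivity
      linarith)
    (by rw [add_vec, ← g2]; exact (spec g).yP)
    (by rw [← g2]; exact (spec g).left)
    (fun z hz => by
      have := (spec f).left z hz
      rw [g1]
      have e : z - (src f - ((1 + t1) * τ) • vec f) = (z - src f) + ((1 + t1) * τ) • vec f := by ring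
      rw [e, cr_add_right, cr_rsmul_right, cr_self]
      change 0 ≤ cr (tgt f - src f) (z - src f) + _
      linarith)
  have h3 := hσ g gn ((t2 + (1 + t1) * τ) * κ) (by positivity) (by
    rw [g1, g2, mul_smul (t2 + (1 + t1) * τ) κ, ← hk]
    convert hw2 using 1
    simp; ring)
  have e1 : (t2 + (1 + t1) * τ) * κ * ‖vec g‖ = (t2 + (1 + t1) * τ) * ‖vec f‖ := by
    rw [hk, norm_smul, Real.norm_of_nonneg k0.le]; ring
  have e2 : ‖vec (sg f)‖ = τ * ‖vec f‖ := by
    rw [hτ, norm_neg, norm_smul, Real.norm_of_nonneg τ0.le]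
  rw [e1] at h3
  rw [e2, ← h3]
  constructor
  · have : 0 < (1 + t1) * τ := by positivity
    nlinarith
  · have : 0 ≤ t1 * τ := by positivity
    nlinarith

lemma k4_flat {c : ℂ} {r : D T} (hk : deg r = 4) (hnf : ¬ NF T) (e : Hc c r (sg r)) : Star T := by
  classical
  have s4 : sg (sg (sg (sg r))) = r := by
    have := sgn_deg r; rw [hk] at this; simpa [pow_succ] using this
  have t1 := e.2.1
  have t2 := e.2.2
  have si : sg⁻¹ r = sg (sg (sg r)) := by rw [Equiv.Perm.inv_eq_iff_eq, s4]
  rw [si] at t2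
  rw [show sg⁻¹ (sg r) = r by simp] at t2
  have r0 : ang r ≠ Real.pi := by
    intro h0
    exact ang_ne r (flat_unique (src_sg r) (by rw [t1.ang, h0]) h0)
  have r1 : ang (sg r) ≠ Real.pi := by rw [t1.ang]; exact r0
  have r3 : ang (sg (sg (sg r))) ≠ Real.pi := by rw [← t2.ang]; exact r0
  have r2 : ang (sg (sg r)) = Real.pi := by
    by_contra hc
    apply hnf
    refine all_of r _ (fun d d' h1 h2 => by rw [h1.ang]; exact h2) ?_
    intro n hn
    rw [hk] at hn
    interval_cases n
    · exact r0
    · simpa using r1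
    · simpa [pow_succ] using hc
    · simpa [pow_succ] using r3
  obtain ⟨d0, hd0⟩ : ∃ d0, d0 = sg (sg (sg r)) := ⟨_, rfl⟩
  rw [← hd0] at s4 t2 r3 si
  have hk0 : deg d0 = 4 := by rw [← hk]; exact deg_const _ _
  have a0 : (sg ^ 0) d0 = d0 := rfl
  have a1 : (sg ^ 1) d0 = r := by simp [s4]
  have a2 : (sg ^ 2) d0 = sg r := by simp [s4, pow_succ]
  have a3 : (sg ^ 3) d0 = sg (sg r) := by simp [s4, pow_succ]
  have hfl : ∀ i : Fin 4, ang ((sg ^ (i : ℕ)) d0) = Real.pi ↔ i = 3 := by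
    intro i
    fin_cases i
    · change ang ((sg ^ 0) d0) = Real.pi ↔ (0 : Fin 4) = 3
      rw [a0]; exact iff_of_false r3 (by decide)
    · change ang ((sg ^ 1) d0) = Real.pi ↔ (1 : Fin 4) = 3
      rw [a1]; exact iff_of_false r0 (by decide)
    · change ang ((sg ^ 2) d0) = Real.pi ↔ (2 : Fin 4) = 3
      rw [a2]; exact iff_of_false r1 (by decide)
    · change ang ((sg ^ 3) d0) = Real.pi ↔ (3 : Fin 4) = 3
      rw [a3]; exact iff_of_true r2 rfl
  have hu : ∀ i j : Fin 4, Eqv ((sg ^ (i : ℕ)) d0) ((sg ^ (j : ℕ)) d0) → i = j := by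
    intro i j h1
    have h3 := (Eqv_shift hk0 (3 - i) h1).ang
    have h4 := (hfl (i + (3 - i))).2 (add_sub_cancel i 3)
    rw [← h3, hfl] at h4
    have : ∀ i j : Fin 4, j + (3 - i) = 3 → i = j := by decide
    exact this i j h4
  obtain ⟨L, l, hL⟩ := exists_Lab hk0 hu
  have flat_iff : ∀ d : D T, ang d = Real.pi ↔ L d = 3 := by
    intro d
    have h1 : Eqv ((sg ^ ((L d : Fin 4) : ℕ)) d0) d := (l.eqv _ _).1 (hL _)
    rw [h1.ang, hfl]
  have hprop : ∀ e : D T, ang e ≠ Real.pi → ∃ a, Tc a r e := by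
    intro e he
    have h1 : Eqv ((sg ^ ((L e : Fin 4) : ℕ)) d0) e := (l.eqv _ _).1 (hL _)
    obtain ⟨a, ha⟩ := h1.hc
    have h2 := ha.2.1
    rw [Ne, flat_iff] at he
    generalize L e = i at h2 he
    fin_cases i
    · change Tc a ((sg ^ 0) d0) e at h2
      rw [a0] at h2
      exact ⟨_, t2.symm.trans h2⟩
    · change Tc a ((sg ^ 1) d0) e at h2
      rw [a1] at h2
      exact ⟨_, h2⟩
    · change Tc a ((sg ^ 2) d0) e at h2
      rw [a2] at h2
      exact ⟨_, t1.trans h2⟩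
    · exact absurd rfl he
  obtain ⟨σ, hσ⟩ := side_len hprop
  -- number of corners
  have hP3 : ∀ d : D T, ang d ≠ Real.pi → pd d = 3 := by
    have he := MC.euler r
    rw [hk] at he
    simp only [Finset.sum_range_succ, Finset.sum_range_zero, pow_succ, pow_zero, one_mul, zero_add,
      Equiv.Perm.coe_mul, Function.comp, Equiv.Perm.coe_one, id, if_neg r0, if_neg r1, if_pos r2] at he
    rw [← hd0, if_neg r3, t1.pd, ← t2.pd] at he
    have p3 := pd_ge r
    have : pd r = 3 := by
      have hp0 : (pd r : ℝ) ≠ 0 := by positivity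
      field_simp at he
      have : (pd r : ℝ) = 3 := by push_cast at he; linarith
      exact_mod_cast this
    intro d hd
    obtain ⟨a, ha⟩ := hprop d hd
    rw [ha.pd, this]
  -- the reversal map on labels
  have m3 : ∀ d : D T, L d = 3 → L (rv d) = 3 := by
    intro d hd
    rw [← flat_iff] at hd ⊢
    by_contra hc
    have h1 := (flat_short hσ hd).1
    have h2 := hσ (rv d) hc 1 one_pos (by
      rw [one_smul, add_vec, tgt_rv, lt_rv]
      by_contra h3
      have h4 : ang (sg⁻¹ d) = Real.pi := by rw [ang_pi_iff_ext, src_sgi]; exact h3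
      have h5 := flat_unique (src_sgi d) h4 hd
      rw [Equiv.Perm.inv_eq_iff_eq] at h5
      exact ang_ne d h5.symm)
    rw [vec_rv, norm_neg] at h2
    linarith
  have m0 : ∀ d : D T, L d = 0 → L (rv d) = 0 := by
    intro d hd
    have h3 : L (sg⁻¹ d) = 3 := by rw [l.sgi, hd]; decide
    rw [← flat_iff] at h3
    have h1 := (flat_short hσ h3).2
    rw [show sg (sg⁻¹ d) = d by simp] at h1
    have hdn : ang d ≠ Real.pi := by rw [Ne, flat_iff, hd]; decide
    have h4 : L (nx d) = 3 := by
      rw [← flat_iff, ang_pi_iff_ext, src_nx, lt_nx]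
      intro h5
      have := hσ d hdn 1 one_pos (by rw [one_smul, add_vec]; exact h5)
      linarith
    rw [l.nx] at h4
    have : ∀ i : Fin 4, i - 1 = 3 → i = 0 := by decide
    exact this _ h4
  have m2 : ∀ d : D T, L d = 2 → L (rv d) ≠ 1 := by
    intro d hd h1
    have b3 : L (nx⁻¹ d) = 3 := by
      have h2 := l.rnxi d
      rw [hd] at h2
      have := m3 _ h2
      rwa [rv_rv] at this
    have b0 : L (nx⁻¹ (nx⁻¹ d)) = 0 := by
      have h2 := l.rnxi (nx⁻¹ d)
      rw [b3] at h2
      have := m0 _ h2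
      rwa [rv_rv] at this
    have f0 : L (nx d) = 0 := by rw [l.nx, h1]; decide
    have f3 : L (nx (nx d)) = 3 := by rw [l.nx, m0 _ f0]; decide
    have f2 : L (nx (nx (nx d))) = 2 := by rw [l.nx, m3 _ f3]; decide
    have hdn : ang d ≠ Real.pi := by rw [Ne, flat_iff, hd]; decide
    have hc := pd_eq d
    rw [hP3 d hdn] at hc
    by_cases hcyc : nx d = nx⁻¹ (nx⁻¹ d)
    · have hn3 : (nx ^ 3) (nx⁻¹ (nx⁻¹ d)) = nx⁻¹ (nx⁻¹ d) := by
        simp [pow_succ, hcyc]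
      have hsub : (dtl (lt d) : Finset (D T)).filter (fun e => ang e ≠ Real.pi) ⊆ {d, nx⁻¹ (nx⁻¹ d)} := by
        intro e he
        rw [Finset.mem_filter, mem_dtl] at he
        obtain ⟨n, hn⟩ := exists_nxn (d := nx⁻¹ (nx⁻¹ d)) (e := e) (by rw [lt_nxi, lt_nxi]; exact he.1)
        have hper : ∀ m : ℕ, ((nx ^ 3) ^ m) (nx⁻¹ (nx⁻¹ d)) = nx⁻¹ (nx⁻¹ d) := by
          intro m; induction m with
          | zero => rfl
          | succ m ih => rw [pow_succ, Equiv.Perm.mul_apply, hn3, ih]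
        have : (nx ^ (n % 3)) (nx⁻¹ (nx⁻¹ d)) = e := by
          rw [← hn]; conv_rhs => rw [← Nat.mod_add_div n 3]
          rw [pow_add, Equiv.Perm.mul_apply, pow_mul, hper]
        have hlt : n % 3 < 3 := Nat.mod_lt _ (by norm_num)
        generalize n % 3 = q at this hlt
        interval_cases q
        · rw [← this]; simp
        · exfalso; apply he.2; rw [flat_iff, ← this]; simpa using b3
        · rw [← this]; simp [pow_succ]
      have := Finset.card_le_card hsub
      have := Finset.card_le_two (a := d) (b := nx⁻¹ (nx⁻¹ d))
      omega
    · have hsub : ({d, nx d, nx (nx (nx d)), nx⁻¹ (nx⁻¹ d)} : Finset (D T)) ⊆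
          (dtl (lt d) : Finset (D T)).filter (fun e => ang e ≠ Real.pi) := by
        intro e he
        simp only [Finset.mem_insert, Finset.mem_singleton] at he
        simp only [Finset.mem_filter, mem_dtl, Ne, flat_iff]
        rcases he with rfl | rfl | rfl | rfl
        · exact ⟨rfl, by rw [hd]; decide⟩
        · exact ⟨by simp [lt_nx], by rw [f0]; decide⟩
        · exact ⟨by simp [lt_nx], by rw [f2]; decide⟩
        · exact ⟨by rw [lt_nxi, lt_nxi], by rw [b0]; decide⟩
      have hle := Finset.card_le_card hsub
      have ne1 : d ≠ nx d := fun h0 => by rw [← h0, hd] at f0; exact absurd f0 (by decide)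
      have ne2 : d ≠ nx⁻¹ (nx⁻¹ d) := fun h0 => by rw [← h0, hd] at b0; exact absurd b0 (by decide)
      have ne3 : nx d ≠ nx (nx (nx d)) := fun h0 => by rw [← h0, f0] at f2; exact absurd f2 (by decide)
      have ne4 : nx (nx (nx d)) ≠ nx⁻¹ (nx⁻¹ d) := fun h0 => by rw [← h0, f2] at b0; exact absurd b0 (by decide)
      have ne5 : d ≠ nx (nx (nx d)) := fun h0 => by
        apply hcyc
        rw [eq_comm, Equiv.Perm.inv_eq_iff_eq, Equiv.Perm.inv_eq_iff_eq]; exact h0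
      have h4 : ({d, nx d, nx (nx (nx d)), nx⁻¹ (nx⁻¹ d)} : Finset (D T)).card = 4 := by
        rw [Finset.card_insert_of_notMem (by
          intro hmem; simp only [Finset.mem_insert, Finset.mem_singleton] at hmem; tauto),
          Finset.card_insert_of_notMem (by
          intro hmem; simp only [Finset.mem_insert, Finset.mem_singleton] at hmem; tauto), Finset.card_pair ne4]
      omega
  have fin4 : ∀ i : Fin 4, i ≠ 0 → i ≠ 3 → i ≠ 1 → i = 2 := by decide
  have fin4' : ∀ i : Fin 4, i ≠ 0 → i ≠ 3 → i ≠ 2 → i = 1 := by decide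
  have hm : ∀ d : D T, L (rv d) = L d := by
    intro d
    have i0 : L (rv d) = 0 → L d = 0 := fun h0 => by simpa using m0 _ h0
    have i3 : L (rv d) = 3 → L d = 3 := fun h0 => by simpa using m3 _ h0
    by_cases c0 : L d = 0
    · rw [m0 d c0, c0]
    by_cases c3 : L d = 3
    · rw [m3 d c3, c3]
    by_cases c2 : L d = 2
    · rw [c2]; exact fin4 _ (fun h0 => c0 (i0 h0)) (fun h0 => c3 (i3 h0)) (m2 d c2)
    · have c1 := fin4' _ c0 c3 c2
      rw [c1]
      refine fin4' _ (fun h0 => c0 (i0 h0)) (fun h0 => c3 (i3 h0)) ?_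
      intro h2
      refine m2 _ h2 ?_
      rw [rv_rv, c1]
  exact l.star (fun d d' e => by rw [hm, hm, e])

end
end MC

namespace MC

/-- local compatibility of labels of a dart and its reverse -/
def R0 (p : Fin 5 → ℕ) (i j : Fin 5) : Bool :=
  p j == p (i - 1) && p (j - 1) == p i

/-- refinement of a compatibility relation by following triangles and squares -/
def Rf (p : Fin 5 → ℕ) (R : Fin 5 → Fin 5 → Bool) (i j : Fin 5) : Bool :=
  R i j && R j i &&
  (p i != 3 || decide (∃ c : Fin 5, R (j - 1) (c + 1) = true ∧ R c (i + 1) = true)) &&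
  (p i != 4 || decide (∃ c e : Fin 5, R (j - 1) (c + 1) = true ∧ R c (e + 1) = true ∧ R e (i + 1) = true))

lemma pat5 : ∀ a b c d e : Fin 4, 60 / (a.val + 3) + 60 / (b.val + 3) + 60 / (c.val + 3) + 60 / (d.val + 3) + 60 / (e.val + 3) = 90 →
    ∃ n : Fin 5, (∀ i : Fin 5, (![a, b, c, d, e] (i + n)).val + 3 = (![3, 3, 3, 3, 6] : Fin 5 → ℕ) i) ∨
      (∀ i : Fin 5, (![a, b, c, d, e] (i + n)).val + 3 = (![3, 3, 3, 4, 4] : Fin 5 → ℕ) i) ∨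
      (∀ i : Fin 5, (![a, b, c, d, e] (i + n)).val + 3 = (![3, 4, 3, 4, 3] : Fin 5 → ℕ) i) := by
  decide +kernel

section
variable {T : Set (Set ℂ)} [h : Til T]

lemma k5_pat (nf : NF T) {r : D T} (hk : deg r = 5) : ∃ d0 : D T, deg d0 = 5 ∧
    ((∀ i : Fin 5, pd ((sg ^ (i : ℕ)) d0) = (![3, 3, 3, 3, 6] : Fin 5 → ℕ) i) ∨
      (∀ i : Fin 5, pd ((sg ^ (i : ℕ)) d0) = (![3, 3, 3, 4, 4] : Fin 5 → ℕ) i) ∨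
      (∀ i : Fin 5, pd ((sg ^ (i : ℕ)) d0) = (![3, 4, 3, 4, 3] : Fin 5 → ℕ) i)) := by
  have h1 := nf.euler r
  rw [hk] at h1
  have hb : ∀ n : ℕ, n < 5 → pd ((sg ^ n) r) ≤ 6 := by
    intro n hn
    rw [Finset.sum_eq_add_sum_sdiff_singleton_of_mem (Finset.mem_range.2 hn)] at h1
    have h2 := Finset.sum_le_card_nsmul (Finset.range 5 \ {n}) (fun i => 1 / (pd ((sg ^ i) r) : ℝ)) (1/3)
      (fun i _ => inv_pd _)
    rw [Finset.card_sdiff_of_subset (by simpa using hn)] at h2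
    simp only [Finset.card_range, Finset.card_singleton] at h2
    have h3 : (1:ℝ) / 6 ≤ 1 / (pd ((sg ^ n) r) : ℝ) := by norm_num at h1 h2 ⊢; linarith
    have h4 : (0:ℝ) < pd ((sg ^ n) r) := by have := pd_ge ((sg ^ n) r); exact_mod_cast (by omega)
    rw [div_le_div_iff₀ (by norm_num) h4] at h3
    have : (pd ((sg ^ n) r) : ℝ) ≤ 6 := by linarith
    exact_mod_cast this
  have hq : ∀ n : ℕ, n < 5 → ∃ a : Fin 4, pd ((sg ^ n) r) = a.val + 3 := by
    intro n hn
    have := hb n hn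
    have := pd_ge ((sg ^ n) r)
    exact ⟨⟨pd ((sg ^ n) r) - 3, by omega⟩, by simp; omega⟩
  have hr : ∀ a : Fin 4, (1:ℝ) / ((a.val + 3 : ℕ) : ℝ) = ((60 / (a.val + 3) : ℕ) : ℝ) / 60 := by
    intro a; fin_cases a <;> norm_num
  obtain ⟨a0, e0⟩ := hq 0 (by norm_num)
  obtain ⟨a1, e1⟩ := hq 1 (by norm_num)
  obtain ⟨a2, e2⟩ := hq 2 (by norm_num)
  obtain ⟨a3, e3⟩ := hq 3 (by norm_num)
  obtain ⟨a4, e4⟩ := hq 4 (by norm_num)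
  simp only [Finset.sum_range_succ, Finset.range_zero, Finset.sum_empty, e0, e1, e2, e3, e4, hr] at h1
  have h2 : 60 / (a0.val + 3) + 60 / (a1.val + 3) + 60 / (a2.val + 3) + 60 / (a3.val + 3) + 60 / (a4.val + 3) = 90 := by
    have : ((60 / (a0.val + 3) : ℕ) : ℝ) + ((60 / (a1.val + 3) : ℕ) : ℝ) + ((60 / (a2.val + 3) : ℕ) : ℝ)
      + ((60 / (a3.val + 3) : ℕ) : ℝ) + ((60 / (a4.val + 3) : ℕ) : ℝ) = 90 := by
      push_cast at h1 ⊢; linarith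
    exact_mod_cast this
  obtain ⟨n, hn⟩ := pat5 _ _ _ _ _ h2
  have hv : ∀ i : Fin 5, pd ((sg ^ (i : ℕ)) r) = (![a0, a1, a2, a3, a4] i).val + 3 := by
    intro i; fin_cases i
    · exact e0
    · exact e1
    · exact e2
    · exact e3
    · exact e4
  have hd : deg ((sg ^ (n : ℕ)) r) = 5 := (deg_const _ _).trans hk
  refine ⟨(sg ^ (n : ℕ)) r, hd, ?_⟩
  have hs : ∀ i : Fin 5, pd ((sg ^ (i : ℕ)) ((sg ^ (n : ℕ)) r)) = (![a0, a1, a2, a3, a4] (i + n)).val + 3 := by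
    intro i
    rw [← hv, ← Equiv.Perm.mul_apply, ← pow_add, Fin.val_add, sgn_mod hk]
  simp only [hs]
  exact hn

lemma k5_lab {d0 : D T} (hk : deg d0 = 5) {p : Fin 5 → ℕ}
    (hp : ∀ i : Fin 5, pd ((sg ^ (i : ℕ)) d0) = p i)
    (hu : ∀ i j : Fin 5, (∀ n, p (i + n) = p (j + n)) → i = j) :
    ∃ L : D T → Fin 5, Lab 5 L ∧ ∀ d, pd d = p (L d) := by
  obtain ⟨L, l, hL⟩ := exists_Lab (k := 5) hk (fun i j e => hu i j (fun n => by
    rw [← hp, ← hp]; exact (Eqv_shift hk n e).pd.symm))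
  refine ⟨L, l, fun d => ?_⟩
  rw [← hp (L d)]
  exact ((l.eqv _ _).1 (hL (L d))).pd

lemma R0_adm {p : Fin 5 → ℕ} {L : D T → Fin 5} (l : Lab 5 L) (hp : ∀ d, pd d = p (L d)) (d : D T) :
    R0 p (L d) (L (rv d)) = true := by
  unfold R0
  rw [← hp, ← hp, ← l.sgi, ← l.nx, ← hp, ← hp]
  simp only [Bool.and_eq_true, beq_iff_eq]
  exact ⟨pd_lt (lt_rv d), pd_lt (lt_nx d)⟩

lemma nx3 (nf : NF T) {d : D T} (hd : pd d = 3) : nx (nx (nx d)) = d := by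
  have := nx_pd nf d
  rw [hd] at this; exact this

lemma nx4 (nf : NF T) {d : D T} (hd : pd d = 4) : nx (nx (nx (nx d))) = d := by
  have := nx_pd nf d
  rw [hd] at this; exact this

lemma Lab.rv5 {L : D T → Fin 5} (l : Lab 5 L) (d : D T) : L (rv d) = L (MC.nx d) + 1 := by
  rw [l.nx, sub_add_cancel]

/-- labels around a triangle -/
lemma tri5 (nf : NF T) {L : D T → Fin 5} (l : Lab 5 L) {R : Fin 5 → Fin 5 → Bool}
    (hR : ∀ d, R (L d) (L (rv d)) = true) {d : D T} (hd : pd d = 3) :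
    R (L (nx d)) (L (nx (nx d)) + 1) = true ∧ R (L (nx (nx d))) (L d + 1) = true := by
  have h1 := hR (nx d)
  have h2 := hR (nx (nx d))
  rw [l.rv5] at h1 h2
  rw [nx3 nf hd] at h2
  exact ⟨h1, h2⟩

lemma Rf_adm (nf : NF T) {p : Fin 5 → ℕ} {L : D T → Fin 5} (l : Lab 5 L) (hp : ∀ d, pd d = p (L d))
    {R : Fin 5 → Fin 5 → Bool} (hR : ∀ d, R (L d) (L (rv d)) = true) (d : D T) :
    Rf p R (L d) (L (rv d)) = true := by
  unfold Rf
  have h2 : R (L (rv d)) (L d) = true := by have := hR (rv d); rwa [rv_rv] at this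
  simp only [hR, h2, Bool.and_self, Bool.true_and, Bool.and_eq_true, Bool.or_eq_true, bne_iff_ne,
    decide_eq_true_eq, ← l.nx, ← hp]
  constructor
  · by_cases h3 : pd d = 3
    · right; exact ⟨_, tri5 nf l hR h3⟩
    · exact Or.inl h3
  · by_cases h3 : pd d = 4
    · right
      refine ⟨L (nx (nx d)), L (nx (nx (nx d))), ?_, ?_, ?_⟩
      · rw [← l.rv5]; exact hR _
      · rw [← l.rv5]; exact hR _
      · have := hR (nx (nx (nx d)))
        rwa [l.rv5, nx4 nf h3] at this
    · exact Or.inl h3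

lemma R_star {L : D T → Fin 5} (l : Lab 5 L) {R : Fin 5 → Fin 5 → Bool}
    (hR : ∀ d, R (L d) (L (rv d)) = true) (hf : ∀ i j j', R i j = true → R i j' = true → j = j') : Star T := by
  apply l.star
  intro d d' e
  have h1 := hR d
  have h2 := hR d'
  rw [← e] at h2
  exact hf _ _ _ h1 h2

lemma dec2 : ∀ i j j', Rf ![3, 3, 3, 4, 4] (Rf ![3, 3, 3, 4, 4] (R0 ![3, 3, 3, 4, 4])) i j = true →
    Rf ![3, 3, 3, 4, 4] (Rf ![3, 3, 3, 4, 4] (R0 ![3, 3, 3, 4, 4])) i j' = true → j = j' := by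
  decide +kernel

lemma dec3 : ∀ i j j', Rf ![3, 4, 3, 4, 3] (Rf ![3, 4, 3, 4, 3] (Rf ![3, 4, 3, 4, 3]
      (Rf ![3, 4, 3, 4, 3] (R0 ![3, 4, 3, 4, 3])))) i j = true →
    Rf ![3, 4, 3, 4, 3] (Rf ![3, 4, 3, 4, 3] (Rf ![3, 4, 3, 4, 3]
      (Rf ![3, 4, 3, 4, 3] (R0 ![3, 4, 3, 4, 3])))) i j' = true → j = j' := by
  decide +kernel

/-- the possible transitions for the snub trihexagonal type -/
def R6 (i j : Fin 5) : Bool :=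
  ![![false, false, false, false, true], ![false, true, true, false, false],
    ![false, true, false, true, false], ![false, false, true, true, false],
    ![true, false, false, false, false]] i j

lemma dec1 : ∀ i j, Rf ![3, 3, 3, 3, 6] (Rf ![3, 3, 3, 3, 6] (Rf ![3, 3, 3, 3, 6]
    (R0 ![3, 3, 3, 3, 6]))) i j = true → R6 i j = true := by
  decide +kernel

lemma snub (nf : NF T) (hk : ∀ d : D T, deg d = 5) {L : D T → Fin 5} (l : Lab 5 L) (hp : ∀ d, pd d = (![3, 3, 3, 3, 6] : Fin 5 → ℕ) (L d)) :
    Star T := by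
  have hR : ∀ d, R6 (L d) (L (rv d)) = true := fun d =>
    dec1 _ _ (Rf_adm nf l hp (Rf_adm nf l hp (Rf_adm nf l hp (R0_adm l hp))) d)
  have htri : ∀ d, L d ≠ 4 → pd d = 3 := by
    intro d; rw [hp]; generalize L d = i; revert i; decide
  -- labels around a triangle
  have key : ∀ d, L d ≠ 4 → ∃ c, L (rv (sg d)) = c ∧ R6 (L d) (L (rv d)) = true ∧
      R6 (L (rv d) - 1) (c + 1) = true ∧ R6 c (L d + 1) = true := by
    intro d hd
    have h3 := htri d hd
    have e : rv (sg d) = nx (nx d) := by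
      rw [sg_apply, rv_rv]
      rw [Equiv.Perm.inv_eq_iff_eq]
      exact (nx3 nf h3).symm
    refine ⟨L (rv (sg d)), rfl, hR d, ?_⟩
    rw [e, ← l.nx]
    exact tri5 nf l hR h3
  have k2 : ∀ d, L d = 2 → (L (rv d) = 1 ↔ L (rv (sg d)) = 3) := by
    intro d hd
    obtain ⟨c, hc, h1, h2, h3⟩ := key d (by rw [hd]; decide)
    rw [hc]; rw [hd] at h1 h3
    generalize L (rv d) = m at *
    clear hc hd; revert c m; decide
  have k1 : ∀ d, L d = 1 → (L (rv d) = 2 ↔ L (rv (sg d)) = 1) := by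
    intro d hd
    obtain ⟨c, hc, h1, h2, h3⟩ := key d (by rw [hd]; decide)
    rw [hc]; rw [hd] at h1 h3
    generalize L (rv d) = m at *
    clear hc hd; revert c m; decide
  have uniq : ∀ d e : D T, src d = src e → L d = L e → d = e := by
    intro d e he hl
    obtain ⟨n, hn, e1⟩ := exists_sgn he
    rw [hk] at hn
    by_cases n0 : n = 0
    · rw [n0] at e1; exact e1
    exfalso
    rw [← e1] at hl
    clear e1
    interval_cases n
    · exact n0 rfl
    all_goals
      simp only [pow_succ', Equiv.Perm.mul_apply, pow_zero, mul_one, l.sg] at hl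
      revert hl; generalize L d = i; revert i; decide
  let A : ℂ → Prop := fun x => ∃ e : D T, src e = x ∧ L e = 2 ∧ L (rv e) = 1
  have A2 : ∀ d, L d = 2 → (A (src d) ↔ L (rv d) = 1) := by
    intro d hd
    constructor
    · rintro ⟨e, h1, h2, h3⟩
      rw [uniq d e h1.symm (hd.trans h2.symm)]; exact h3
    · intro h1; exact ⟨d, rfl, hd, h1⟩
  have A3 : ∀ d, L d = 3 → (A (src d) ↔ L (rv d) = 3) := by
    intro d hd
    have h1 : L (sg⁻¹ d) = 2 := by rw [l.sgi, hd]; decide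
    rw [← src_sgi, A2 _ h1, k2 _ h1, show sg (sg⁻¹ d) = d by simp]
  have A1 : ∀ d, L d = 1 → (A (src d) ↔ L (rv d) = 2) := by
    intro d hd
    have h1 : L (sg d) = 2 := by rw [l.sg, hd]; decide
    rw [← src_sg, A2 _ h1, k1 _ hd]
  have tr0 : ∀ d, L d = 0 → (A (src d) ↔ A (tgt d)) := by
    intro d hd
    have h1 : L (sg d) = 1 := by rw [l.sg, hd]; decide
    have h4 : L (rv d) = 4 := by
      have := hR d; rw [hd] at this; revert this; generalize L (rv d) = m; revert m; decide
    have h5 : L (nx d) = 3 := by rw [l.nx, h4]; decide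
    rw [← src_nx, A3 _ h5, ← src_sg, A1 _ h1]
    have e : rv (sg d) = nx (nx d) := by
      rw [sg_apply, rv_rv]
      rw [Equiv.Perm.inv_eq_iff_eq]
      exact (nx3 nf (htri d (by rw [hd]; decide))).symm
    rw [e, l.nx]
    generalize L (rv (nx d)) = m
    revert m; decide
  have tr : ∀ d : D T, (A (src d) ↔ A (tgt d)) := by
    intro d
    have h1 := hR d
    have c0 : L d = 0 ∨ L d = 1 ∨ L d = 2 ∨ L d = 3 ∨ L d = 4 := by generalize L d = i; revert i; decide
    rcases c0 with h0 | h0 | h0 | h0 | h0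
    · exact tr0 d h0
    · have c1 : L (rv d) = 1 ∨ L (rv d) = 2 := by
        rw [h0] at h1; revert h1; generalize L (rv d) = m; revert m; decide
      rw [A1 d h0, ← src_rv]
      rcases c1 with c | c
      · rw [A1 _ c, rv_rv, c, h0]
      · rw [A2 _ c, rv_rv, c, h0]; decide
    · have c1 : L (rv d) = 1 ∨ L (rv d) = 3 := by
        rw [h0] at h1; revert h1; generalize L (rv d) = m; revert m; decide
      rw [A2 d h0, ← src_rv]
      rcases c1 with c | c
      · rw [A1 _ c, rv_rv, c, h0]; decide
      · rw [A3 _ c, rv_rv, c, h0]; decide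
    · have c1 : L (rv d) = 2 ∨ L (rv d) = 3 := by
        rw [h0] at h1; revert h1; generalize L (rv d) = m; revert m; decide
      rw [A3 d h0, ← src_rv]
      rcases c1 with c | c
      · rw [A2 _ c, rv_rv, c, h0]; decide
      · rw [A3 _ c, rv_rv, c, h0]
    · have c : L (rv d) = 0 := by
        rw [h0] at h1; revert h1; generalize L (rv d) = m; revert m; decide
      have := tr0 _ c
      rw [src_rv, tgt_rv] at this
      exact this.symm
  have all : ∀ d d' : D T, (A (src d) ↔ A (src d')) := by
    intro d d'
    have := conn (T := T) {x | A (src d) ↔ A x} ⟨src d, (spec d).hx, Iff.rfl⟩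
      (fun e he => Iff.trans he (tr e)) (src d') (spec d').hx
    exact this
  apply l.star
  intro d d' e
  have h1 := hR d
  have h2 := hR d'
  have h3 := all d d'
  rw [← e] at h2
  have c0 : L d = 0 ∨ L d = 1 ∨ L d = 2 ∨ L d = 3 ∨ L d = 4 := by generalize L d = i; revert i; decide
  rcases c0 with h0 | h0 | h0 | h0 | h0
  · rw [h0] at h1 h2; revert h1 h2; clear h3; generalize L (rv d) = m; generalize L (rv d') = m'; revert m m'; decide
  · rw [A1 d h0, A1 d' (e ▸ h0)] at h3
    rw [h0] at h1 h2; revert h1 h2 h3; generalize L (rv d) = m; generalize L (rv d') = m'; revert m m'; decide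
  · rw [A2 d h0, A2 d' (e ▸ h0)] at h3
    rw [h0] at h1 h2; revert h1 h2 h3; generalize L (rv d) = m; generalize L (rv d') = m'; revert m m'; decide
  · rw [A3 d h0, A3 d' (e ▸ h0)] at h3
    rw [h0] at h1 h2; revert h1 h2 h3; generalize L (rv d) = m; generalize L (rv d') = m'; revert m m'; decide
  · rw [h0] at h1 h2; revert h1 h2; clear h3; generalize L (rv d) = m; generalize L (rv d') = m'; revert m m'; decide

theorem k5 (nf : NF T) {r : D T} (hk : deg r = 5) : Star T := by
  obtain ⟨d0, h0, hp | hp | hp⟩ := k5_pat nf hk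
  · obtain ⟨L, l, hL⟩ := k5_lab h0 hp (by decide)
    exact snub nf (fun d => (deg_const _ _).trans h0) l hL
  · obtain ⟨L, l, hL⟩ := k5_lab h0 hp (by decide)
    exact R_star l (Rf_adm nf l hL (Rf_adm nf l hL (R0_adm l hL))) dec2
  · obtain ⟨L, l, hL⟩ := k5_lab h0 hp (by decide)
    exact R_star l (Rf_adm nf l hL (Rf_adm nf l hL (Rf_adm nf l hL (Rf_adm nf l hL (R0_adm l hL))))) dec3

end
end MC

namespace MC

/-- fast successor -/
def su (i : Fin 6) : Fin 6 := match i with | 0 => 1 | 1 => 2 | 2 => 3 | 3 => 4 | 4 => 5 | 5 => 0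
/-- fast predecessor -/
def pr (i : Fin 6) : Fin 6 := match i with | 0 => 5 | 1 => 0 | 2 => 1 | 3 => 2 | 4 => 3 | 5 => 4
/-- fast vectors -/
def v6 (a b c d e f : Fin 3) (i : Fin 6) : Fin 3 := match i with | 0 => a | 1 => b | 2 => c | 3 => d | 4 => e | 5 => f
/-- bounded existence -/
def ex6 (p : Fin 6 → Bool) : Bool := p 0 || p 1 || p 2 || p 3 || p 4 || p 5
/-- bounded universal quantifier -/
def all6 (p : Fin 6 → Bool) : Bool := p 0 && p 1 && p 2 && p 3 && p 4 && p 5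
/-- fast equality test -/
def e3 (a b : Fin 3) : Bool := Nat.beq a.val b.val
/-- bounded universal quantifier -/
def all3 (p : Fin 3 → Bool) : Bool := p 0 && p 1 && p 2

lemma su_eq : ∀ i, su i = i + 1 := by decide
lemma pr_eq : ∀ i, pr i = i - 1 := by decide
lemma e3_iff : ∀ a b, e3 a b = true ↔ a = b := by decide

lemma ex6_iff (p : Fin 6 → Bool) : ex6 p = true ↔ ∃ i, p i = true := by
  constructor
  · unfold ex6; simp only [Bool.or_eq_true]
    rintro (((((a | a) | a) | a) | a) | a) <;> exact ⟨_, a⟩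
  · rintro ⟨i, hi⟩
    unfold ex6; simp only [Bool.or_eq_true]
    fin_cases i <;> simp_all

lemma all6_iff (p : Fin 6 → Bool) : all6 p = true ↔ ∀ i, p i = true := by
  constructor
  · unfold all6; simp only [Bool.and_eq_true]
    rintro ⟨⟨⟨⟨⟨a, b⟩, c⟩, d⟩, e⟩, f⟩ i
    fin_cases i <;> assumption
  · intro h
    unfold all6; simp only [h, Bool.and_self]

lemma all3_iff (p : Fin 3 → Bool) : all3 p = true ↔ ∀ i, p i = true := by
  constructor
  · unfold all3; simp only [Bool.and_eq_true]
    rintro ⟨⟨a, b⟩, c⟩ i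
    fin_cases i <;> assumption
  · intro h
    unfold all3; simp only [h, Bool.and_self]

/-- compatibility of edge lengths -/
def G0 (l c : Fin 6 → Fin 3) (i j : Fin 6) : Bool :=
  e3 (l j) (l i) && e3 (l (pr j)) (c i) && e3 (c (pr j)) (l (su i))

/-- symmetrization and closure under following a triangle -/
def Gf (R : Fin 6 → Fin 6 → Bool) (i j : Fin 6) : Bool :=
  R i j && R j i && ex6 fun m => R (pr j) m && R (pr m) (su i)

/-- the combinatorial claim for a shift, computably -/
def C6 (t : Fin 6) (s : Fin 6 → Fin 6) (l c : Fin 6 → Fin 3) : Bool :=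
  !(ex6 fun j => G0 l c j 0 && G0 l c j t && Gf (Gf (Gf (G0 l c))) j 0 && Gf (Gf (Gf (G0 l c))) j t) ||
  !(all6 fun i => ex6 fun j => G0 l c i j && Gf (G0 l c) i j) ||
  all6 fun i => e3 (l (s i)) (l i) && e3 (c (s i)) (c i)

/-- the combinatorial claim for a shift -/
def Claim6 (t : Fin 6) (l c : Fin 6 → Fin 3) : Prop :=
  (∃ j : Fin 6, G0 l c j 0 = true ∧ G0 l c j t = true ∧
    Gf (Gf (Gf (G0 l c))) j 0 = true ∧ Gf (Gf (Gf (G0 l c))) j t = true) →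
  (∀ i, ∃ j, G0 l c i j = true ∧ Gf (G0 l c) i j = true) → ∀ i, l (i + t) = l i ∧ c (i + t) = c i

lemma claim_of {t : Fin 6} {s : Fin 6 → Fin 6} (hs : ∀ i, s i = i + t) {l c : Fin 6 → Fin 3}
    (hc : C6 t s l c = true) : Claim6 t l c := by
  intro h1 h2
  unfold C6 at hc
  rw [Bool.or_eq_true, Bool.or_eq_true] at hc
  rcases hc with (hc | hc) | hc
  · exfalso
    rw [Bool.not_eq_true', ← Bool.not_eq_true, ex6_iff] at hc
    apply hc
    obtain ⟨j, a, b, c, d⟩ := h1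
    exact ⟨j, by simp only [a, b, c, d, Bool.and_self]⟩
  · exfalso
    rw [Bool.not_eq_true', ← Bool.not_eq_true, all6_iff] at hc
    apply hc
    intro i
    obtain ⟨j, a, b⟩ := h2 i
    exact (ex6_iff _).2 ⟨j, by simp only [a, b, Bool.and_self]⟩
  · rw [all6_iff] at hc
    intro i
    have := hc i
    rwa [Bool.and_eq_true, e3_iff, e3_iff, hs] at this

lemma comp61 : (all3 fun x => all3 fun y => all3 fun a => all3 fun b => all3 fun e => all3 fun f =>
    C6 1 su (v6 0 0 0 x y 0) (v6 a a b e f a)) = true := by decide +kernel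
lemma comp62 : (all3 fun x => all3 fun y => all3 fun a => all3 fun b => all3 fun e => all3 fun f =>
    C6 2 (fun i => su (su i)) (v6 x 0 x 0 y 0) (v6 a b a e f b)) = true := by decide +kernel
lemma comp63 : (all3 fun x => all3 fun y => all3 fun a => all3 fun b => all3 fun e => all3 fun f =>
    C6 3 (fun i => su (su (su i))) (v6 x y 0 x y 0) (v6 a b e a f e)) = true := by decide +kernel

lemma dec61 (x y a b e f : Fin 3) : Claim6 1 (v6 0 0 0 x y 0) (v6 a a b e f a) := by
  have := comp61
  simp only [all3_iff] at this
  exact claim_of su_eq (this x y a b e f)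
lemma dec62 (x y a b e f : Fin 3) : Claim6 2 (v6 x 0 x 0 y 0) (v6 a b a e f b) := by
  have := comp62
  simp only [all3_iff] at this
  exact claim_of (by decide) (this x y a b e f)
lemma dec63 (x y a b e f : Fin 3) : Claim6 3 (v6 x y 0 x y 0) (v6 a b e a f e) := by
  have := comp63
  simp only [all3_iff] at this
  exact claim_of (by decide) (this x y a b e f)

lemma sss {u w u' w' : ℂ} (hu : u ≠ 0) (hu' : u' ≠ 0) (h1 : ‖u'‖ = ‖u‖) (h2 : ‖w'‖ = ‖w‖)
    (h3 : ‖w' - u'‖ = ‖w - u‖) (p : 0 < (w / u).im) (p' : 0 < (w' / u').im) : w' / u' = w / u := by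
  have e1 : ‖w' / u'‖ = ‖w / u‖ := by rw [norm_div, norm_div, h1, h2]
  have e2 : ‖w' / u' - 1‖ = ‖w / u - 1‖ := by
    rw [show w' / u' - 1 = (w' - u') / u' by field_simp, show w / u - 1 = (w - u) / u by field_simp,
      norm_div, norm_div, h1, h3]
  generalize w' / u' = q' at *
  generalize w / u = q at *
  have f1 : ‖q'‖ ^ 2 = ‖q‖ ^ 2 := by rw [e1]
  have f2 : ‖q' - 1‖ ^ 2 = ‖q - 1‖ ^ 2 := by rw [e2]
  rw [Complex.sq_norm, Complex.sq_norm, Complex.normSq_apply, Complex.normSq_apply] at f1 f2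
  simp only [Complex.sub_re, Complex.one_re, Complex.sub_im, Complex.one_im, sub_zero] at f2
  have g1 : q'.re = q.re := by nlinarith
  rw [g1] at f1
  have g2 : q'.im = q.im := by nlinarith
  exact Complex.ext g1 g2

section
variable {T : Set (Set ℂ)} [h : Til T]

lemma k6_pd (nf : NF T) (hk : ∀ d : D T, deg d = 6) (r : D T) : pd r = 3 := by
  have h1 := nf.euler r
  rw [hk, Finset.sum_eq_add_sum_sdiff_singleton_of_mem (Finset.mem_range.2 (show 0 < 6 by norm_num))] at h1
  have h2 := Finset.sum_le_card_nsmul (Finset.range 6 \ {0}) (fun i => 1 / (pd ((sg ^ i) r) : ℝ)) (1/3)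
      (fun i _ => inv_pd _)
  rw [Finset.card_sdiff_of_subset (by simp)] at h2
  simp only [Finset.card_range, Finset.card_singleton] at h2
  have h3 : (1:ℝ) / 3 ≤ 1 / (pd r : ℝ) := by norm_num at h1 h2 ⊢; linarith
  have h4 : (0:ℝ) < pd r := by have := pd_ge r; exact_mod_cast (by omega)
  rw [div_le_div_iff₀ (by norm_num) h4] at h3
  have h5 : (pd r : ℝ) ≤ 3 := by linarith
  have h6 : pd r ≤ 3 := by exact_mod_cast h5
  have := pd_ge r
  omega

lemma sg_im (nf : NF T) (d : D T) : 0 < (vec (sg d) / vec d).im := by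
  have h1 := ang_pos d
  have h2 := lt_of_le_of_ne (ang_le d) (nf d)
  have h0 : vec (sg d) / vec d ≠ 0 := div_ne_zero (vec_ne _) (vec_ne _)
  have h3 : 0 < Real.sin (Complex.arg (vec (sg d) / vec d)) := Real.sin_pos_of_pos_of_lt_pi h1 h2
  rw [Complex.sin_arg] at h3
  by_contra hh
  push Not at hh
  have := div_nonpos_of_nonpos_of_nonneg hh (norm_nonneg (vec (sg d) / vec d))
  linarith

lemma nxx (nf : NF T) {d : D T} (h3 : pd d = 3) : nx (nx d) = rv (sg d) := by
  rw [sg_apply, rv_rv]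
  symm
  rw [Equiv.Perm.inv_eq_iff_eq]
  exact (nx3 nf h3).symm

lemma vec_nx3 (nf : NF T) {d : D T} (h3 : pd d = 3) : vec (nx d) = vec (sg d) - vec d := by
  have h1 : src (nx d) = tgt d := src_nx d
  have h2 : tgt (nx d) = tgt (sg d) := by rw [← src_nx, nxx nf h3, src_rv]
  unfold vec
  rw [h1, h2, src_sg]; ring

lemma tri_tc (nf : NF T) (hp : ∀ d : D T, pd d = 3) {c : ℂ} (hc : ‖c‖ = 1) {d d' : D T}
    (h1 : vec d' = c * vec d) (h2 : vec (sg d') = c * vec (sg d)) : Tc c d d' := by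
  apply tile_of_vecs hc
  have e1 : vec (nx d') = c * vec (nx d) := by rw [vec_nx3 nf (hp _), vec_nx3 nf (hp _), h1, h2]; ring
  have e2 : vec (nx (nx d')) = c * vec (nx (nx d)) := by
    rw [nxx nf (hp _), nxx nf (hp _), vec_rv, vec_rv, h2]; ring
  have key : ∀ n : ℕ, vec ((nx ^ n) d') = c * vec ((nx ^ n) d) ∧ vec ((nx ^ (n + 1)) d') = c * vec ((nx ^ (n + 1)) d) ∧
      vec ((nx ^ (n + 2)) d') = c * vec ((nx ^ (n + 2)) d) := by
    intro n
    induction n with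
    | zero => exact ⟨h1, by simpa using e1, e2⟩
    | succ n ih =>
      refine ⟨ih.2.1, ih.2.2, ?_⟩
      have : ∀ d : D T, (nx ^ (n + 1 + 2)) d = (nx ^ n) d := by
        intro d
        rw [show n + 1 + 2 = n + 3 by ring, pow_add, Equiv.Perm.mul_apply]
        congr 1
        exact nx3 nf (hp d)
      rw [this, this]; exact ih.1
  exact fun n => (key n).1

/-- the relation on classes at a base dart -/
def M6 (d0 : D T) (i j : Fin 6) : Prop :=
  ∃ d : D T, Eqv ((sg ^ (i : ℕ)) d0) d ∧ Eqv ((sg ^ (j : ℕ)) d0) (rv d)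

lemma M6.symm {d0 : D T} {i j : Fin 6} (m : M6 d0 i j) : M6 d0 j i := by
  obtain ⟨d, h1, h2⟩ := m
  exact ⟨rv d, h2, by rwa [rv_rv]⟩

lemma sgn_sub_one {k : ℕ} [NeZero k] {d : D T} (hk : deg d = k) (i : Fin k) :
    (sg ^ ((i - 1 : Fin k) : ℕ)) d = sg⁻¹ ((sg ^ (i : ℕ)) d) := by
  have := sgn_add_one hk (i - 1)
  rw [sub_add_cancel] at this
  rw [this]; simp

lemma Eqv.nxlen (nf : NF T) {d d' : D T} (e : Eqv d d') : ‖vec (nx d')‖ = ‖vec (nx d)‖ := by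
  obtain ⟨a, ha⟩ := e.hc
  rw [(ha.2.1.nx nf).vec nf, norm_mul, ha.2.1.1, one_mul]

lemma M6.nx {d0 : D T} (hk : deg d0 = 6) {j : Fin 6} {d : D T}
    (h2 : Eqv ((sg ^ (j : ℕ)) d0) (rv d)) : Eqv ((sg ^ ((j - 1 : Fin 6) : ℕ)) d0) (MC.nx d) := by
  rw [sgn_sub_one hk, nx_eq]; exact h2.sgi

lemma M6.len (nf : NF T) (hp : ∀ d : D T, pd d = 3) {d0 : D T} (hk : deg d0 = 6) {i j : Fin 6} (m : M6 d0 i j) :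
    ‖vec ((sg ^ (j : ℕ)) d0)‖ = ‖vec ((sg ^ (i : ℕ)) d0)‖ ∧
    ‖vec ((sg ^ ((j - 1 : Fin 6) : ℕ)) d0)‖ = ‖vec (MC.nx ((sg ^ (i : ℕ)) d0))‖ ∧
    ‖vec (MC.nx ((sg ^ ((j - 1 : Fin 6) : ℕ)) d0))‖ = ‖vec ((sg ^ ((i + 1 : Fin 6) : ℕ)) d0)‖ := by
  obtain ⟨d, h1, h2⟩ := m
  have h3 := M6.nx hk h2
  refine ⟨?_, ?_, ?_⟩
  · rw [← h1.len, ← h2.len, vec_rv, norm_neg]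
  · rw [← h3.len, h1.nxlen nf]
  · rw [← h3.nxlen nf, nxx nf (hp _), vec_rv, norm_neg, sgn_add_one hk, h1.sg.len]

lemma M6.tri (nf : NF T) (hp : ∀ d : D T, pd d = 3) {d0 : D T} (hk : deg d0 = 6) {i j : Fin 6} (m : M6 d0 i j) :
    ∃ n, M6 d0 (j - 1) n ∧ M6 d0 (n - 1) (i + 1) := by
  obtain ⟨d, h1, h2⟩ := m
  have h3 := M6.nx hk h2
  obtain ⟨n, hn⟩ := exists_lb (k := 6) hk (rv (MC.nx d))
  have h4 := M6.nx hk hn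
  refine ⟨n, ⟨_, h3, hn⟩, _, h4, ?_⟩
  rw [nxx nf (hp _), rv_rv, sgn_add_one hk]
  exact h1.sg

lemma M6.gf (nf : NF T) (hp : ∀ d : D T, pd d = 3) {d0 : D T} (hk : deg d0 = 6) {R : Fin 6 → Fin 6 → Bool}
    (hR : ∀ i j, M6 d0 i j → R i j = true) (i j : Fin 6) (m : M6 d0 i j) : Gf R i j = true := by
  unfold Gf
  obtain ⟨n, h1, h2⟩ := m.tri nf hp hk
  simp only [hR _ _ m, hR _ _ m.symm, Bool.and_self, Bool.true_and, ex6_iff, pr_eq, su_eq]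
  exact ⟨n, by rw [hR _ _ h1, hR _ _ h2]; rfl⟩

lemma code3 (x y z : ℝ) : ∃ f : ℝ → Fin 3, f x = 0 ∧ ∀ u v, (u = x ∨ u = y ∨ u = z) → (v = x ∨ v = y ∨ v = z) →
    f u = f v → u = v := by
  classical
  refine ⟨fun u => if u = x then 0 else if u = y then 1 else 2, by simp, ?_⟩
  intro u v hu hv huv
  dsimp only at huv
  split_ifs at huv with a1 a2 a3 a4 a5 a6 a7 a8 <;> simp_all

/-- if the lengths are invariant under the shift, so is the corona -/
lemma k6_inv (nf : NF T) (hk : ∀ d : D T, deg d = 6) {c : ℂ} {r s : D T} (e : Hc c r s)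
    (h1 : ∀ n : ℕ, ‖vec ((sg ^ n) s)‖ = ‖vec ((sg ^ n) r)‖)
    (h2 : ∀ n : ℕ, ‖vec (nx ((sg ^ n) s))‖ = ‖vec (nx ((sg ^ n) r))‖) : Eqv r s := by
  have hp := k6_pd nf hk
  have hv : ∀ n : ℕ, vec ((sg ^ n) s) = c * vec ((sg ^ n) r) := by
    intro n
    induction n with
    | zero => exact e.1
    | succ n ih =>
      have a1 := h1 (n + 1)
      have a2 := h2 n
      rw [vec_nx3 nf (hp _), vec_nx3 nf (hp _)] at a2
      rw [pow_succ', Equiv.Perm.mul_apply, Equiv.Perm.mul_apply] at a1 ⊢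
      have := sss (vec_ne _) (vec_ne _) (h1 n) a1 a2 (sg_im nf _) (sg_im nf _)
      have v1 := vec_ne ((sg ^ n) s)
      have v2 := vec_ne ((sg ^ n) r)
      rw [div_eq_div_iff v1 v2, ih] at this
      apply mul_right_cancel₀ v2
      rw [this]; ring
  apply Eqv_of e.1
  intro n _
  apply tri_tc nf hp e.2.1.1 (hv n)
  have := hv (n + 1)
  rwa [pow_succ', Equiv.Perm.mul_apply, Equiv.Perm.mul_apply] at this

theorem k6 (nf : NF T) (hk : ∀ d : D T, deg d = 6) {c : ℂ} {r d d' : D T} {t : Fin 6} (ht : t = 1 ∨ t = 2 ∨ t = 3)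
    (e : Hc c r ((sg ^ (t : ℕ)) r)) (hd : Eqv d d') (hr : Eqv r (rv d)) (hs : Eqv (rv d') ((sg ^ (t : ℕ)) r)) :
    Eqv r ((sg ^ (t : ℕ)) r) := by
  have hp := k6_pd nf hk
  obtain ⟨l, hl⟩ : ∃ l : Fin 6 → ℝ, ∀ i, l i = ‖vec ((sg ^ (i : ℕ)) r)‖ := ⟨_, fun _ => rfl⟩
  obtain ⟨m, hm⟩ : ∃ m : Fin 6 → ℝ, ∀ i, m i = ‖vec (nx ((sg ^ (i : ℕ)) r))‖ := ⟨_, fun _ => rfl⟩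
  have tot : ∀ i, ∃ j, M6 r i j := by
    intro i
    obtain ⟨j, hj⟩ := exists_lb (k := 6) (hk r) (rv ((sg ^ (i : ℕ)) r))
    exact ⟨j, _, Eqv.refl _, hj⟩
  have hj : ∃ j, M6 r j 0 ∧ M6 r j t := by
    obtain ⟨j, hj⟩ := exists_lb (k := 6) (hk r) d
    exact ⟨j, ⟨d, hj, hr⟩, d', hj.trans hd, hs.symm⟩
  have hadm : ∀ i j, M6 r i j → l j = l i ∧ l (j - 1) = m i ∧ m (j - 1) = l (i + 1) := by
    intro i j hij
    rw [hl, hl, hl, hl, hm, hm]; exact hij.len nf hp (hk r)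
  have c1 : l t = l 0 := by
    rw [hl, hl, e.1, norm_mul, e.2.1.1, one_mul]; rfl
  have c2 : l (t + 1) = l 1 := by
    rw [hl, hl, sgn_add_one (hk r), e.2.1.sg nf, norm_mul, e.2.1.1, one_mul]; rfl
  have c3 : m t = m 0 := by
    rw [hm, hm, (e.2.1.nx nf).vec nf, norm_mul, e.2.1.1, one_mul]; rfl
  have e5 : (sg ^ ((5 : Fin 6) : ℕ)) r = sg⁻¹ r := by
    have := sgn_sub_one (hk r) 0
    exact this
  have c4 : l (t - 1) = l 5 := by
    rw [hl, hl, sgn_sub_one (hk r), e5, e.2.2.vec nf, norm_mul, e.2.1.1, one_mul]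
  have c5 : m (t - 1) = m 5 := by
    rw [hm, hm, sgn_sub_one (hk r), e5, (e.2.2.nx nf).vec nf, norm_mul, e.2.1.1, one_mul]
  -- reduce to invariance of lengths
  suffices hinv : ∀ i, l (i + t) = l i ∧ m (i + t) = m i by
    have cv : ∀ n : ℕ, (sg ^ n) r = (sg ^ ((Fin.ofNat 6 n : Fin 6) : ℕ)) r ∧
        (sg ^ n) ((sg ^ (t : ℕ)) r) = (sg ^ ((Fin.ofNat 6 n + t : Fin 6) : ℕ)) r := by
      intro n
      constructor
      · exact (sgn_mod (hk r) n).symm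
      · rw [Fin.val_add, sgn_mod (hk r), pow_add, Equiv.Perm.mul_apply]
        rw [← Equiv.Perm.mul_apply, ← Equiv.Perm.mul_apply, ← pow_add, ← pow_add,
          ← sgn_mod (hk r), ← sgn_mod (hk r) (_ + _)]
        congr 2
        simp [Fin.ofNat]
    apply k6_inv nf hk e
    · intro n; rw [(cv n).1, (cv n).2, ← hl, ← hl]; exact (hinv _).1
    · intro n; rw [(cv n).1, (cv n).2, ← hm, ← hm]; exact (hinv _).2
  -- coding
  suffices hcode : ∃ f : ℝ → Fin 3, Claim6 t (f ∘ l) (f ∘ m) ∧ ∀ i j, f (l i) = f (l j) → l i = l j by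
    obtain ⟨f, hc, hf⟩ := hcode
    have g0 : ∀ i j, M6 r i j → G0 (f ∘ l) (f ∘ m) i j = true := by
      intro i j hij
      obtain ⟨h1, h2, h3⟩ := hadm i j hij
      unfold G0
      simp only [Bool.and_eq_true, e3_iff, pr_eq, su_eq, Function.comp_apply, h1, h2, h3, and_self]
    have g1 := M6.gf nf hp (hk r) g0
    have g3 := M6.gf nf hp (hk r) (M6.gf nf hp (hk r) g1)
    obtain ⟨j, j1, j2⟩ := hj
    have := hc ⟨j, g0 _ _ j1, g0 _ _ j2, g3 _ _ j1, g3 _ _ j2⟩ (fun i => by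
      obtain ⟨j, hj⟩ := tot i
      exact ⟨j, g0 _ _ hj, g1 _ _ hj⟩)
    intro i
    obtain ⟨h1, h2⟩ := this i
    refine ⟨hf _ _ h1, ?_⟩
    obtain ⟨a, ha⟩ := tot i
    obtain ⟨b, hb⟩ := tot (i + t)
    have ha := (hadm _ _ ha).2.1
    have hb := (hadm _ _ hb).2.1
    change f _ = f _ at h2
    rw [← ha, ← hb] at h2 ⊢
    exact hf _ _ h2
  rcases ht with rfl | rfl | rfl
  · change l 2 = l 1 at c2
    change l 0 = l 5 at c4
    change m 0 = m 5 at c5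
    obtain ⟨f, f0, hf⟩ := code3 (l 5) (l 3) (l 4)
    have hv : ∀ i, l i = l 5 ∨ l i = l 3 ∨ l i = l 4 := by
      intro i; fin_cases i
      · left; exact c4
      · left; exact c1.trans c4
      · left; exact c2.trans (c1.trans c4)
      · right; left; rfl
      · right; right; rfl
      · left; rfl
    refine ⟨f, ?_, fun i j hij => hf _ _ (hv i) (hv j) hij⟩
    have q1 : f ∘ l = v6 0 0 0 (f (l 3)) (f (l 4)) 0 := by
      funext i; fin_cases i
      · change f (l 0) = 0; rw [c4, f0]
      · change f (l 1) = 0; rw [c1, c4, f0]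
      · change f (l 2) = 0; rw [c2, c1, c4, f0]
      · rfl
      · rfl
      · exact f0
    have q2 : f ∘ m = v6 (f (m 0)) (f (m 0)) (f (m 2)) (f (m 3)) (f (m 4)) (f (m 0)) := by
      funext i; fin_cases i
      · rfl
      · change f (m 1) = _; rw [c3]; rfl
      · rfl
      · rfl
      · rfl
      · change f (m 5) = _; rw [← c5]; rfl
    rw [q1, q2]; exact dec61 _ _ _ _ _ _
  · change l 3 = l 1 at c2
    change l 1 = l 5 at c4
    change m 1 = m 5 at c5
    obtain ⟨f, f0, hf⟩ := code3 (l 5) (l 0) (l 4)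
    have hv : ∀ i, l i = l 5 ∨ l i = l 0 ∨ l i = l 4 := by
      intro i; fin_cases i
      · right; left; rfl
      · left; exact c4
      · right; left; exact c1
      · left; exact c2.trans c4
      · right; right; rfl
      · left; rfl
    refine ⟨f, ?_, fun i j hij => hf _ _ (hv i) (hv j) hij⟩
    have q1 : f ∘ l = v6 (f (l 0)) 0 (f (l 0)) 0 (f (l 4)) 0 := by
      funext i; fin_cases i
      · rfl
      · change f (l 1) = 0; rw [c4, f0]
      · change f (l 2) = _; rw [c1]; rfl
      · change f (l 3) = _; rw [c2, c4, f0]; rfl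
      · rfl
      · exact f0
    have q2 : f ∘ m = v6 (f (m 0)) (f (m 1)) (f (m 0)) (f (m 3)) (f (m 4)) (f (m 1)) := by
      funext i; fin_cases i
      · rfl
      · rfl
      · change f (m 2) = _; rw [c3]; rfl
      · rfl
      · rfl
      · change f (m 5) = _; rw [← c5]; rfl
    rw [q1, q2]; exact dec62 _ _ _ _ _ _
  · change l 4 = l 1 at c2
    change l 2 = l 5 at c4
    change m 2 = m 5 at c5
    obtain ⟨f, f0, hf⟩ := code3 (l 5) (l 0) (l 1)
    have hv : ∀ i, l i = l 5 ∨ l i = l 0 ∨ l i = l 1 := by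
      intro i; fin_cases i
      · right; left; rfl
      · right; right; rfl
      · left; exact c4
      · right; left; exact c1
      · right; right; exact c2
      · left; rfl
    refine ⟨f, ?_, fun i j hij => hf _ _ (hv i) (hv j) hij⟩
    have q1 : f ∘ l = v6 (f (l 0)) (f (l 1)) 0 (f (l 0)) (f (l 1)) 0 := by
      funext i; fin_cases i
      · rfl
      · rfl
      · change f (l 2) = 0; rw [c4, f0]
      · change f (l 3) = _; rw [c1]; rfl
      · change f (l 4) = _; rw [c2]; rfl
      · exact f0
    have q2 : f ∘ m = v6 (f (m 0)) (f (m 1)) (f (m 2)) (f (m 0)) (f (m 4)) (f (m 2)) := by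
      funext i; fin_cases i
      · rfl
      · rfl
      · rfl
      · change f (m 3) = _; rw [c3]; rfl
      · rfl
      · change f (m 5) = _; rw [← c5]; rfl
    rw [q1, q2]; exact dec63 _ _ _ _ _ _

end
end MC

namespace MC
section
variable {T : Set (Set ℂ)} [h : Til T]

theorem star_T : Star T := by
  by_contra hs
  obtain ⟨d, d', r, s, c, h1, h2, h3, h4, h5, h6⟩ := not_star hs
  obtain ⟨t, ht, e⟩ := exists_sgn h4
  have dc : ∀ e : D T, deg e = deg r := fun e => deg_const _ _
  -- the inverse rotation
  have inv : ∀ t', t' + t = deg r → (sg ^ t') s = r := by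
    intro t' h
    rw [← e, ← Equiv.Perm.mul_apply, ← pow_add, h, sgn_deg]
  have t0 : t ≠ 0 := by
    rintro rfl
    apply h6; rw [← e]; exact Eqv.refl _
  have hge := deg_ge r
  have hle : deg r ≤ 6 ∧ (¬ NF T → deg r ≤ 4) := by
    by_cases nf : NF T
    · exact ⟨nf.deg_le r, fun h => absurd nf h⟩
    · have : deg r ≤ 4 := by
        unfold NF at nf; push Not at nf
        obtain ⟨f, hf⟩ := nf
        rw [← dc f]; exact flat_deg_le hf
      exact ⟨by omega, fun _ => this⟩
  have h5' := h5.symm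
  have ds : deg s = deg r := dc s
  have hcase : deg r = 3 ∨ deg r = 4 ∨ deg r = 5 ∨ deg r = 6 := by omega
  rcases hcase with hk | hk | hk | hk
  · have : t = 1 ∨ t = 2 := by omega
    rcases this with rfl | rfl
    · have e1 : s = sg r := by rw [← e]; simp
      rw [e1] at h5 h6
      exact h6 (k3 hk h5)
    · have e1 : r = sg s := by have := inv 1 (by omega); rw [← this]; simp
      have h5'' : Hc c⁻¹ s (sg s) := by rw [← e1]; exact h5'
      have := k3 (ds.trans hk) h5''
      rw [← e1] at this
      exact h6 this.symm
  · have : t = 1 ∨ t = 2 ∨ t = 3 := by omega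
    have key : ∀ (c : ℂ) (r : D T), deg r = 4 → Hc c r (sg r) → Eqv r (sg r) := by
      intro c r hk h
      by_cases nf : NF T
      · exact k4_1 nf hk h
      · exact absurd (k4_flat hk nf h) hs
    rcases this with rfl | rfl | rfl
    · have e1 : s = sg r := by rw [← e]; simp
      rw [e1] at h5 h6
      exact h6 (key _ _ hk h5)
    · have e1 : s = sg (sg r) := by rw [← e]; rfl
      rw [e1] at h5 h6
      exact h6 (k4_2 hk h5)
    · have e1 : r = sg s := by have := inv 1 (by omega); rw [← this]; simp
      have h5'' : Hc c⁻¹ s (sg s) := by rw [← e1]; exact h5'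
      have := key _ _ (ds.trans hk) h5''
      rw [← e1] at this
      exact h6 this.symm
  · have nf : NF T := by by_contra hh; have := hle.2 hh; omega
    exact hs (k5 nf hk)
  · have nf : NF T := by by_contra hh; have := hle.2 hh; omega
    have hk' : ∀ e : D T, deg e = 6 := fun e => (dc e).trans hk
    by_cases ht3 : t ≤ 3
    · have ht' : (⟨t, by omega⟩ : Fin 6) = 1 ∨ (⟨t, by omega⟩ : Fin 6) = 2 ∨ (⟨t, by omega⟩ : Fin 6) = 3 := by
        have : t = 1 ∨ t = 2 ∨ t = 3 := by omega
        rcases this with rfl | rfl | rfl <;> simp [Fin.ext_iff]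
      rw [← e] at h5 h6 h3
      exact h6 (k6 nf hk' ht' h5 h1 (by rw [h2]; exact Eqv.refl _) h3)
    · obtain ⟨u, hu⟩ : ∃ u, u = 6 - t := ⟨_, rfl⟩
      have ht' : (⟨u, by omega⟩ : Fin 6) = 1 ∨ (⟨u, by omega⟩ : Fin 6) = 2 ∨ (⟨u, by omega⟩ : Fin 6) = 3 := by
        have : u = 1 ∨ u = 2 ∨ u = 3 := by omega
        rcases this with rfl | rfl | rfl <;> simp [Fin.ext_iff]
      have e1 := inv u (by omega)
      rw [← e1] at h5'
      have := k6 nf hk' ht' h5' h1.symm h3.symm (by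
        rw [h2]; change Eqv r ((sg ^ u) s); rw [e1]; exact Eqv.refl _)
      change Eqv s ((sg ^ u) s) at this
      rw [e1] at this
      exact h6 this.symm

end
end MC

namespace MC

/-- the identification of the Euclidean plane with the complex numbers -/
def phi : E2 ≃ₗᵢ[ℝ] ℂ := Complex.orthonormalBasisOneI.repr.symm

/-- transported tiling -/
def TC (T : Set (Set E2)) : Set (Set ℂ) := (fun P => phi '' P) '' T

lemma phi_ext (P : Set E2) : phi '' (Set.extremePoints ℝ P) = Set.extremePoints ℝ (phi '' P) :=
  image_extremePoints phi P

lemma phi_int (P : Set E2) : interior (phi '' P) = phi '' interior P :=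
  (phi.toHomeomorph.image_interior P).symm

lemma direct_form (f : E2 ≃ᵃⁱ[ℝ] E2) (hf : OrientationPreserving f) :
    ∃ a : ℂ, ‖a‖ = 1 ∧ ∀ z x : E2, phi (f z) = mv a (phi x) (phi (f x)) (phi z) := by
  let g : ℂ ≃ₗᵢ[ℝ] ℂ := (phi.symm.trans f.linearIsometryEquiv).trans phi
  have hg : LinearMap.det (g.toLinearEquiv : ℂ →ₗ[ℝ] ℂ) = 1 := by
    have := LinearMap.det_conj (f.linearIsometryEquiv.toLinearEquiv : E2 →ₗ[ℝ] E2) phi.toLinearEquiv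
    rw [hf] at this
    rw [← this]
    rfl
  obtain ⟨a, ha | ha⟩ := linear_isometry_complex g
  · refine ⟨(a : ℂ), Circle.norm_coe a, ?_⟩
    intro z x
    have h1 : g (phi z - phi x) = a * (phi z - phi x) := by rw [ha, rotation_apply]
    have h2 : g (phi z - phi x) = phi (f z) - phi (f x) := by
      rw [← map_sub]
      change phi (f.linearIsometryEquiv (phi.symm (phi (z - x)))) = _
      rw [phi.symm_apply_apply, ← map_sub]
      congr 1
      have := f.map_vsub z x
      simpa using this
    unfold mv
    rw [← h1, h2]; ring
  · exfalso
    have e : (g.toLinearEquiv : ℂ →ₗ[ℝ] ℂ) = ((rotation a).toLinearEquiv : ℂ →ₗ[ℝ] ℂ) ∘ₗ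
        (Complex.conjLIE.toLinearEquiv : ℂ →ₗ[ℝ] ℂ) := by rw [ha]; rfl
    rw [e, LinearMap.det_comp, det_rotation, Complex.det_conjLIE] at hg
    norm_num at hg

lemma til_TC {T : Set (Set E2)} (hT : IsTiling T) (hmc : MonocoronalRM T) : Til (TC T) where
  cpt := by
    rintro _ ⟨P, hP, rfl⟩
    exact (hT.2.1 P hP).1.image phi.continuous
  cvx := by
    rintro _ ⟨P, hP, rfl⟩
    exact (hT.2.1 P hP).2.1.linear_image phi.toLinearEquiv.toLinearMap
  int := by
    rintro _ ⟨P, hP, rfl⟩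
    dsimp only
    rw [phi_int]
    exact (hT.2.1 P hP).2.2.1.image _
  fin := by
    rintro _ ⟨P, hP, rfl⟩
    dsimp only
    rw [← phi_ext]
    exact (hT.2.1 P hP).2.2.2.image _
  cov := by
    intro z
    have h1 : phi.symm z ∈ ⋃₀ T := by rw [hT.2.2.1]; trivial
    obtain ⟨P, hP, hz⟩ := h1
    exact ⟨_, ⟨P, hP, rfl⟩, ⟨_, hz, by simp⟩⟩
  dis := by
    rintro _ ⟨P, hP, rfl⟩ _ ⟨Q, hQ, rfl⟩ z h1 h2
    dsimp only at h1 h2 ⊢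
    rw [phi_int] at h1 h2
    obtain ⟨p, hp, rfl⟩ := h1
    obtain ⟨q, hq, e⟩ := h2
    rw [phi.injective e] at hq
    by_contra hne
    have : P ≠ Q := by rintro rfl; exact hne rfl
    exact Set.disjoint_left.1 (hT.2.2.2 hP hQ this) hp hq
  mono := by
    rintro x ⟨_, ⟨P, hP, rfl⟩, hx⟩ y ⟨_, ⟨Q, hQ, rfl⟩, hy⟩
    dsimp only at hx hy
    rw [← phi_ext] at hx hy
    obtain ⟨p, hp, rfl⟩ := hx
    obtain ⟨q, hq, rfl⟩ := hy
    obtain ⟨f, f1, f2, f3⟩ := hmc p q ⟨P, hP, hp⟩ ⟨Q, hQ, hq⟩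
    obtain ⟨a, ha, hf⟩ := direct_form f f1
    have hcor : ∀ p : E2, Cor (TC T) (phi p) = (fun P => phi '' P) '' {P | P ∈ T ∧ p ∈ P} := by
      intro p
      ext R
      constructor
      · rintro ⟨⟨P, hP, rfl⟩, hp⟩
        exact ⟨P, ⟨hP, (phi.injective.mem_set_image).1 hp⟩, rfl⟩
      · rintro ⟨P, ⟨hP, hp⟩, rfl⟩
        exact ⟨⟨P, hP, rfl⟩, mem_image_of_mem _ hp⟩
    refine ⟨a, ha, ?_⟩
    rw [hcor, hcor, ← f3, Set.image_image, Set.image_image]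
    congr 1
    funext P
    rw [Set.image_image, Set.image_image]
    congr 1
    funext z
    rw [hf z p, f2]

lemma per_TC {T : Set (Set E2)} {v : ℂ} (hv : v ∈ Per (TC T)) : phi.symm v ∈ periodVectors T := by
  have h1 := hv.2
  change (fun P => _ '' P) '' T = T
  have inj : Function.Injective (fun P : Set E2 => phi '' P) := phi.injective.image_injective
  apply inj.image_injective
  change _ = TC T
  rw [← h1, Set.image_image]
  unfold TC
  rw [Set.image_image]
  congr 1
  funext P
  rw [Set.image_image, Set.image_image]
  congr 1
  funext z
  simp [add_comm]

theorem main (T : Set (Set E2)) (hT : IsTiling T) (hmc : MonocoronalRM T) :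
    Module.finrank ℝ (Submodule.span ℝ (periodVectors T)) = 2 := by
  haveI := til_TC hT hmc
  have h1 := Star.span (T := TC T) star_T
  have h2 : Submodule.span ℝ (periodVectors T) = ⊤ := by
    rw [eq_top_iff]
    have h3 : Submodule.map (phi.symm.toLinearEquiv : ℂ →ₗ[ℝ] E2) (Submodule.span ℝ (Per (TC T))) = ⊤ := by
      rw [h1, Submodule.map_top, LinearMap.range_eq_top]
      exact phi.symm.surjective
    rw [← h3, Submodule.map_span]
    apply Submodule.span_mono
    rintro _ ⟨v, hv, rfl⟩
    exact per_TC hv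
  rw [h2, finrank_top]
  simp

end MC

/-- Every monocoronal (up to rigid motions) tiling of the plane by convex polygons
is crystallographic, i.e. 2-periodic. -/
theorem monocoronalRM_crystallographic (T : Set (Set E2)) (hT : IsTiling T)
    (hmc : MonocoronalRM T) :
    Module.finrank ℝ (Submodule.span ℝ (periodVectors T)) = 2 := by
  exact MC.main T hT hmc
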